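/- arXiv:1405.1687 — 4 statements merged into one kernel-verified Lean document; each statement's English description precedes it below -/
import Mathlib

section
/- For every integer q ≥ 1, the Reeve tetrahedron reeve(q) = conv{(0,0,0), (0,0,1), (0,1,0), (q,1,1)} ⊂ ℝ³ contains no lattice points other than its four vertices, and its Euclidean volume equals q/6; consequently, for q > 1 the tetrahedron reeve(q) admits no unimodular triangulation. -/
/-- `x` is a point of the standard lattice `ℤ^d ⊆ ℝ^d`. -/
def Zd {d : ℕ} (x : Fin d → ℝ) : Prop := ∀ i, ∃ z : ℤ, x i = (z : ℝ)

/-- `x` lies in the affine lattice generated (over `ℤ`) by the finite point set `F`. -/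
def InAffLat {E : Type*} [AddCommGroup E] [Module ℝ E] (F : Finset E) (x : E) : Prop :=
  ∃ c : E → ℤ, (∀ a, a ∉ F → c a = 0) ∧ (∑ a ∈ F, c a) = 1 ∧ (∑ a ∈ F, (c a : ℝ) • a) = x

/-- `F` is the vertex set of a unimodular simplex with respect to the lattice predicate `L`:
its vertices are affinely independent lattice points which affinely generate every lattice
point of their affine span. -/
def UnimodularFinset {E : Type*} [AddCommGroup E] [Module ℝ E] (L : E → Prop)
    (F : Finset E) : Prop :=
  (∀ a ∈ F, L a) ∧ AffineIndependent ℝ (fun p : F => (p : E)) ∧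
    ∀ x, L x → x ∈ affineSpan ℝ (F : Set E) → InAffLat F x

/-- A (geometric) triangulation of the set `P`, recorded by the vertex sets of its faces:
faces are affinely independent, the collection is closed under taking subsets, convex hulls
of faces intersect in the convex hull of the common vertices, and the faces cover `P`. -/
def IsTriangulation {E : Type*} [AddCommGroup E] [Module ℝ E]
    (P : Set E) (T : Finset (Finset E)) : Prop :=
  (∀ F ∈ T, AffineIndependent ℝ (fun p : F => (p : E))) ∧
  (∀ F ∈ T, ∀ G, G ⊆ F → G ∈ T) ∧
  (∀ F ∈ T, ∀ G ∈ T,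
    convexHull ℝ (F : Set E) ∩ convexHull ℝ (G : Set E) =
      convexHull ℝ ((F : Set E) ∩ (G : Set E))) ∧
  (⋃ F ∈ T, convexHull ℝ (F : Set E)) = P

/-- `F` is a maximal cell of the triangulation `T`. -/
def MaxCell {E : Type*} (T : Finset (Finset E)) (F : Finset E) : Prop :=
  F ∈ T ∧ ∀ G ∈ T, F ⊆ G → G = F

/-- A triangulation is unimodular when all of its maximal cells are unimodular simplices. -/
def IsUnimodular {E : Type*} [AddCommGroup E] [Module ℝ E] (L : E → Prop)
    (T : Finset (Finset E)) : Prop :=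
  ∀ F, MaxCell T F → UnimodularFinset L F

/-- A triangulation is regular when its maximal cells are the domains of linearity of a
piecewise linear convex function on `P`. -/
def IsRegularTri {E : Type*} [AddCommGroup E] [Module ℝ E]
    (P : Set E) (T : Finset (Finset E)) : Prop :=
  ∃ f : E → ℝ, ConvexOn ℝ P f ∧
    (∀ F, MaxCell T F → ∃ g : E →ᵃ[ℝ] ℝ, Set.EqOn f (⇑g) (convexHull ℝ (F : Set E))) ∧
    (∀ F G, MaxCell T F → MaxCell T G → F ≠ G →
      ¬ ∃ g : E →ᵃ[ℝ] ℝ,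
        Set.EqOn f (⇑g) (convexHull ℝ (F : Set E) ∪ convexHull ℝ (G : Set E)))

/-- `N` is a minimal non-face of the triangulation `T`: a set of vertices of `T` which is
not a face, all of whose proper subsets are faces. -/
def MinNonFace {E : Type*} (T : Finset (Finset E)) (N : Finset E) : Prop :=
  (∀ x ∈ N, ({x} : Finset E) ∈ T) ∧ N ∉ T ∧ ∀ M, M ⊂ N → M ∈ T

/-- A triangulation is flag when all of its minimal non-faces have exactly two elements. -/
def IsFlag {E : Type*} (T : Finset (Finset E)) : Prop :=
  ∀ N, MinNonFace T N → N.card = 2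

/-- A triangulation of `P` is full when every lattice point of `P` is one of its vertices. -/
def IsFull {E : Type*} (L : E → Prop) (P : Set E) (T : Finset (Finset E)) : Prop :=
  ∀ x ∈ P, L x → ({x} : Finset E) ∈ T

/-- `P` is a lattice polytope with respect to the lattice predicate `L`. -/
def IsLatticePolytope {E : Type*} [AddCommGroup E] [Module ℝ E] (L : E → Prop)
    (P : Set E) : Prop :=
  ∃ V : Finset E, V.Nonempty ∧ (∀ v ∈ V, L v) ∧ P = convexHull ℝ (V : Set E)

open MeasureTheory in
/-- The corner simplex `{x ≥ 0, ∑ xᵢ ≤ t}` in `ℝⁿ` has volume `tⁿ / n!`. -/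
theorem volume_cornerSimplex (n : ℕ) : ∀ t : ℝ, 0 ≤ t →
    volume {x : Fin n → ℝ | (∀ i, 0 ≤ x i) ∧ ∑ i, x i ≤ t} =
      ENNReal.ofReal (t ^ n / n.factorial) := by
  induction n with
  | zero =>
    intro t ht
    simp [ht, volume_pi]
  | succ n ih =>
    intro t ht
    have hmeas : MeasurableSet
        {p : ℝ × (Fin n → ℝ) | (0 ≤ p.1 ∧ ∀ i, 0 ≤ p.2 i) ∧ p.1 + ∑ i, p.2 i ≤ t} := by
      refine IsClosed.measurableSet ?_
      have hsum : Continuous fun p : ℝ × (Fin n → ℝ) => p.1 + ∑ i, p.2 i := by fun_prop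
      refine ((isClosed_le continuous_const continuous_fst).inter ?_).inter
        (isClosed_le hsum continuous_const)
      change IsClosed {p : ℝ × (Fin n → ℝ) | ∀ i, 0 ≤ p.2 i}
      rw [Set.ofPred_forall]
      exact isClosed_iInter fun i =>
        isClosed_le continuous_const ((continuous_apply i).comp continuous_snd)
    have hpre := (volume_preserving_piFinSuccAbove (fun _ : Fin (n + 1) => ℝ) 0).measure_preimage
      hmeas.nullMeasurableSet
    have hset : MeasurableEquiv.piFinSuccAbove (fun _ : Fin (n + 1) => ℝ) 0 ⁻¹'
          {p : ℝ × (Fin n → ℝ) | (0 ≤ p.1 ∧ ∀ i, 0 ≤ p.2 i) ∧ p.1 + ∑ i, p.2 i ≤ t} =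
        {x : Fin (n + 1) → ℝ | (∀ i, 0 ≤ x i) ∧ ∑ i, x i ≤ t} := by
      ext x
      simp [MeasurableEquiv.piFinSuccAbove, Fin.insertNthEquiv, Fin.forall_fin_succ,
        Fin.sum_univ_succ, Fin.tail]
    rw [← hset, hpre, Measure.volume_eq_prod, Measure.prod_apply hmeas]
    have hsec : ∀ y : ℝ, volume (Prod.mk y ⁻¹'
          {p : ℝ × (Fin n → ℝ) | (0 ≤ p.1 ∧ ∀ i, 0 ≤ p.2 i) ∧ p.1 + ∑ i, p.2 i ≤ t}) =
        (Set.Icc 0 t).indicator (fun y => ENNReal.ofReal ((t - y) ^ n / n.factorial)) y := by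
      intro y
      by_cases hy : y ∈ Set.Icc 0 t
      · rw [Set.indicator_of_mem hy, ← ih _ (sub_nonneg.2 hy.2)]
        congr 1
        ext x
        simp [hy.1, le_sub_iff_add_le']
      · rw [Set.indicator_of_notMem hy]
        convert measure_empty (μ := (volume : Measure (Fin n → ℝ)))
        refine Set.eq_empty_of_forall_notMem fun x hx => hy ⟨hx.1.1, ?_⟩
        have := Finset.sum_nonneg fun i (_ : i ∈ Finset.univ) => hx.1.2 i
        linarith [show y + ∑ i, x i ≤ t from hx.2]
    simp_rw [hsec]
    rw [lintegral_indicator measurableSet_Icc, ← ofReal_integral_eq_lintegral_ofReal]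
    · congr 1
      rw [integral_Icc_eq_integral_Ioc, ← intervalIntegral.integral_of_le ht,
        intervalIntegral.integral_div,
        intervalIntegral.integral_comp_sub_left (fun y => y ^ n) t, integral_pow]
      simp only [sub_self, sub_zero, Nat.factorial_succ]
      push_cast
      simp [div_div]
    · exact (Continuous.continuousOn (by fun_prop)).integrableOn_compact isCompact_Icc
    · filter_upwards [ae_restrict_mem measurableSet_Icc] with y hy
      have := sub_nonneg.2 hy.2
      positivity

/-- Facet description of the Reeve tetrahedron. -/
theorem convexHull_reeve_eq {q : ℝ} (hq : 0 < q) :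
    convexHull ℝ ({![0, 0, 0], ![0, 0, 1], ![0, 1, 0], ![q, 1, 1]} : Set (Fin 3 → ℝ)) =
      {x | 0 ≤ x 0 / q ∧ 0 ≤ x 1 - x 0 / q ∧ 0 ≤ x 2 - x 0 / q ∧ x 1 + x 2 - x 0 / q ≤ 1} := by
  apply Set.Subset.antisymm
  · apply convexHull_min
    · rintro x (rfl | rfl | rfl | rfl) <;> simp [hq.ne']
    · rintro x ⟨hx0, hx1, hx2, hx3⟩ y ⟨hy0, hy1, hy2, hy3⟩ a b ha hb hab
      simp only [Set.mem_ofPred_eq, Pi.add_apply, Pi.smul_apply, smul_eq_mul, add_div,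
        mul_div_assoc]
      refine ⟨?_, ?_, ?_, ?_⟩ <;> nlinarith
  · rintro x ⟨hx0, hx1, hx2, hx3⟩
    have h := (convex_convexHull ℝ
      ({![0, 0, 0], ![0, 0, 1], ![0, 1, 0], ![q, 1, 1]} : Set (Fin 3 → ℝ))).sum_mem
      (t := Finset.univ)
      (w := ![1 - (x 1 + x 2 - x 0 / q), x 2 - x 0 / q, x 1 - x 0 / q, x 0 / q])
      (z := ![![0, 0, 0], ![0, 0, 1], ![0, 1, 0], ![q, 1, 1]])
      (by intro i _; fin_cases i <;> simp <;> linarith)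
      (by simp [Fin.sum_univ_four]; ring)
      (by intro i _; apply subset_convexHull; fin_cases i <;> simp)
    convert h using 1
    ext i
    fin_cases i <;> simp [Fin.sum_univ_four, hq.ne']

open MeasureTheory in
theorem volume_convexHull_reeve {q : ℝ} (hq : 0 < q) :
    volume (convexHull ℝ
      ({![0, 0, 0], ![0, 0, 1], ![0, 1, 0], ![q, 1, 1]} : Set (Fin 3 → ℝ))) =
      ENNReal.ofReal (q / 6) := by
  let M : Matrix (Fin 3) (Fin 3) ℝ := !![1 / q, 0, 0; -1 / q, 1, 0; -1 / q, 0, 1]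
  have hdet : LinearMap.det (Matrix.toLin' M) = 1 / q := by
    simp [M, Matrix.det_fin_three]
  have hset : convexHull ℝ
      ({![0, 0, 0], ![0, 0, 1], ![0, 1, 0], ![q, 1, 1]} : Set (Fin 3 → ℝ)) =
      Matrix.toLin' M ⁻¹' {x : Fin 3 → ℝ | (∀ i, 0 ≤ x i) ∧ ∑ i, x i ≤ 1} := by
    rw [convexHull_reeve_eq hq]
    ext x
    have e0 : Matrix.toLin' M x 0 = x 0 / q := by
      simp [M, Matrix.toLin'_apply, Matrix.mulVec, dotProduct, Fin.sum_univ_three]; ring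
    have e1 : Matrix.toLin' M x 1 = x 1 - x 0 / q := by
      simp [M, Matrix.toLin'_apply, Matrix.mulVec, dotProduct, Fin.sum_univ_three]; ring
    have e2 : Matrix.toLin' M x 2 = x 2 - x 0 / q := by
      simp [M, Matrix.toLin'_apply, Matrix.mulVec, dotProduct, Fin.sum_univ_three]; ring
    simp only [Set.mem_preimage, Set.mem_ofPred_eq, Fin.forall_fin_succ, Fin.sum_univ_three,
      e0, e1, e2, Fin.succ_zero_eq_one, Fin.succ_one_eq_two, IsEmpty.forall_iff, and_true,
      and_assoc]
    have e : x 0 / q + (x 1 - x 0 / q) + (x 2 - x 0 / q) = x 1 + x 2 - x 0 / q := by ring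
    rw [e]
  rw [hset, Measure.addHaar_preimage_linearMap _ (by rw [hdet]; positivity),
    volume_cornerSimplex 3 1 zero_le_one, hdet, ← ENNReal.ofReal_mul (abs_nonneg _)]
  congr 1
  rw [one_div, inv_inv, abs_of_pos hq]
  norm_num [Nat.factorial]
  ring

/-- The Reeve tetrahedron is an empty lattice simplex. -/
theorem mem_vertices_of_mem_convexHull_reeve {q : ℝ} (hq : 0 < q) {x : Fin 3 → ℝ}
    (hx : x ∈ convexHull ℝ
      ({![0, 0, 0], ![0, 0, 1], ![0, 1, 0], ![q, 1, 1]} : Set (Fin 3 → ℝ))) (hZ : Zd x) :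
    x ∈ ({![0, 0, 0], ![0, 0, 1], ![0, 1, 0], ![q, 1, 1]} : Set (Fin 3 → ℝ)) := by
  rw [convexHull_reeve_eq hq] at hx
  obtain ⟨h0, h1, h2, h3⟩ := hx
  obtain ⟨m, hm⟩ := hZ 1
  obtain ⟨n, hn⟩ := hZ 2
  have hx0 : x 0 = x 0 / q * q := by field_simp
  generalize x 0 / q = d at *
  have hm0 : 0 ≤ m := by exact_mod_cast (by linarith : (0 : ℝ) ≤ m)
  have hn0 : 0 ≤ n := by exact_mod_cast (by linarith : (0 : ℝ) ≤ n)
  have hm1 : m ≤ 1 := by exact_mod_cast (by linarith : (m : ℝ) ≤ 1)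
  have hn1 : n ≤ 1 := by exact_mod_cast (by linarith : (n : ℝ) ≤ 1)
  have hx : x = ![x 0, x 1, x 2] := by ext i; fin_cases i <;> rfl
  rw [hx, hx0, hm, hn]
  rw [hm, hn] at h3
  rw [hm] at h1
  rw [hn] at h2
  interval_cases m <;> interval_cases n <;> norm_num at h1 h2 h3
  · simp [le_antisymm h1 h0]
  · simp [le_antisymm h1 h0]
  · simp [le_antisymm h2 h0]
  · have hd : d = 1 := by linarith
    simp [hd]

/-- A set of vertices of the Reeve tetrahedron whose convex hull contains the barycentre consists
of all four vertices. -/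
theorem reeve_vertices_subset_of_barycenter_mem {q : ℝ} (hq : 0 < q) {F : Set (Fin 3 → ℝ)}
    (hF : F ⊆ {![0, 0, 0], ![0, 0, 1], ![0, 1, 0], ![q, 1, 1]})
    (hb : ![q / 4, 1 / 2, 1 / 2] ∈ convexHull ℝ F) :
    {![0, 0, 0], ![0, 0, 1], ![0, 1, 0], ![q, 1, 1]} ⊆ F := by
  have key : ∀ (l : (Fin 3 → ℝ) →ₗ[ℝ] ℝ) (c : ℝ), (∀ y ∈ F, c ≤ l y) →
      c ≤ l ![q / 4, 1 / 2, 1 / 2] := fun l c h =>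
    convexHull_min h (convex_halfSpace_ge l.isLinear c) hb
  let p : Fin 3 → (Fin 3 → ℝ) →ₗ[ℝ] ℝ := fun i => LinearMap.proj i
  rintro v (rfl | rfl | rfl | rfl) <;> by_contra hv
  · have := key (p 1 + p 2 - q⁻¹ • p 0) 1 fun y hy => by
      have hne : y ≠ ![0, 0, 0] := fun h => hv (h ▸ hy)
      rcases hF hy with rfl | rfl | rfl | rfl <;> simp [p, hq.ne'] at hne ⊢
    simp [p] at this
    field_simp at this
    linarith
  · have := key (q⁻¹ • p 0 - p 2) 0 fun y hy => by
      have hne : y ≠ ![0, 0, 1] := fun h => hv (h ▸ hy)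
      rcases hF hy with rfl | rfl | rfl | rfl <;> simp [p, hq.ne'] at hne ⊢
    simp [p] at this
    field_simp at this
    linarith
  · have := key (q⁻¹ • p 0 - p 1) 0 fun y hy => by
      have hne : y ≠ ![0, 1, 0] := fun h => hv (h ▸ hy)
      rcases hF hy with rfl | rfl | rfl | rfl <;> simp [p, hq.ne'] at hne ⊢
    simp [p] at this
    field_simp at this
    linarith
  · have := key (-p 0) 0 fun y hy => by
      have hne : y ≠ ![q, 1, 1] := fun h => hv (h ▸ hy)
      rcases hF hy with rfl | rfl | rfl | rfl <;> simp [p] at hne ⊢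
    simp [p] at this
    linarith

/-- The vertices of the Reeve tetrahedron affinely generate only lattice points whose first
coordinate is divisible by `q`. -/
theorem not_unimodularFinset_reeve {q : ℕ} (hq : 1 < q) {F : Finset (Fin 3 → ℝ)}
    (hF : (F : Set (Fin 3 → ℝ)) = {![0, 0, 0], ![0, 0, 1], ![0, 1, 0], ![(q : ℝ), 1, 1]}) :
    ¬ UnimodularFinset Zd F := by
  rintro ⟨-, -, hgen⟩
  have hq0 : (0 : ℝ) < q := by exact_mod_cast (by omega : 0 < q)
  have hx0 : ∀ a ∈ F, a 0 = 0 ∨ a 0 = q := by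
    intro a ha
    have ha' : a ∈ (F : Set (Fin 3 → ℝ)) := ha
    rw [hF] at ha'
    rcases ha' with rfl | rfl | rfl | rfl <;> simp
  have hZ : Zd (![1, 0, 0] : Fin 3 → ℝ) := by
    intro i
    fin_cases i
    exacts [⟨1, by simp⟩, ⟨0, by simp⟩, ⟨0, by simp⟩]
  have hspan : ![1, 0, 0] ∈ affineSpan ℝ (F : Set (Fin 3 → ℝ)) := by
    rw [hF]
    set S : Set (Fin 3 → ℝ) := {![0, 0, 0], ![0, 0, 1], ![0, 1, 0], ![(q : ℝ), 1, 1]} with hS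
    have h0 : (0 : Fin 3 → ℝ) ∈ S := Or.inl (by ext i; fin_cases i <;> rfl)
    have hdir : ∀ v ∈ S, v ∈ (affineSpan ℝ S).direction := fun v hv => by
      simpa using AffineSubspace.vsub_mem_direction (mem_affineSpan ℝ hv) (mem_affineSpan ℝ h0)
    have h1 := hdir ![0, 0, 1] (by simp [hS])
    have h2 := hdir ![0, 1, 0] (by simp [hS])
    have h3 := hdir ![(q : ℝ), 1, 1] (by simp [hS])
    have h := AffineSubspace.vadd_mem_of_mem_direction
      (Submodule.smul_mem _ (q : ℝ)⁻¹ (Submodule.sub_mem _ (Submodule.sub_mem _ h3 h2) h1))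
      (mem_affineSpan ℝ h0)
    convert h using 1
    ext i
    fin_cases i <;> simp [hq0.ne']
  obtain ⟨c, -, -, hc⟩ := hgen _ hZ hspan
  have h := congrFun hc 0
  rw [Finset.sum_apply] at h
  have hdvd : ∃ k : ℤ, ∑ a ∈ F, ((c a : ℝ) • a) 0 = q * k := by
    refine Finset.sum_induction _ (fun r : ℝ => ∃ k : ℤ, r = q * k) ?_ ⟨0, by simp⟩ ?_
    · rintro _ _ ⟨k, rfl⟩ ⟨l, rfl⟩
      exact ⟨k + l, by push_cast; ring⟩
    · intro a ha
      rcases hx0 a ha with h | h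
      · exact ⟨0, by simp [h]⟩
      · exact ⟨c a, by simp [h, mul_comm]⟩
  obtain ⟨k, hk⟩ := hdvd
  rw [h] at hk
  have hk' : (1 : ℤ) = q * k := by exact_mod_cast (by simpa using hk : (1 : ℝ) = q * k)
  have := Int.le_of_dvd one_pos ⟨k, hk'⟩
  omega

/-- Every face of a finite family of finite sets is contained in a maximal one. -/
theorem exists_maxCell_superset {E : Type*} {T : Finset (Finset E)} {F : Finset E} (hF : F ∈ T) :
    ∃ G, MaxCell T G ∧ F ⊆ G := by
  obtain ⟨G, hFG, hG⟩ := T.exists_le_maximal hF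
  exact ⟨G, ⟨hG.1, fun H hH hGH => (hG.eq_of_le hH hGH).symm⟩, hFG⟩


open MeasureTheory in
/-- **Reeve's tetrahedra.** For `q ≥ 1`, the tetrahedron
`reeve(q) = conv{(0,0,0),(0,0,1),(0,1,0),(q,1,1)}` contains no lattice point besides its
four vertices, its Euclidean volume is `q/6`, and for `q > 1` it admits no unimodular
triangulation. -/
theorem reeve_tetrahedron (q : ℕ) (hq : 1 ≤ q) :
    (∀ x ∈ convexHull ℝ
        ({![0, 0, 0], ![0, 0, 1], ![0, 1, 0], ![(q : ℝ), 1, 1]} : Set (Fin 3 → ℝ)), Zd x →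
      x ∈ ({![0, 0, 0], ![0, 0, 1], ![0, 1, 0], ![(q : ℝ), 1, 1]} : Set (Fin 3 → ℝ))) ∧
    volume (convexHull ℝ
        ({![0, 0, 0], ![0, 0, 1], ![0, 1, 0], ![(q : ℝ), 1, 1]} : Set (Fin 3 → ℝ))) =
      ENNReal.ofReal ((q : ℝ) / 6) ∧
    (1 < q →
      ¬ ∃ T : Finset (Finset (Fin 3 → ℝ)),
          IsTriangulation (convexHull ℝ
            ({![0, 0, 0], ![0, 0, 1], ![0, 1, 0], ![(q : ℝ), 1, 1]} : Set (Fin 3 → ℝ))) T ∧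
          IsUnimodular Zd T) := by
  have hq0 : (0 : ℝ) < q := by exact_mod_cast hq
  refine ⟨fun x hx hZ => mem_vertices_of_mem_convexHull_reeve hq0 hx hZ,
    volume_convexHull_reeve hq0, ?_⟩
  rintro hq1 ⟨T, ⟨-, -, -, hcover⟩, hU⟩
  have hb : ![(q : ℝ) / 4, 1 / 2, 1 / 2] ∈ ⋃ F ∈ T, convexHull ℝ (F : Set (Fin 3 → ℝ)) := by
    rw [hcover, convexHull_reeve_eq hq0]
    have e : (q : ℝ) / 4 / q = 1 / 4 := by field_simp
    refine ⟨?_, ?_, ?_, ?_⟩ <;> simp [e] <;> norm_num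
  simp only [Set.mem_iUnion] at hb
  obtain ⟨F, hF, hbF⟩ := hb
  obtain ⟨G, hG, hFG⟩ := exists_maxCell_superset hF
  have hGV : (G : Set (Fin 3 → ℝ)) ⊆
      {![0, 0, 0], ![0, 0, 1], ![0, 1, 0], ![(q : ℝ), 1, 1]} := by
    intro v hv
    refine mem_vertices_of_mem_convexHull_reeve hq0 ?_ ((hU G hG).1 v hv)
    rw [← hcover]
    exact Set.mem_biUnion hG.1 (subset_convexHull ℝ _ hv)
  exact not_unimodularFinset_reeve hq1 (hGV.antisymm
    (reeve_vertices_subset_of_barycenter_mem hq0 hGV (convexHull_mono hFG hbF))) (hU G hG)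
end

section
/- Let P ⊂ ℝ^d be a facet unimodular lattice polytope, i.e. the collection of primitive facet normals of P forms a unimodular matrix. Then: (1) the canonical subdivision of P, obtained by slicing P along all hyperplanes {x : ⟨n_i, x⟩ = k} for facet normals n_i and integers k, is a regular lattice subdivision all of whose cells are compressed; (2) P has a regular unimodular triangulation. -/
/-- `F` is a face of the convex set `Q` (the improper face `Q` and the empty face included),
cut out by a linear functional maximized on `Q` along `F`. -/
def FaceOf {E : Type*} [AddCommGroup E] [Module ℝ E] (Q F : Set E) : Prop :=
  F = Q ∨ ∃ (l : E →ₗ[ℝ] ℝ) (c : ℝ), (∀ x ∈ Q, l x ≤ c) ∧ F = {x ∈ Q | l x = c}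

/-- `F` is a facet of `Q`: a maximal nonempty proper face. -/
def FacetOf {E : Type*} [AddCommGroup E] [Module ℝ E] (Q F : Set E) : Prop :=
  FaceOf Q F ∧ F.Nonempty ∧ F ≠ Q ∧ ∀ G, FaceOf Q G → G ≠ Q → F ⊆ G → G = F

/-- `C` is a polytope: the convex hull of a finite point set. -/
def IsPolytope {E : Type*} [AddCommGroup E] [Module ℝ E] (C : Set E) : Prop :=
  ∃ V : Finset E, C = convexHull ℝ (V : Set E)

/-- A polyhedral subdivision of `P`: a finite collection of polytopes, closed under taking
nonempty faces, any two members meeting in a common face, whose union is `P`. -/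
def IsSubdivision {E : Type*} [AddCommGroup E] [Module ℝ E]
    (P : Set E) (S : Finset (Set E)) : Prop :=
  (∀ C ∈ S, IsPolytope C) ∧
  (∀ C ∈ S, ∀ F, FaceOf C F → F.Nonempty → F ∈ S) ∧
  (∀ C ∈ S, ∀ D ∈ S, FaceOf C (C ∩ D) ∧ FaceOf D (C ∩ D)) ∧
  ⋃₀ (↑S : Set (Set E)) = P

/-- `C` is a maximal cell of the subdivision `S`. -/
def MaxCellS {E : Type*} (S : Finset (Set E)) (C : Set E) : Prop :=
  C ∈ S ∧ ∀ D ∈ S, C ⊆ D → D = C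

/-- A subdivision is regular when its maximal cells are the domains of linearity of a
piecewise linear convex function on `P`. -/
def IsRegularSubdivision {E : Type*} [AddCommGroup E] [Module ℝ E]
    (P : Set E) (S : Finset (Set E)) : Prop :=
  ∃ f : E → ℝ, ConvexOn ℝ P f ∧
    (∀ C, MaxCellS S C → ∃ g : E →ᵃ[ℝ] ℝ, Set.EqOn f (⇑g) C) ∧
    (∀ C D, MaxCellS S C → MaxCellS S D → C ≠ D →
      ¬ ∃ g : E →ᵃ[ℝ] ℝ, Set.EqOn f (⇑g) (C ∪ D))

/-- `C` is a simplex: the convex hull of an affinely independent finite point set. -/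
def IsSimplexSet {E : Type*} [AddCommGroup E] [Module ℝ E] (C : Set E) : Prop :=
  ∃ V : Finset E, AffineIndependent ℝ (fun p : V => (p : E)) ∧ C = convexHull ℝ (V : Set E)

/-- `C` is a unimodular simplex for the lattice predicate `L`. -/
def UnimodularSimplexSet {E : Type*} [AddCommGroup E] [Module ℝ E] (L : E → Prop)
    (C : Set E) : Prop :=
  ∃ V : Finset E, UnimodularFinset L V ∧ C = convexHull ℝ (V : Set E)

/-- `S'` is the strong pulling refinement of the subdivision `S` at the point `m`: every
face `F ∈ S` containing `m` is replaced by the pyramids `conv({m} ∪ F')` over the faces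
`F'` of `F` which do not contain `m`. -/
def IsStrongPulling {E : Type*} [AddCommGroup E] [Module ℝ E]
    (m : E) (S S' : Finset (Set E)) : Prop :=
  ∀ C : Set E, C ∈ S' ↔
    ((C ∈ S ∧ m ∉ C) ∨
      ∃ F ∈ S, m ∈ F ∧ ∃ F' : Set E, FaceOf F F' ∧ m ∉ F' ∧
        C = convexHull ℝ (insert m F'))

/-- The pairing of an integral normal vector `y` with a point `x` of `ℝ^d`. -/
def dotZ {d : ℕ} (y : Fin d → ℤ) (x : Fin d → ℝ) : ℝ := ∑ i, (y i : ℝ) * x i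

/-- `Q` is compressed, i.e. `Q` has width one with respect to each of its facets. -/
def IsCompressedW {d : ℕ} (Q : Set (Fin d → ℝ)) : Prop :=
  IsLatticePolytope Zd Q ∧
    ∀ (y : Fin d → ℤ) (c : ℝ) (F : Set (Fin d → ℝ)),
      Finset.univ.gcd (fun i => (y i).natAbs) = 1 →
      FacetOf Q F → F = {x ∈ Q | dotZ y x = c} → (∀ x ∈ Q, c ≤ dotZ y x) →
      ∀ x ∈ Q, dotZ y x ≤ c + 1

/-- Farkas' lemma for finitely generated cones. -/
theorem farkas_finset {W ι : Type*} [AddCommGroup W] [Module ℝ W] (B : Finset ι)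
    (p : ι → W) (x : W) :
    (∃ w : ι → ℝ, (∀ b ∈ B, 0 ≤ w b) ∧ ∑ b ∈ B, w b • p b = x) ∨
      ∃ l : W →ₗ[ℝ] ℝ, (∀ b ∈ B, l (p b) ≤ 0) ∧ 0 < l x := by
  classical
  induction B using Finset.induction_on generalizing p x with
  | empty =>
    by_cases hx : x = 0
    · exact Or.inl ⟨0, by simp, by simp [hx]⟩
    · right
      obtain ⟨l, hl⟩ : ∃ l : W →ₗ[ℝ] ℝ, l x ≠ 0 := by
        by_contra! h
        exact hx ((Module.forall_dual_apply_eq_zero_iff ℝ x).1 h)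
      rcases lt_or_gt_of_ne hl with h | h
      · exact ⟨-l, by simp, by simpa using h⟩
      · exact ⟨l, by simp, h⟩
  | insert a B ha ih =>
    rcases ih p x with ⟨w, hw, hx⟩ | ⟨l, hl, hlx⟩
    · refine Or.inl ⟨fun b => if b = a then 0 else w b, fun b hb => ?_, ?_⟩
      · by_cases hba : b = a
        · simp [hba]
        · simpa [hba] using hw b ((Finset.mem_insert.1 hb).resolve_left hba)
      · rw [Finset.sum_insert ha, ← hx]
        simp only [if_true, zero_smul, zero_add]
        refine Finset.sum_congr rfl fun b hb => ?_
        rw [if_neg (ne_of_mem_of_not_mem hb ha)]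
    by_cases hla : l (p a) ≤ 0
    · refine Or.inr ⟨l, fun b hb => ?_, hlx⟩
      rcases Finset.mem_insert.1 hb with rfl | hb
      exacts [hla, hl b hb]
    push Not at hla
    let π : W →ₗ[ℝ] W := l (p a) • LinearMap.id - l.smulRight (p a)
    have hπ : ∀ z, π z = l (p a) • z - l z • p a := fun z => by simp [π]
    rcases ih (fun b => π (p b)) (π x) with ⟨w, hw, hx⟩ | ⟨l', hl', hlx'⟩
    · left
      have hs : 0 ≤ (l x - ∑ b ∈ B, w b * l (p b)) := by
        have : ∑ b ∈ B, w b * l (p b) ≤ 0 :=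
          Finset.sum_nonpos fun b hb => mul_nonpos_of_nonneg_of_nonpos (hw b hb) (hl b hb)
        linarith
      refine ⟨fun b => if b = a then (l x - ∑ b ∈ B, w b * l (p b)) / l (p a) else w b,
        fun b hb => ?_, ?_⟩
      · by_cases hba : b = a
        · simp only [hba, if_true]; positivity
        · simpa [hba] using hw b ((Finset.mem_insert.1 hb).resolve_left hba)
      · rw [Finset.sum_insert ha]
        simp only [if_true]
        have h1 : ∑ b ∈ B, (if b = a then (l x - ∑ b ∈ B, w b * l (p b)) / l (p a) else w b) • p b
            = ∑ b ∈ B, w b • p b := by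
          refine Finset.sum_congr rfl fun b hb => ?_
          rw [if_neg (ne_of_mem_of_not_mem hb ha)]
        rw [h1]
        have h2 : l (p a) • (∑ b ∈ B, w b • p b) - (∑ b ∈ B, w b * l (p b)) • p a
            = l (p a) • x - l x • p a := by
          rw [← hπ x, ← hx, Finset.smul_sum, Finset.sum_smul, ← Finset.sum_sub_distrib]
          refine Finset.sum_congr rfl fun b _ => ?_
          rw [hπ, smul_sub, smul_smul, smul_smul, smul_smul, mul_comm]
        have h3 : l (p a) • (((l x - ∑ b ∈ B, w b * l (p b)) / l (p a)) • p a
            + ∑ b ∈ B, w b • p b) = l (p a) • x := by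
          rw [smul_add, smul_smul, mul_div_cancel₀ _ hla.ne', sub_smul]
          rw [sub_eq_iff_eq_add] at h2
          rw [h2]; abel
        exact smul_right_injective W hla.ne' h3
    · refine Or.inr ⟨l'.comp π, fun b hb => ?_, hlx'⟩
      rcases Finset.mem_insert.1 hb with rfl | hb
      · simp [hπ]
      · exact hl' b hb

theorem exists_pos_step_lt {ι : Type*} (A : Finset ι) (u s : ι → ℝ) :
    ∃ ε : ℝ, 0 < ε ∧ ∀ a ∈ A, 0 < s a → ε * u a < s a := by
  have h : ∀ᶠ ε : ℝ in nhdsWithin 0 (Set.Ioi 0), ∀ a ∈ A, 0 < s a → ε * u a < s a := by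
    rw [Filter.eventually_all_finset]
    intro a _
    by_cases hs : 0 < s a
    · have : Filter.Tendsto (fun ε : ℝ => ε * u a) (nhdsWithin 0 (Set.Ioi 0)) (nhds (0 * u a)) :=
        ((continuous_id.mul continuous_const).tendsto 0).mono_left nhdsWithin_le_nhds
      rw [zero_mul] at this
      filter_upwards [this.eventually (gt_mem_nhds hs)] with ε hε _ using hε
    · exact Filter.Eventually.of_forall fun _ h => absurd h hs
  obtain ⟨ε, h1, h2⟩ := (h.and self_mem_nhdsWithin).exists
  exact ⟨ε, h2, h1⟩

theorem exists_maximal_step {ι : Type*} (A : Finset ι) (u s : ι → ℝ) (hs : ∀ a ∈ A, 0 ≤ s a)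
    (hu : ∃ a ∈ A, 0 < u a) :
    ∃ t : ℝ, 0 ≤ t ∧ (∀ a ∈ A, t * u a ≤ s a) ∧ ∃ a ∈ A, 0 < u a ∧ t * u a = s a := by
  classical
  obtain ⟨a, ha, hmin⟩ := (A.filter fun a => 0 < u a).exists_min_image (fun a => s a / u a)
    (by obtain ⟨a, ha, hua⟩ := hu; exact ⟨a, by simp [ha, hua]⟩)
  rw [Finset.mem_filter] at ha
  have h0 : 0 ≤ s a / u a := div_nonneg (hs a ha.1) ha.2.le
  refine ⟨s a / u a, h0, fun b hb => ?_, a, ha.1, ha.2, div_mul_cancel₀ _ ha.2.ne'⟩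
  by_cases hub : 0 < u b
  · exact (le_div_iff₀ hub).1 (hmin b (by simp [hb, hub]))
  · exact (mul_nonpos_of_nonneg_of_nonpos h0 (not_lt.1 hub)).trans (hs b hb)

section LP
variable {W ι : Type*} [AddCommGroup W] [Module ℝ W]

/-- The set of indices where the linear functional `g` attains the height `ω`. -/
noncomputable def contact (A : Finset ι) (p : ι → W) (ω : ι → ℝ) (g : W →ₗ[ℝ] ℝ) : Finset ι :=
  open Classical in A.filter fun a => g (p a) = ω a

/-- The linear functional `g` lies below the height `ω`. -/
def Below (A : Finset ι) (p : ι → W) (ω : ι → ℝ) (g : W →ₗ[ℝ] ℝ) : Prop :=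
  ∀ a ∈ A, g (p a) ≤ ω a

theorem mem_contact {A : Finset ι} {p : ι → W} {ω : ι → ℝ} {g : W →ₗ[ℝ] ℝ} {a : ι} :
    a ∈ contact A p ω g ↔ a ∈ A ∧ g (p a) = ω a := by
  simp [contact]

theorem contact_subset {A : Finset ι} {p : ι → W} {ω : ι → ℝ} {g : W →ₗ[ℝ] ℝ} :
    contact A p ω g ⊆ A := fun _ h => (mem_contact.1 h).1

/-- The vectors `p a`, `a ∈ B`, span the whole space. -/
def Spans (p : ι → W) (B : Finset ι) : Prop := Submodule.span ℝ (p '' (B : Set ι)) = ⊤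

theorem Spans.mono {p : ι → W} {B C : Finset ι} (hB : Spans p B) (h : B ⊆ C) : Spans p C :=
  top_unique (hB ▸ Submodule.span_mono (Set.image_mono (by exact_mod_cast h)))

theorem Spans.eq_of_eqOn {p : ι → W} {B : Finset ι} (hB : Spans p B) {g h : W →ₗ[ℝ] ℝ}
    (hgh : ∀ b ∈ B, g (p b) = h (p b)) : g = h := by
  refine LinearMap.ext_on (s := p '' (B : Set ι)) hB ?_
  rintro _ ⟨b, hb, rfl⟩
  exact hgh b hb

theorem exists_sum_of_mem_span {p : ι → W} {B : Finset ι} {x : W}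
    (hx : x ∈ Submodule.span ℝ (p '' (B : Set ι))) : ∃ c : ι → ℝ, ∑ b ∈ B, c b • p b = x :=
  (Submodule.mem_span_image_finset_iff_exists_fun' ℝ).1 hx

theorem exists_functional_of_not_spans {p : ι → W} {B : Finset ι} (hB : ¬ Spans p B) :
    ∃ h : W →ₗ[ℝ] ℝ, h ≠ 0 ∧ ∀ b ∈ B, h (p b) = 0 := by
  obtain ⟨f, hf, hle⟩ := Submodule.exists_le_ker_of_lt_top _ (lt_top_iff_ne_top.2 hB)
  exact ⟨f, hf, fun b hb => hle (Submodule.subset_span ⟨b, hb, rfl⟩)⟩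

theorem Below.exists_spans {A : Finset ι} {p : ι → W} {ω : ι → ℝ} (hA : Spans p A)
    {x : W} (hx : ∃ w : ι → ℝ, (∀ a ∈ A, 0 ≤ w a) ∧ ∑ a ∈ A, w a • p a = x)
    {g : W →ₗ[ℝ] ℝ} (hg : Below A p ω g) :
    ∃ g', Below A p ω g' ∧ contact A p ω g ⊆ contact A p ω g' ∧
      Spans p (contact A p ω g') ∧ g x ≤ g' x := by
  induction hn : A.card - (contact A p ω g).card using Nat.strong_induction_on generalizing g with
  | _ n ih =>
  by_cases hsp : Spans p (contact A p ω g)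
  · exact ⟨g, hg, Finset.Subset.refl _, hsp, le_rfl⟩
  obtain ⟨h, h0, hB⟩ := exists_functional_of_not_spans hsp
  obtain ⟨w, hw, hwx⟩ := hx
  have key : ∃ u : W →ₗ[ℝ] ℝ, (∀ b ∈ contact A p ω g, u (p b) = 0) ∧
      (∃ a ∈ A, 0 < u (p a)) ∧ 0 ≤ u x := by
    have hpos : ∀ u : W →ₗ[ℝ] ℝ, 0 < u x → ∃ a ∈ A, 0 < u (p a) := by
      intro u hu
      by_contra! hcon
      rw [← hwx, map_sum] at hu
      refine hu.not_ge (Finset.sum_nonpos fun a ha => ?_)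
      rw [map_smul]
      exact mul_nonpos_of_nonneg_of_nonpos (hw a ha) (hcon a ha)
    rcases lt_trichotomy (h x) 0 with hx | hx | hx
    · refine ⟨-h, fun b hb => by simp [hB b hb], hpos _ (by simpa using hx), ?_⟩
      simpa using hx.le
    · have : ∃ a ∈ A, h (p a) ≠ 0 := by
        by_contra! hcon
        exact h0 (hA.eq_of_eqOn fun b hb => by simpa using hcon b hb)
      obtain ⟨a, ha, hne⟩ := this
      rcases lt_or_gt_of_ne hne with hl | hl
      · exact ⟨-h, fun b hb => by simp [hB b hb], ⟨a, ha, by simpa using hl⟩, by simp [hx]⟩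
      · exact ⟨h, hB, ⟨a, ha, hl⟩, hx.ge⟩
    · exact ⟨h, hB, hpos _ hx, hx.le⟩
  obtain ⟨u, hu0, hupos, hux⟩ := key
  obtain ⟨t, ht, hle, a, ha, hua, hta⟩ := exists_maximal_step A (fun a => u (p a))
    (fun a => ω a - g (p a)) (fun a ha => sub_nonneg.2 (hg a ha)) hupos
  have hg' : Below A p ω (g + t • u) := fun b hb => by
    have := hle b hb
    simp only [LinearMap.add_apply, LinearMap.smul_apply, smul_eq_mul]
    linarith
  have hsub : contact A p ω g ⊆ contact A p ω (g + t • u) := fun b hb => by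
    rw [mem_contact]
    refine ⟨contact_subset hb, ?_⟩
    simp [hu0 b hb, (mem_contact.1 hb).2]
  have hss : contact A p ω g ⊂ contact A p ω (g + t • u) := by
    refine Finset.ssubset_iff_subset_ne.2 ⟨hsub, fun heq => ?_⟩
    have : a ∈ contact A p ω (g + t • u) := mem_contact.2 ⟨ha, by
      simp only [LinearMap.add_apply, LinearMap.smul_apply, smul_eq_mul]; linarith⟩
    rw [← heq] at this
    exact hua.ne' (hu0 a this)
  have hc1 := Finset.card_lt_card hss
  have hc2 := Finset.card_le_card (contact_subset (A := A) (p := p) (ω := ω) (g := g + t • u))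
  obtain ⟨g', h1, h2, h3, h4⟩ := ih _ (by omega) hg' rfl
  refine ⟨g', h1, hsub.trans h2, h3, le_trans ?_ h4⟩
  have := mul_nonneg ht hux
  simp only [LinearMap.add_apply, LinearMap.smul_apply, smul_eq_mul]
  linarith

/-- Strong linear programming duality: every point of the cone over `A` lies in the cone over
a spanning set of indices where some functional below `ω` attains it. -/
theorem exists_spanning_contact {A : Finset ι} {p : ι → W} {ω : ι → ℝ} (hA : Spans p A)
    {g₀ : W →ₗ[ℝ] ℝ} (hg₀ : Below A p ω g₀)
    {x : W} (hx : ∃ w : ι → ℝ, (∀ a ∈ A, 0 ≤ w a) ∧ ∑ a ∈ A, w a • p a = x) :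
    ∃ g, Below A p ω g ∧ Spans p (contact A p ω g) ∧
      ∃ w : ι → ℝ, (∀ b ∈ contact A p ω g, 0 ≤ w b) ∧ ∑ b ∈ contact A p ω g, w b • p b = x := by
  classical
  have hfin : {g : W →ₗ[ℝ] ℝ | Below A p ω g ∧ Spans p (contact A p ω g)}.Finite := by
    refine Set.Finite.of_finite_image (f := contact A p ω)
      ((A.powerset.finite_toSet).subset ?_) ?_
    · rintro _ ⟨g, _, rfl⟩
      simpa using contact_subset
    · rintro g ⟨_, hg⟩ g' _ heq
      refine hg.eq_of_eqOn fun b hb => ?_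
      rw [(mem_contact.1 hb).2, (mem_contact.1 (heq ▸ hb : b ∈ contact A p ω g')).2]
  obtain ⟨g₁, h1, -, h2, -⟩ := hg₀.exists_spans hA hx
  obtain ⟨g, ⟨hg, hsp⟩, hmax⟩ := Set.exists_max_image _ (fun g => g x) hfin ⟨g₁, h1, h2⟩
  refine ⟨g, hg, hsp, ?_⟩
  rcases farkas_finset (contact A p ω g) p x with h | ⟨l, hl, hlx⟩
  · exact h
  exfalso
  obtain ⟨ε, hε, hlt⟩ := exists_pos_step_lt A (fun a => l (p a)) (fun a => ω a - g (p a))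
  have hb : Below A p ω (g + ε • l) := fun a ha => by
    simp only [LinearMap.add_apply, LinearMap.smul_apply, smul_eq_mul]
    by_cases hc : a ∈ contact A p ω g
    · have h1 := hl a hc
      have h2 := (mem_contact.1 hc).2
      nlinarith
    · have h1 : g (p a) < ω a := lt_of_le_of_ne (hg a ha) fun h => hc (mem_contact.2 ⟨ha, h⟩)
      have := hlt a ha (sub_pos.2 h1)
      linarith
  obtain ⟨g', h1, -, h2, h3⟩ := hb.exists_spans hA hx
  have h4 := hmax g' ⟨h1, h2⟩
  have h5 : 0 < ε * l x := mul_pos hε hlx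
  simp only [LinearMap.add_apply, LinearMap.smul_apply, smul_eq_mul] at h3 h4
  linarith
end LP

section Regular
variable {E : Type*} [AddCommGroup E] [Module ℝ E]

/-- The embedding of `E` at height one in `E × ℝ`. -/
def lift (x : E) : E × ℝ := (x, 1)

theorem sum_smul_lift (B : Finset E) (w : E → ℝ) :
    ∑ b ∈ B, w b • lift b = (∑ b ∈ B, w b • b, ∑ b ∈ B, w b) := by
  simp [lift, Prod.ext_iff, Prod.fst_sum, Prod.snd_sum]

theorem mem_convexHull_iff_lift {B : Finset E} {x : E} :
    x ∈ convexHull ℝ (B : Set E) ↔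
      ∃ w : E → ℝ, (∀ b ∈ B, 0 ≤ w b) ∧ ∑ b ∈ B, w b • lift b = lift x := by
  rw [Finset.mem_convexHull']
  simp only [sum_smul_lift]
  simp only [lift, Prod.mk.injEq]
  exact ⟨fun ⟨w, h1, h2, h3⟩ => ⟨w, h1, h3, h2⟩, fun ⟨w, h1, h2, h3⟩ => ⟨w, h1, h3, h2⟩⟩

theorem lift_le_of_mem_convexHull {B : Finset E} {g h : E × ℝ →ₗ[ℝ] ℝ}
    (hle : ∀ b ∈ B, g (lift b) ≤ h (lift b)) {x : E} (hx : x ∈ convexHull ℝ (B : Set E)) :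
    g (lift x) ≤ h (lift x) := by
  obtain ⟨w, hw, hx⟩ := mem_convexHull_iff_lift.1 hx
  rw [← hx, map_sum, map_sum]
  refine Finset.sum_le_sum fun b hb => ?_
  rw [map_smul, map_smul]
  exact mul_le_mul_of_nonneg_left (hle b hb) (hw b hb)

theorem lift_eq_of_mem_convexHull {B : Finset E} {g h : E × ℝ →ₗ[ℝ] ℝ}
    (hle : ∀ b ∈ B, g (lift b) = h (lift b)) {x : E} (hx : x ∈ convexHull ℝ (B : Set E)) :
    g (lift x) = h (lift x) :=
  le_antisymm (lift_le_of_mem_convexHull (fun b hb => (hle b hb).le) hx)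
    (lift_le_of_mem_convexHull (fun b hb => (hle b hb).ge) hx)

theorem convexHull_filter_eq_zero (B : Finset E) (h : E × ℝ →ₗ[ℝ] ℝ)
    [DecidablePred fun b => h (lift b) = 0] (hB : ∀ b ∈ B, h (lift b) ≤ 0) :
    convexHull ℝ ((B.filter fun b => h (lift b) = 0 : Finset E) : Set E) =
      {x ∈ convexHull ℝ (B : Set E) | h (lift x) = 0} := by
  classical
  ext x
  constructor
  · intro hx
    refine ⟨convexHull_mono (by exact_mod_cast Finset.filter_subset _ _) hx, ?_⟩
    simpa using lift_eq_of_mem_convexHull (h := 0)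
      (fun b hb => by simpa using (Finset.mem_filter.1 hb).2) hx
  · rintro ⟨hx, h0⟩
    obtain ⟨w, hw, hx⟩ := mem_convexHull_iff_lift.1 hx
    rw [← hx, map_sum] at h0
    have hz : ∀ b ∈ B, h (w b • lift b) = 0 := by
      refine (Finset.sum_eq_zero_iff_of_nonpos fun b hb => ?_).1 h0
      rw [map_smul]
      exact mul_nonpos_of_nonneg_of_nonpos (hw b hb) (hB b hb)
    refine mem_convexHull_iff_lift.2 ⟨w, fun b hb => hw b (Finset.mem_filter.1 hb).1, ?_⟩
    rw [← hx, Finset.sum_filter]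
    refine Finset.sum_congr rfl fun b hb => ?_
    split_ifs with hb0
    · rfl
    · have := hz b hb
      rw [map_smul, smul_eq_mul] at this
      rw [(mul_eq_zero.1 this).resolve_right hb0, zero_smul]

/-- The linear functional on `E × ℝ` which agrees with `l - c` at height one. -/
noncomputable def affineFunctional (l : E →ₗ[ℝ] ℝ) (c : ℝ) : E × ℝ →ₗ[ℝ] ℝ :=
  l.coprod (LinearMap.toSpanSingleton ℝ ℝ (-c))

@[simp] theorem affineFunctional_lift (l : E →ₗ[ℝ] ℝ) (c : ℝ) (x : E) :
    affineFunctional l c (lift x) = l x - c := by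
  simp [affineFunctional, lift, sub_eq_add_neg]

theorem faceOf_of_functional {Q : Set E} (h : E × ℝ →ₗ[ℝ] ℝ) (hQ : ∀ x ∈ Q, h (lift x) ≤ 0) :
    FaceOf Q {x ∈ Q | h (lift x) = 0} := by
  have key : ∀ x, h (lift x) = h.comp (LinearMap.inl ℝ E ℝ) x + h (0, 1) := fun x => by
    rw [LinearMap.comp_apply, ← map_add]; simp [lift]
  refine Or.inr ⟨h.comp (LinearMap.inl ℝ E ℝ), -h (0, 1), fun x hx => ?_, ?_⟩
  · have := hQ x hx
    rw [key] at this; linarith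
  · ext x
    simp only [Set.mem_ofPred_eq, key, add_eq_zero_iff_eq_neg]

theorem FaceOf.exists_functional {Q F : Set E} (hF : FaceOf Q F) :
    ∃ h : E × ℝ →ₗ[ℝ] ℝ, (∀ x ∈ Q, h (lift x) ≤ 0) ∧ F = {x ∈ Q | h (lift x) = 0} := by
  rcases hF with rfl | ⟨l, c, hl, rfl⟩
  · exact ⟨0, by simp, by simp⟩
  · exact ⟨affineFunctional l c, fun x hx => by simpa using hl x hx, by simp [sub_eq_zero]⟩

theorem Spans.nonempty {B : Finset E} (hB : Spans lift B) : B.Nonempty := by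
  rw [Finset.nonempty_iff_ne_empty]
  rintro rfl
  rw [Spans, Finset.coe_empty, Set.image_empty, Submodule.span_empty] at hB
  have : ((0, 1) : E × ℝ) ∈ (⊥ : Submodule ℝ (E × ℝ)) := hB ▸ Submodule.mem_top
  simp at this

/-- The cells of the regular subdivision of `A` induced by the heights `ω`. -/
noncomputable def regularCells (A : Finset E) (ω : E → ℝ) : Finset (Set E) :=
  open Classical in
  (A.powerset.filter fun B => B.Nonempty ∧ ∃ g, Below A lift ω g ∧ contact A lift ω g = B).image
    fun B : Finset E => convexHull ℝ (B : Set E)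

variable {A : Finset E} {ω : E → ℝ}

theorem mem_regularCells {C : Set E} :
    C ∈ regularCells A ω ↔ ∃ g, Below A lift ω g ∧ (contact A lift ω g).Nonempty ∧
      C = convexHull ℝ (contact A lift ω g : Set E) := by
  classical
  simp only [regularCells, Finset.mem_image, Finset.mem_filter, Finset.mem_powerset]
  constructor
  · rintro ⟨B, ⟨_, hne, g, hg, rfl⟩, rfl⟩
    exact ⟨g, hg, hne, rfl⟩
  · rintro ⟨g, hg, hne, rfl⟩
    exact ⟨_, ⟨contact_subset, hne, g, hg, rfl⟩, rfl⟩

theorem Below.le_of_mem_contact {g h : E × ℝ →ₗ[ℝ] ℝ} (hh : Below A lift ω h) :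
    ∀ b ∈ contact A lift ω g, h (lift b) ≤ g (lift b) := fun b hb =>
  (hh b (contact_subset hb)).trans (mem_contact.1 hb).2.ge

theorem convexHull_contact_inter {g h : E × ℝ →ₗ[ℝ] ℝ} (hg : Below A lift ω g)
    (hh : Below A lift ω h) :
    convexHull ℝ (contact A lift ω g : Set E) ∩ convexHull ℝ (contact A lift ω h : Set E) =
      {x ∈ convexHull ℝ (contact A lift ω g : Set E) | (h - g) (lift x) = 0} := by
  classical
  ext x
  constructor
  · rintro ⟨h1, h2⟩
    refine ⟨h1, ?_⟩
    have h3 := lift_le_of_mem_convexHull hh.le_of_mem_contact h1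
    have h4 := lift_le_of_mem_convexHull hg.le_of_mem_contact h2
    rw [LinearMap.sub_apply]; linarith
  · intro hx
    refine ⟨hx.1, ?_⟩
    rw [← convexHull_filter_eq_zero _ _ (fun b hb => by
      simpa using hh.le_of_mem_contact b hb)] at hx
    refine convexHull_mono (fun b hb => ?_) hx
    simp only [LinearMap.sub_apply, sub_eq_zero, Finset.coe_filter, Set.mem_ofPred_eq] at hb
    exact mem_contact.2 ⟨contact_subset hb.1, hb.2.trans (mem_contact.1 hb.1).2⟩

theorem faceOf_convexHull_contact_inter {g h : E × ℝ →ₗ[ℝ] ℝ} (hg : Below A lift ω g)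
    (hh : Below A lift ω h) :
    FaceOf (convexHull ℝ (contact A lift ω g : Set E))
      (convexHull ℝ (contact A lift ω g : Set E) ∩
        convexHull ℝ (contact A lift ω h : Set E)) := by
  rw [convexHull_contact_inter hg hh]
  refine faceOf_of_functional _ fun x hx => ?_
  simpa using lift_le_of_mem_convexHull hh.le_of_mem_contact hx

theorem exists_below (A : Finset E) (ω : E → ℝ) : ∃ g, Below A lift ω g := by
  obtain ⟨c, hc⟩ := (A.image ω).bddBelow
  refine ⟨affineFunctional 0 (-c), fun a ha => ?_⟩
  simpa using hc (by simpa using ⟨a, ha, rfl⟩)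

theorem exists_spanning_cell (hA : Spans lift A) (ω : E → ℝ) {x : E}
    (hx : x ∈ convexHull ℝ (A : Set E)) :
    ∃ g, Below A lift ω g ∧ Spans lift (contact A lift ω g) ∧
      x ∈ convexHull ℝ (contact A lift ω g : Set E) := by
  obtain ⟨g₀, hg₀⟩ := exists_below A ω
  obtain ⟨g, h1, h2, h3⟩ := exists_spanning_contact hA hg₀ (mem_convexHull_iff_lift.1 hx)
  exact ⟨g, h1, h2, mem_convexHull_iff_lift.2 h3⟩

theorem isSubdivision_regularCells (hA : Spans lift A) (ω : E → ℝ) :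
    IsSubdivision (convexHull ℝ (A : Set E)) (regularCells A ω) := by
  classical
  refine ⟨fun C hC => ?_, fun C hC F hF hne => ?_, fun C hC D hD => ?_, ?_⟩
  · obtain ⟨g, -, -, rfl⟩ := mem_regularCells.1 hC
    exact ⟨_, rfl⟩
  · obtain ⟨g, hg, -, rfl⟩ := mem_regularCells.1 hC
    obtain ⟨h, hle, rfl⟩ := hF.exists_functional
    have hB : ∀ b ∈ contact A lift ω g, h (lift b) ≤ 0 := fun b hb =>
      hle b (subset_convexHull ℝ _ hb)
    obtain ⟨ε, hε, hlt⟩ := exists_pos_step_lt A (fun a => h (lift a))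
      (fun a => ω a - g (lift a))
    have hs : ∀ a ∈ A, a ∉ contact A lift ω g → (g + ε • h) (lift a) < ω a := fun a ha hc => by
      have h1 : g (lift a) < ω a := lt_of_le_of_ne (hg a ha) fun h => hc (mem_contact.2 ⟨ha, h⟩)
      have := hlt a ha (sub_pos.2 h1)
      simp only [LinearMap.add_apply, LinearMap.smul_apply, smul_eq_mul]
      linarith
    have hb : Below A lift ω (g + ε • h) := fun a ha => by
      by_cases hc : a ∈ contact A lift ω g
      · have h1 := hB a hc
        have h2 := (mem_contact.1 hc).2
        simp only [LinearMap.add_apply, LinearMap.smul_apply, smul_eq_mul]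
        nlinarith
      · exact (hs a ha hc).le
    have heq : contact A lift ω (g + ε • h) =
        (contact A lift ω g).filter fun b => h (lift b) = 0 := by
      ext a
      rw [Finset.mem_filter]
      constructor
      · intro ha
        obtain ⟨ha, hc⟩ := mem_contact.1 ha
        have hac : a ∈ contact A lift ω g := by
          by_contra hcon
          exact (hs a ha hcon).ne hc
        refine ⟨hac, ?_⟩
        rw [← (mem_contact.1 hac).2] at hc
        simpa [hε.ne'] using hc
      · rintro ⟨h1, h2⟩
        refine mem_contact.2 ⟨contact_subset h1, ?_⟩
        simp [h2, (mem_contact.1 h1).2]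
    rw [← convexHull_filter_eq_zero _ _ hB, ← heq] at hne ⊢
    refine mem_regularCells.2 ⟨_, hb, ?_, rfl⟩
    simpa using hne
  · obtain ⟨g, hg, -, rfl⟩ := mem_regularCells.1 hC
    obtain ⟨h, hh, -, rfl⟩ := mem_regularCells.1 hD
    refine ⟨faceOf_convexHull_contact_inter hg hh, ?_⟩
    rw [Set.inter_comm]
    exact faceOf_convexHull_contact_inter hh hg
  · ext x
    constructor
    · rintro ⟨C, hC, hx⟩
      obtain ⟨g, -, -, rfl⟩ := mem_regularCells.1 hC
      exact convexHull_mono (by exact_mod_cast contact_subset) hx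
    · intro hx
      obtain ⟨g, h1, h2, h3⟩ := exists_spanning_cell hA ω hx
      exact ⟨_, mem_regularCells.2 ⟨g, h1, h2.nonempty, rfl⟩, h3⟩

theorem maxCellS_regularCells_iff (hA : Spans lift A) {C : Set E} :
    MaxCellS (regularCells A ω) C ↔ ∃ g, Below A lift ω g ∧ Spans lift (contact A lift ω g) ∧
      C = convexHull ℝ (contact A lift ω g : Set E) := by
  constructor
  · rintro ⟨hC, hmax⟩
    obtain ⟨g, hg, -, rfl⟩ := mem_regularCells.1 hC
    obtain ⟨g', h1, h2, h3, -⟩ := hg.exists_spans hA (x := 0) ⟨0, by simp, by simp⟩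
    exact ⟨g', h1, h3, (hmax _ (mem_regularCells.2 ⟨g', h1, h3.nonempty, rfl⟩)
      (convexHull_mono (by exact_mod_cast h2))).symm⟩
  · rintro ⟨g, hg, hs, rfl⟩
    refine ⟨mem_regularCells.2 ⟨g, hg, hs.nonempty, rfl⟩, fun D hD hsub => ?_⟩
    obtain ⟨h, hh, -, rfl⟩ := mem_regularCells.1 hD
    have : h = g := hs.eq_of_eqOn fun b hb => by
      have hb' := subset_convexHull ℝ _ (Finset.mem_coe.2 hb)
      have := (convexHull_contact_inter hg hh ▸ ⟨hb', hsub hb'⟩ :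
        b ∈ {x ∈ convexHull ℝ (contact A lift ω g : Set E) | (h - g) (lift x) = 0}).2
      simpa [sub_eq_zero] using this
    rw [this]

theorem isRegularSubdivision_regularCells (hA : Spans lift A) (ω : E → ℝ) :
    IsRegularSubdivision (convexHull ℝ (A : Set E)) (regularCells A ω) := by
  let f : E → ℝ := fun x => sSup ((fun g : E × ℝ →ₗ[ℝ] ℝ => g (lift x)) '' {g | Below A lift ω g})
  have hgr : ∀ {g x}, Below A lift ω g → x ∈ convexHull ℝ (contact A lift ω g : Set E) →
      IsGreatest ((fun g : E × ℝ →ₗ[ℝ] ℝ => g (lift x)) '' {g | Below A lift ω g}) (g (lift x)) := by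
    intro g x hg hx
    refine ⟨⟨g, hg, rfl⟩, ?_⟩
    rintro _ ⟨h, hh, rfl⟩
    exact lift_le_of_mem_convexHull (Below.le_of_mem_contact hh) hx
  have hf : ∀ {g x}, Below A lift ω g → x ∈ convexHull ℝ (contact A lift ω g : Set E) →
      f x = g (lift x) := fun hg hx => (hgr hg hx).csSup_eq
  have hle : ∀ {g x}, Below A lift ω g → x ∈ convexHull ℝ (A : Set E) → g (lift x) ≤ f x := by
    intro g x hg hx
    obtain ⟨h, h1, -, h3⟩ := exists_spanning_cell hA ω hx
    rw [hf h1 h3]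
    exact (hgr h1 h3).2 ⟨g, hg, rfl⟩
  have hlin : ∀ (G : E →ᵃ[ℝ] ℝ) (x : E), affineFunctional G.linear (-G 0) (lift x) = G x := by
    intro G x
    rw [affineFunctional_lift, sub_neg_eq_add]
    exact (congrFun G.decomp x).symm
  refine ⟨f, ⟨convex_convexHull ℝ _, ?_⟩, ?_, ?_⟩
  · intro x hx y hy a b ha hb hab
    obtain ⟨h, h1, -, h3⟩ := exists_spanning_cell hA ω ((convex_convexHull ℝ _) hx hy ha hb hab)
    rw [hf h1 h3]
    have : lift (a • x + b • y) = a • lift x + b • lift y := by simp [lift, hab]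
    rw [this, map_add, map_smul, map_smul, smul_eq_mul, smul_eq_mul, smul_eq_mul, smul_eq_mul]
    exact add_le_add (mul_le_mul_of_nonneg_left (hle h1 hx) ha)
      (mul_le_mul_of_nonneg_left (hle h1 hy) hb)
  · intro C hC
    obtain ⟨g, hg, -, rfl⟩ := (maxCellS_regularCells_iff hA).1 hC
    refine ⟨(g.comp (LinearMap.inl ℝ E ℝ)).toAffineMap + AffineMap.const ℝ E (g (0, 1)),
      fun x hx => ?_⟩
    rw [hf hg hx]
    simp [lift, ← map_add]
  · rintro C D hC hD hne ⟨G, hG⟩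
    obtain ⟨g, hg, hs, rfl⟩ := (maxCellS_regularCells_iff hA).1 hC
    obtain ⟨h, hh, hs', rfl⟩ := (maxCellS_regularCells_iff hA).1 hD
    have e1 : g = affineFunctional G.linear (-G 0) := hs.eq_of_eqOn fun b hb => by
      have hb := subset_convexHull ℝ _ (Finset.mem_coe.2 hb)
      rw [← hf hg hb, hlin, hG (Or.inl hb)]
    have e2 : h = affineFunctional G.linear (-G 0) := hs'.eq_of_eqOn fun b hb => by
      have hb := subset_convexHull ℝ _ (Finset.mem_coe.2 hb)
      rw [← hf hh hb, hlin, hG (Or.inr hb)]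
    exact hne (by rw [e1, e2])

end Regular

section Lattice
variable {d : ℕ}

/-- The functional `dotZ v` as a linear map. -/
noncomputable def dotLin (v : Fin d → ℤ) : (Fin d → ℝ) →ₗ[ℝ] ℝ :=
  Fintype.linearCombination ℝ (fun i => (v i : ℝ))

@[simp] theorem dotLin_apply (v : Fin d → ℤ) (x : Fin d → ℝ) : dotLin v x = dotZ v x := by
  simp [dotLin, Fintype.linearCombination_apply, dotZ, mul_comm]

theorem continuous_dotZ (v : Fin d → ℤ) : Continuous (dotZ v : (Fin d → ℝ) → ℝ) := by
  unfold dotZ; fun_prop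

theorem dotZ_add (v : Fin d → ℤ) (x y : Fin d → ℝ) : dotZ v (x + y) = dotZ v x + dotZ v y := by
  simp only [← dotLin_apply, map_add]

theorem dotZ_smul (v : Fin d → ℤ) (c : ℝ) (x : Fin d → ℝ) : dotZ v (c • x) = c * dotZ v x := by
  simp only [← dotLin_apply, map_smul, smul_eq_mul]

theorem dotZ_sub (v : Fin d → ℤ) (x y : Fin d → ℝ) : dotZ v (x - y) = dotZ v x - dotZ v y := by
  simp only [← dotLin_apply, map_sub]

theorem Zd.exists_dotZ {x : Fin d → ℝ} (hx : Zd x) (v : Fin d → ℤ) : ∃ k : ℤ, dotZ v x = k := by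
  choose z hz using hx
  exact ⟨∑ i, v i * z i, by simp [dotZ, hz]⟩

/-- The polyhedron of points whose pairings with `N` lie between `lo` and `hi`. -/
def NBox (N : Finset (Fin d → ℤ)) (lo hi : (Fin d → ℤ) → ℤ) : Set (Fin d → ℝ) :=
  {x | ∀ v ∈ N, (lo v : ℝ) ≤ dotZ v x ∧ dotZ v x ≤ (hi v : ℝ)}

/-- The set of all maximal minors of `N` is contained in `{-1, 0, 1}`. -/
def UnimodularMinors (N : Finset (Fin d → ℤ)) : Prop :=
  ∀ v : Fin d → (Fin d → ℤ), (∀ i, v i ∈ N) →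
    (Matrix.of fun i j => v i j).det ∈ ({-1, 0, 1} : Set ℤ)

theorem zd_of_spans {N B : Finset (Fin d → ℤ)} (hN : UnimodularMinors N) (hBN : B ⊆ N)
    (hB : Spans (fun (v : Fin d → ℤ) (i : Fin d) => (v i : ℝ)) B) {x : Fin d → ℝ}
    (hx : ∀ v ∈ B, ∃ k : ℤ, dotZ v x = k) : Zd x := by
  classical
  obtain ⟨b, hb, hspan, hli⟩ := exists_linearIndependent ℝ
    ((fun (v : Fin d → ℤ) (i : Fin d) => (v i : ℝ)) '' (B : Set (Fin d → ℤ)))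
  have hspan' : ⊤ ≤ Submodule.span ℝ (Set.range (Subtype.val : b → Fin d → ℝ)) := by
    rw [Subtype.range_coe, hspan]; exact hB.ge
  let bas := Module.Basis.mk hli hspan'
  let bas' := bas.reindex (bas.indexEquiv (Pi.basisFun ℝ (Fin d)))
  have hmem : ∀ i, bas' i ∈ b := fun i => by simp [bas', bas]
  choose v hvB hv using fun i => hb (hmem i)
  let M : Matrix (Fin d) (Fin d) ℤ := Matrix.of fun i j => v i j
  let MR : Matrix (Fin d) (Fin d) ℝ := M.map (Int.castRingHom ℝ)
  have hrow : MR.row = bas' := by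
    funext i; rw [← hv i]; rfl
  have hu : IsUnit MR := by
    rw [← Matrix.linearIndependent_rows_iff_isUnit, hrow]
    exact bas'.linearIndependent
  have hdet : M.det ≠ 0 := by
    intro h0
    have h1 := (Matrix.isUnit_iff_isUnit_det _).1 hu
    have h2 : MR.det = ((M.det : ℤ) : ℝ) := ((Int.castRingHom ℝ).map_det M).symm
    rw [h2, h0] at h1
    simp at h1
  have hMu : IsUnit M.det := by
    rcases hN v (fun i => hBN (hvB i)) with h | h | h
    · rw [show M.det = -1 from h]; exact isUnit_one.neg
    · exact absurd h hdet
    · rw [show M.det = 1 from h]; exact isUnit_one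
  choose k hk using fun i => hx (v i) (hvB i)
  have h1 : MR.mulVec x = fun i => (k i : ℝ) := by
    funext i; rw [← hk i]; rfl
  have h2 : MR.mulVec (fun i => ((M⁻¹.mulVec k) i : ℝ)) = fun i => (k i : ℝ) := by
    have h3 := congrArg (fun w : Fin d → ℤ => (fun i => ((w i : ℤ) : ℝ)))
      (show M.mulVec (M⁻¹.mulVec k) = k by
        rw [Matrix.mulVec_mulVec, Matrix.mul_nonsing_inv _ hMu, Matrix.one_mulVec])
    refine Eq.trans ?_ h3
    funext i
    simp [Matrix.mulVec, dotProduct, MR]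
  have h4 := Matrix.mulVec_injective_of_isUnit hu (h1.trans h2.symm)
  exact fun i => ⟨_, congrFun h4 i⟩

theorem convex_NBox (N : Finset (Fin d → ℤ)) (lo hi : (Fin d → ℤ) → ℤ) :
    Convex ℝ (NBox N lo hi) := by
  intro x hx y hy a b ha hb hab v hv
  rw [dotZ_add, dotZ_smul, dotZ_smul]
  exact convex_Icc (lo v : ℝ) (hi v) (hx v hv) (hy v hv) ha hb hab

theorem isClosed_NBox (N : Finset (Fin d → ℤ)) (lo hi : (Fin d → ℤ) → ℤ) :
    IsClosed (NBox N lo hi) := by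
  have : NBox N lo hi = ⋂ v ∈ N, {x | (lo v : ℝ) ≤ dotZ v x} ∩ {x | dotZ v x ≤ (hi v : ℝ)} := by
    ext x; simp [NBox]
  rw [this]
  refine isClosed_biInter fun v _ => IsClosed.inter ?_ ?_
  · exact isClosed_le continuous_const (continuous_dotZ v)
  · exact isClosed_le (continuous_dotZ v) continuous_const

theorem zd_of_mem_extremePoints {N : Finset (Fin d → ℤ)} (hN : UnimodularMinors N)
    {lo hi : (Fin d → ℤ) → ℤ} {x : Fin d → ℝ} (hx : x ∈ (NBox N lo hi).extremePoints ℝ) :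
    Zd x := by
  classical
  have hxN := hx.1
  refine zd_of_spans hN (B := N.filter fun v => dotZ v x = lo v ∨ dotZ v x = hi v)
    (Finset.filter_subset _ _) ?_ fun v hv => ?_
  swap
  · rcases (Finset.mem_filter.1 hv).2 with h | h
    exacts [⟨_, h⟩, ⟨_, h⟩]
  by_contra hsp
  obtain ⟨h, h0, hB⟩ := exists_functional_of_not_spans hsp
  let u : Fin d → ℝ := fun i => h (fun j => if i = j then 1 else 0)
  have hu' : ∀ w : Fin d → ℝ, h w = ∑ i, w i * u i := fun w =>
    LinearMap.pi_apply_eq_sum_univ h w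
  have hu : ∀ v : Fin d → ℤ, h (fun i => (v i : ℝ)) = dotZ v u := fun v => hu' _
  have hu0 : u ≠ 0 := by
    intro hu0
    exact h0 (LinearMap.ext fun w => by simp [hu' w, hu0])
  obtain ⟨ε, hε, hlt⟩ := exists_pos_step_lt N (fun v => |dotZ v u|)
    (fun v => min (dotZ v x - lo v) (hi v - dotZ v x))
  have key : ∀ s : ℝ, |s| = ε → x + s • u ∈ NBox N lo hi := by
    intro s hs v hv
    rw [dotZ_add, dotZ_smul]
    by_cases hc : dotZ v x = lo v ∨ dotZ v x = hi v
    · rw [← hu, hB v (Finset.mem_filter.2 ⟨hv, hc⟩), mul_zero, add_zero]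
      exact hxN v hv
    · push Not at hc
      have h1 : 0 < min (dotZ v x - lo v) (hi v - dotZ v x) :=
        lt_min (sub_pos.2 (lt_of_le_of_ne (hxN v hv).1 (Ne.symm hc.1)))
          (sub_pos.2 (lt_of_le_of_ne (hxN v hv).2 hc.2))
      have h2 := hlt v hv h1
      rw [← hs, ← abs_mul, lt_min_iff] at h2
      have h3 := le_abs_self (s * dotZ v u)
      have h4 := neg_abs_le (s * dotZ v u)
      constructor <;> linarith
  have h1 := key ε (abs_of_pos hε)
  have h2 := key (-ε) (by rw [abs_neg, abs_of_pos hε])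
  have h3 := hx.2 h1 h2 ⟨1 / 2, 1 / 2, by norm_num, by norm_num, by norm_num, by
    ext i; simp; ring⟩
  have h4 : ε • u = 0 := by simpa using h3
  exact hu0 ((smul_eq_zero.1 h4).resolve_left hε.ne')

theorem finite_setOf_zd {R : Set (Fin d → ℝ)} (hR : Bornology.IsBounded R) :
    {x ∈ R | Zd x}.Finite := by
  obtain ⟨r, hr⟩ := hR.subset_closedBall 0
  refine (((Set.Finite.pi' fun _ : Fin d => Set.finite_Icc (-⌈r⌉) ⌈r⌉)).image
    (fun (z : Fin d → ℤ) i => (z i : ℝ))).subset ?_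
  rintro x ⟨hx, hz⟩
  choose z hz using hz
  refine ⟨z, fun i => ?_, (funext hz).symm⟩
  have h1 : ‖x‖ ≤ r := by simpa using hr hx
  have h2 := (norm_le_pi_norm x i).trans h1
  rw [hz i, Real.norm_eq_abs, abs_le] at h2
  have h3 := h2.2.trans (Int.le_ceil r)
  have h4 : (-⌈r⌉ : ℝ) ≤ z i := by linarith [Int.le_ceil r]
  exact ⟨by exact_mod_cast h4, by exact_mod_cast h3⟩

/-- Bounded polyhedra with integral bounds and unimodular normals are lattice polytopes. -/
theorem convexHull_zd_NBox {N : Finset (Fin d → ℤ)} (hN : UnimodularMinors N)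
    {lo hi : (Fin d → ℤ) → ℤ} (hb : Bornology.IsBounded (NBox N lo hi)) :
    convexHull ℝ {x ∈ NBox N lo hi | Zd x} = NBox N lo hi := by
  refine Set.Subset.antisymm (convexHull_min (fun x hx => hx.1) (convex_NBox N lo hi)) ?_
  have hcpt : IsCompact (NBox N lo hi) :=
    Metric.isCompact_of_isClosed_isBounded (isClosed_NBox N lo hi) hb
  conv_lhs => rw [← closure_convexHull_extremePoints hcpt (convex_NBox N lo hi)]
  refine closure_minimal (convexHull_mono fun x hx => ⟨hx.1, zd_of_mem_extremePoints hN hx⟩) ?_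
  exact (finite_setOf_zd hb).isClosed_convexHull ℝ

/-- If `h ≥ 0` on the polyhedron vanishes on `Y` but not at `m`, then some defining
inequality is tight on `Y` but not at `m`. -/
theorem exists_tight {N : Finset (Fin d → ℤ)} {lo hi : (Fin d → ℤ) → ℤ}
    {Y : Finset (Fin d → ℝ)} (hne : Y.Nonempty) (hY : ∀ b ∈ Y, b ∈ NBox N lo hi)
    {m : Fin d → ℝ} {h : (Fin d → ℝ) × ℝ →ₗ[ℝ] ℝ}
    (h0 : ∀ b ∈ Y, h (lift b) = 0) (hhm : 0 < h (lift m))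
    (hpos : ∀ x ∈ NBox N lo hi, 0 ≤ h (lift x)) :
    ∃ v ∈ N, ((∀ b ∈ Y, dotZ v b = lo v) ∧ dotZ v m ≠ lo v) ∨
      ((∀ b ∈ Y, dotZ v b = hi v) ∧ dotZ v m ≠ hi v) := by
  by_contra! hcon
  set n : ℝ := (Y.card : ℝ) with hn
  have hn0 : 0 < n := by rw [hn]; exact_mod_cast hne.card_pos
  let y : Fin d → ℝ := ∑ b ∈ Y, n⁻¹ • b
  have hone : ∑ b ∈ Y, n⁻¹ = 1 := by simp [← hn, hn0.ne']
  have hlift : ∑ b ∈ Y, n⁻¹ • lift b = lift y := by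
    rw [sum_smul_lift Y fun _ => n⁻¹, hone]; rfl
  have hsum : ∀ (v : Fin d → ℤ) (c : ℝ), dotZ v y - c = ∑ b ∈ Y, n⁻¹ * (dotZ v b - c) := by
    intro v c
    have := congrArg (affineFunctional (dotLin v) c) hlift
    rw [map_sum] at this
    simpa using this.symm
  have hlo : ∀ v ∈ N, 0 ≤ dotZ v y - lo v ∧
      (dotZ v y - lo v = 0 → dotZ v m = lo v) := by
    intro v hv
    have hnn : ∀ b ∈ Y, 0 ≤ n⁻¹ * (dotZ v b - lo v) := fun b hb =>
      mul_nonneg (inv_pos.2 hn0).le (sub_nonneg.2 (hY b hb v hv).1)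
    rw [hsum]
    refine ⟨Finset.sum_nonneg hnn, fun hz => (hcon v hv).1 fun b hb => ?_⟩
    have := (Finset.sum_eq_zero_iff_of_nonneg hnn).1 hz b hb
    linarith [(mul_eq_zero.1 this).resolve_left (inv_pos.2 hn0).ne']
  have hhi : ∀ v ∈ N, dotZ v y - hi v ≤ 0 ∧
      (dotZ v y - hi v = 0 → dotZ v m = hi v) := by
    intro v hv
    have hnn : ∀ b ∈ Y, n⁻¹ * (dotZ v b - hi v) ≤ 0 := fun b hb =>
      mul_nonpos_of_nonneg_of_nonpos (inv_pos.2 hn0).le (sub_nonpos.2 (hY b hb v hv).2)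
    rw [hsum]
    refine ⟨Finset.sum_nonpos hnn, fun hz => (hcon v hv).2 fun b hb => ?_⟩
    have := (Finset.sum_eq_zero_iff_of_nonpos hnn).1 hz b hb
    linarith [(mul_eq_zero.1 this).resolve_left (inv_pos.2 hn0).ne']
  have hy0 : h (lift y) = 0 := by
    rw [← hlift, map_sum]
    exact Finset.sum_eq_zero fun b hb => by simp [h0 b hb]
  obtain ⟨ε₁, hε₁, hlt₁⟩ := exists_pos_step_lt N (fun v => |dotZ v m - dotZ v y|)
    (fun v => dotZ v y - lo v)
  obtain ⟨ε₂, hε₂, hlt₂⟩ := exists_pos_step_lt N (fun v => |dotZ v m - dotZ v y|)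
    (fun v => hi v - dotZ v y)
  set ε := min ε₁ ε₂
  have hε : 0 < ε := lt_min hε₁ hε₂
  have hmem : y + ε • (y - m) ∈ NBox N lo hi := by
    intro v hv
    rw [dotZ_add, dotZ_smul, dotZ_sub]
    have ha := abs_nonneg (dotZ v m - dotZ v y)
    have e1 : ε * (dotZ v m - dotZ v y) ≤ ε * |dotZ v m - dotZ v y| :=
      mul_le_mul_of_nonneg_left (le_abs_self _) hε.le
    have e2 : ε * -(dotZ v m - dotZ v y) ≤ ε * |dotZ v m - dotZ v y| :=
      mul_le_mul_of_nonneg_left (neg_le_abs _) hε.le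
    constructor
    · rcases (hlo v hv).1.eq_or_lt with hz | hz
      · have h1 := (hlo v hv).2 hz.symm
        have h2 : dotZ v m = dotZ v y := by linarith
        rw [h2]; linarith
      · have h1 := hlt₁ v hv hz
        have h2 : ε * |dotZ v m - dotZ v y| ≤ ε₁ * |dotZ v m - dotZ v y| :=
          mul_le_mul_of_nonneg_right (min_le_left _ _) ha
        linarith
    · rcases (hhi v hv).1.eq_or_lt with hz | hz
      · have h1 := (hhi v hv).2 hz
        have h2 : dotZ v m = dotZ v y := by linarith
        rw [h2]; linarith
      · have h1 := hlt₂ v hv (by linarith)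
        have h2 : ε * |dotZ v m - dotZ v y| ≤ ε₂ * |dotZ v m - dotZ v y| :=
          mul_le_mul_of_nonneg_right (min_le_right _ _) ha
        linarith
  have hfin := hpos _ hmem
  have : lift (y + ε • (y - m)) = lift y + ε • (lift y - lift m) := by simp [lift]
  rw [this, map_add, map_smul, map_sub, hy0, smul_eq_mul] at hfin
  nlinarith [mul_pos hε hhm]

end Lattice

section Facets
variable {E : Type*} [NormedAddCommGroup E] [NormedSpace ℝ E]

theorem exists_pos_smul_mem_of_mem_interior {P : Set E} {y : E} (hy : y ∈ interior P) (z : E) :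
    ∃ ε : ℝ, 0 < ε ∧ y + ε • z ∈ P := by
  have hc : Filter.Tendsto (fun ε : ℝ => y + ε • z) (nhdsWithin 0 (Set.Ioi 0)) (nhds y) := by
    have : Continuous fun ε : ℝ => y + ε • z := by fun_prop
    simpa using (this.tendsto 0).mono_left nhdsWithin_le_nhds
  obtain ⟨ε, h1, h2⟩ := ((hc.eventually (mem_interior_iff_mem_nhds.1 hy)).and
    self_mem_nhdsWithin).exists
  exact ⟨ε, h2, h1⟩

/-- A point outside a full-dimensional polytope is separated from it by a facet. -/
theorem exists_facet_separating {A : Finset E} {y : E}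
    (hy : y ∈ interior (convexHull ℝ (A : Set E))) {x : E} (hx : x ∉ convexHull ℝ (A : Set E)) :
    ∃ F, FacetOf (convexHull ℝ (A : Set E)) F ∧ ∀ (l : E →ₗ[ℝ] ℝ) (c : ℝ),
      (∀ z ∈ convexHull ℝ (A : Set E), l z ≤ c) →
      F = {z ∈ convexHull ℝ (A : Set E) | l z = c} → c < l x := by
  set P := convexHull ℝ (A : Set E) with hP
  have hconv : Convex ℝ P := convex_convexHull ℝ _
  have hyP : y ∈ P := interior_subset hy
  let p : E → E := fun a => a - y
  have hcone : ∀ z : E, ∃ w : E → ℝ, (∀ a ∈ A, 0 ≤ w a) ∧ ∑ a ∈ A, w a • p a = z := by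
    intro z
    obtain ⟨ε, hε, hmem⟩ := exists_pos_smul_mem_of_mem_interior hy z
    obtain ⟨w, hw, hw1, hwx⟩ := Finset.mem_convexHull'.1 hmem
    refine ⟨fun a => ε⁻¹ * w a, fun a ha => mul_nonneg (inv_pos.2 hε).le (hw a ha), ?_⟩
    have : ∑ a ∈ A, w a • p a = ε • z := by
      simp only [p, smul_sub, Finset.sum_sub_distrib, ← Finset.sum_smul]
      rw [hwx, hw1, one_smul, add_sub_cancel_left]
    simp only [mul_smul, ← Finset.smul_sum]
    rw [this, smul_smul, inv_mul_cancel₀ hε.ne', one_smul]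
  have hsp : Spans p A := by
    refine Submodule.eq_top_iff'.2 fun z => ?_
    obtain ⟨w, -, rfl⟩ := hcone z
    exact Submodule.sum_mem _ fun a ha =>
      Submodule.smul_mem _ _ (Submodule.subset_span ⟨a, ha, rfl⟩)
  obtain ⟨g, hg, hgs, w, hw, hwx⟩ := exists_spanning_contact (ω := fun _ => 1) hsp
    (g₀ := 0) (fun a _ => by simp) (hcone (x - y))
  set B := contact A p (fun _ => 1) g with hB
  have hBA : ∀ b ∈ B, b ∈ P := fun b hb =>
    subset_convexHull ℝ _ (Finset.mem_coe.2 (contact_subset hb))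
  have hgB : ∀ b ∈ B, g b = 1 + g y := fun b hb => by
    have := (mem_contact.1 hb).2
    simp only [p, map_sub] at this
    linarith
  have hgP : ∀ z ∈ P, g z ≤ 1 + g y := by
    intro z hz
    refine convexHull_min (t := {z | g z ≤ 1 + g y}) ?_ (convex_halfSpace_le g.isLinear _) hz
    intro a ha
    have := hg a ha
    simp only [p, map_sub] at this
    simp only [Set.mem_ofPred_eq]; linarith
  have hxy : x ≠ y := fun h => hx (h ▸ hyP)
  have hw1 : 1 < ∑ b ∈ B, w b := by
    by_contra! hle
    have hs0 : 0 ≤ ∑ b ∈ B, w b := Finset.sum_nonneg hw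
    have hxw : x = y + ∑ b ∈ B, w b • p b := by rw [hwx]; abel
    rcases hs0.eq_or_lt with h0 | h0
    · have h1 := (Finset.sum_eq_zero_iff_of_nonneg hw).1 h0.symm
      rw [Finset.sum_eq_zero fun b hb => by rw [h1 b hb, zero_smul], add_zero] at hxw
      exact hxy hxw
    · have hq := hconv.sum_mem (t := B) (w := fun b => (∑ b ∈ B, w b)⁻¹ * w b) (z := id)
        (fun b hb => mul_nonneg (inv_pos.2 h0).le (hw b hb))
        (by rw [← Finset.mul_sum, inv_mul_cancel₀ h0.ne']) hBA
      have hmem := hconv hyP hq (sub_nonneg.2 hle) hs0 (by ring)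
      have hz : (∑ b ∈ B, w b) • ∑ b ∈ B, ((∑ b ∈ B, w b)⁻¹ * w b) • id b =
          ∑ b ∈ B, w b • b := by
        rw [Finset.smul_sum]
        refine Finset.sum_congr rfl fun b _ => ?_
        rw [smul_smul, mul_inv_cancel_left₀ h0.ne', id]
      have hp : ∑ b ∈ B, w b • p b = ∑ b ∈ B, w b • b - (∑ b ∈ B, w b) • y := by
        rw [Finset.sum_smul, ← Finset.sum_sub_distrib]
        exact Finset.sum_congr rfl fun b _ => smul_sub _ _ _
      rw [hz, sub_smul, one_smul] at hmem
      rw [hp] at hxw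
      apply hx
      rw [hxw]
      convert hmem using 1
      abel
  have hBne : B.Nonempty := by
    rw [Finset.nonempty_iff_ne_empty]
    intro h
    rw [h, Finset.sum_empty] at hw1
    linarith
  have hsupp : ∀ (l : E →ₗ[ℝ] ℝ) (c : ℝ), (∀ b ∈ B, l b = c) →
      ∀ z, (c - l y) * g (z - y) = l (z - y) := by
    intro l c hl
    have : (c - l y) • g = l := hgs.eq_of_eqOn fun b hb => by
      rw [LinearMap.smul_apply, (mem_contact.1 hb).2]
      simp [p, hl b hb]
    intro z
    exact LinearMap.congr_fun this (z - y)
  refine ⟨{z ∈ P | g z = 1 + g y}, ⟨Or.inr ⟨g, 1 + g y, hgP, rfl⟩, ?_, ?_, ?_⟩, ?_⟩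
  · obtain ⟨b, hb⟩ := hBne
    exact ⟨b, hBA b hb, hgB b hb⟩
  · intro h
    have hy' : y ∈ {z ∈ P | g z = 1 + g y} := by rw [h]; exact hyP
    linarith [hy'.2]
  · intro G hG hGP hsub
    rcases hG with rfl | ⟨l, c, hl, rfl⟩
    · exact absurd rfl hGP
    have hlB : ∀ b ∈ B, l b = c := fun b hb => (hsub ⟨hBA b hb, hgB b hb⟩).2
    have hs := hsupp l c hlB
    refine Set.Subset.antisymm (fun z hz => ⟨hz.1, ?_⟩) hsub
    rcases eq_or_ne (c - l y) 0 with h0 | h0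
    · refine absurd ?_ hGP
      ext z
      refine ⟨fun h => h.1, fun h => ⟨h, ?_⟩⟩
      have := hs z
      rw [h0, zero_mul, map_sub] at this
      linarith
    · have := hs z
      rw [map_sub, map_sub, hz.2] at this
      have := mul_left_cancel₀ h0 (this.trans (mul_one _).symm)
      linarith
  · intro l c hl hF
    have hlB : ∀ b ∈ B, l b = c := fun b hb =>
      (hF.subset (show b ∈ {z ∈ P | g z = 1 + g y} from ⟨hBA b hb, hgB b hb⟩)).2
    have hlt : l y < c := lt_of_le_of_ne (hl y hyP) fun h => by
      have hy' := (hF.superset (show y ∈ {z ∈ P | l z = c} from ⟨hyP, h⟩)).2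
      linarith
    have h1 : l (x - y) = (∑ b ∈ B, w b) * (c - l y) := by
      rw [← hwx, map_sum, Finset.sum_mul]
      refine Finset.sum_congr rfl fun b hb => ?_
      simp [p, hlB b hb]
    rw [map_sub] at h1
    nlinarith
end Facets

section Cells
variable {d : ℕ}

theorem dotZ_self_pos {v : Fin d → ℤ} (hv : v ≠ 0) : 0 < dotZ v (fun i => (v i : ℝ)) := by
  obtain ⟨i, hi⟩ := Function.ne_iff.1 hv
  refine Finset.sum_pos' (fun j _ => mul_self_nonneg _) ⟨i, Finset.mem_univ i, ?_⟩
  exact mul_self_pos.2 (Int.cast_ne_zero.2 hi)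

theorem dotZ_zero_left (x : Fin d → ℝ) : dotZ (0 : Fin d → ℤ) x = 0 := by simp [dotZ]

theorem dotZ_neg_left (v : Fin d → ℤ) (x : Fin d → ℝ) : dotZ (-v) x = -dotZ v x := by
  simp [dotZ]

theorem dotZ_lt_of_mem_interior {Q : Set (Fin d → ℝ)} {v : Fin d → ℤ} (hv : v ≠ 0) {c : ℝ}
    (hQ : ∀ x ∈ Q, dotZ v x ≤ c) {y : Fin d → ℝ} (hy : y ∈ interior Q) : dotZ v y < c := by
  obtain ⟨ε, hε, hmem⟩ := exists_pos_smul_mem_of_mem_interior hy (fun i => (v i : ℝ))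
  have h1 := hQ _ hmem
  rw [dotZ_add, dotZ_smul] at h1
  nlinarith [mul_pos hε (dotZ_self_pos hv)]

/-- A linear functional bounded by `c` on a finite set and attaining `c` on its convex hull
attains `c` on the set. -/
theorem exists_mem_eq_of_mem_convexHull {E : Type*} [AddCommGroup E] [Module ℝ E] {A : Set E}
    {l : E →ₗ[ℝ] ℝ} {c : ℝ} (hA : ∀ a ∈ A, l a ≤ c) {x : E} (hx : x ∈ convexHull ℝ A)
    (hxc : l x = c) : ∃ a ∈ A, l a = c := by
  by_contra! hne
  have := convexHull_min (t := {z | l z < c}) (fun a ha => lt_of_le_of_ne (hA a ha) (hne a ha))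
    (convex_halfSpace_lt l.isLinear c) hx
  exact lt_irrefl c (hxc ▸ this : c < c)

/-- The cell of the slicing of `P` along the hyperplanes with normals in `N`. -/
def sliceCell (P : Set (Fin d → ℝ)) (N : Finset (Fin d → ℤ)) (a : (Fin d → ℤ) → ℤ) :
    Set (Fin d → ℝ) :=
  {x ∈ P | ∀ v ∈ N, (a v : ℝ) ≤ dotZ v x ∧ dotZ v x ≤ (a v : ℝ) + 1}

theorem sliceCell_eq_inter (P : Set (Fin d → ℝ)) (N : Finset (Fin d → ℤ))
    (a : (Fin d → ℤ) → ℤ) : sliceCell P N a = P ∩ NBox N a fun v => a v + 1 := by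
  ext x; simp [sliceCell, NBox]

/-- A full-dimensional slice cell is cut out by the slicing hyperplanes alone. -/
theorem sliceCell_eq_NBox {A : Finset (Fin d → ℝ)} (hA : ∀ a ∈ A, Zd a)
    {N : Finset (Fin d → ℤ)}
    (hN : ∀ F, FacetOf (convexHull ℝ (A : Set (Fin d → ℝ))) F → ∃ v ∈ N, ∃ c : ℝ,
      (∀ x ∈ convexHull ℝ (A : Set (Fin d → ℝ)), dotZ v x ≤ c) ∧
        F = {x ∈ convexHull ℝ (A : Set (Fin d → ℝ)) | dotZ v x = c})
    {a : (Fin d → ℤ) → ℤ}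
    (hi : (interior (sliceCell (convexHull ℝ (A : Set (Fin d → ℝ))) N a)).Nonempty) :
    sliceCell (convexHull ℝ (A : Set (Fin d → ℝ))) N a = NBox N a fun v => a v + 1 := by
  rw [sliceCell_eq_inter] at hi ⊢
  obtain ⟨y, hy⟩ := hi
  have hyP := interior_mono Set.inter_subset_left hy
  refine Set.inter_eq_right.2 fun x hx => ?_
  by_contra hxP
  obtain ⟨F, hF, hlt⟩ := exists_facet_separating hyP hxP
  obtain ⟨v, hv, c, hc, rfl⟩ := hN F hF
  have hcx := hlt (dotLin v) c (by simpa using hc) (by simp)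
  rw [dotLin_apply] at hcx
  obtain ⟨z, hz⟩ := hF.2.1
  have hv0 : v ≠ 0 := by
    rintro rfl
    have := hz.2
    rw [dotZ_zero_left] at this hcx
    linarith
  obtain ⟨b, hb, hbc⟩ := exists_mem_eq_of_mem_convexHull (l := dotLin v) (c := c)
    (fun b hb => by simpa using hc b (subset_convexHull ℝ _ hb)) hz.1 (by simpa using hz.2)
  obtain ⟨k, hk⟩ := (hA b hb).exists_dotZ v
  rw [dotLin_apply, hk] at hbc
  have h1 := dotZ_lt_of_mem_interior hv0 hc hyP
  have h2 := ((interior_subset hy).2 v hv).1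
  have h3 := (hx v hv).2
  rw [← hbc] at h1 hcx
  have h4 : a v + 1 ≤ k := by
    have : a v < k := by exact_mod_cast h2.trans_lt h1
    omega
  have h5 : ((a v + 1 : ℤ) : ℝ) ≤ k := by exact_mod_cast h4
  linarith

theorem exists_mem_forall_dotZ_ne {U : Set (Fin d → ℝ)} (hU : IsOpen U) (hne : U.Nonempty)
    (N : Finset (Fin d → ℤ)) (x : Fin d → ℝ) :
    ∃ z ∈ U, ∀ v ∈ N, v ≠ 0 → dotZ v z ≠ dotZ v x := by
  classical
  suffices h : ∃ V ⊆ U, IsOpen V ∧ V.Nonempty ∧ ∀ z ∈ V, ∀ v ∈ N, v ≠ 0 → dotZ v z ≠ dotZ v x by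
    obtain ⟨V, hVU, -, ⟨z, hz⟩, h⟩ := h
    exact ⟨z, hVU hz, h z hz⟩
  induction N using Finset.induction_on with
  | empty => exact ⟨U, subset_rfl, hU, hne, by simp⟩
  | insert v M _ ih =>
    obtain ⟨V, hVU, hV, ⟨z, hz⟩, h⟩ := ih
    rcases eq_or_ne v 0 with rfl | hv
    · refine ⟨V, hVU, hV, ⟨z, hz⟩, fun z hz w hw hw0 => ?_⟩
      exact h z hz w (Finset.mem_of_mem_insert_of_ne hw hw0) hw0
    · refine ⟨V ∩ {u | dotZ v u ≠ dotZ v x}, fun u hu => hVU hu.1,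
        hV.inter (isOpen_ne_fun (continuous_dotZ v) continuous_const), ?_, ?_⟩
      · by_cases hzx : dotZ v z = dotZ v x
        · obtain ⟨ε, hε, hmem⟩ := exists_pos_smul_mem_of_mem_interior
            (hV.interior_eq.superset hz) (fun i => (v i : ℝ))
          refine ⟨_, hmem, ?_⟩
          simp only [Set.mem_ofPred_eq]
          rw [dotZ_add, dotZ_smul, hzx]
          have := mul_pos hε (dotZ_self_pos hv)
          linarith
        · exact ⟨z, hz, hzx⟩
      · intro u hu w hw hw0
        rcases Finset.mem_insert.1 hw with rfl | hw
        exacts [hu.2, h u hu.1 w hw hw0]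

/-- Full-dimensional slice cells cover a full-dimensional convex set. -/
theorem exists_mem_sliceCell {P : Set (Fin d → ℝ)} (hP : Convex ℝ P) (hi : (interior P).Nonempty)
    (N : Finset (Fin d → ℤ)) {x : Fin d → ℝ} (hx : x ∈ P) :
    ∃ a, x ∈ sliceCell P N a ∧ (interior (sliceCell P N a)).Nonempty := by
  classical
  obtain ⟨z, hz, hne⟩ := exists_mem_forall_dotZ_ne isOpen_interior hi N x
  let a : (Fin d → ℤ) → ℤ := fun v =>
    if 0 ≤ dotZ v (z - x) then ⌊dotZ v x⌋ else ⌈dotZ v x⌉ - 1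
  have hpos : ∀ v, 0 ≤ dotZ v (z - x) → (a v : ℝ) ≤ dotZ v x ∧ dotZ v x < a v + 1 := by
    intro v hv
    simp only [a, if_pos hv]
    exact ⟨Int.floor_le _, Int.lt_floor_add_one _⟩
  have hneg : ∀ v, ¬ 0 ≤ dotZ v (z - x) → (a v : ℝ) < dotZ v x ∧ dotZ v x ≤ a v + 1 := by
    intro v hv
    simp only [a, if_neg hv]
    push_cast
    constructor <;> linarith [Int.ceil_lt_add_one (dotZ v x), Int.le_ceil (dotZ v x)]
  refine ⟨a, ⟨hx, fun v _ => ?_⟩, ?_⟩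
  · by_cases hv : 0 ≤ dotZ v (z - x)
    exacts [⟨(hpos v hv).1, (hpos v hv).2.le⟩, ⟨(hneg v hv).1.le, (hneg v hv).2⟩]
  obtain ⟨t₀, ht₀, hlt⟩ := exists_pos_step_lt N (fun v => |dotZ v (z - x)|)
    (fun v => if 0 ≤ dotZ v (z - x) then a v + 1 - dotZ v x else dotZ v x - a v)
  set t := min t₀ 1
  have ht : 0 < t := lt_min ht₀ one_pos
  have hopen : IsOpen (interior P ∩ ⋂ v ∈ N.filter (· ≠ 0),
      {u | (a v : ℝ) < dotZ v u} ∩ {u | dotZ v u < a v + 1}) := by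
    refine isOpen_interior.inter (isOpen_biInter_finset fun v _ => IsOpen.inter ?_ ?_)
    · exact isOpen_lt continuous_const (continuous_dotZ v)
    · exact isOpen_lt (continuous_dotZ v) continuous_const
  refine ⟨x + t • (z - x), interior_maximal ?_ hopen ⟨?_, ?_⟩⟩
  · rintro u ⟨hu, hu'⟩
    refine ⟨interior_subset hu, fun v hv => ?_⟩
    rcases eq_or_ne v 0 with rfl | hv0
    · simp [a, dotZ_zero_left]
    · have := Set.mem_iInter₂.1 hu' v (Finset.mem_filter.2 ⟨hv, hv0⟩)
      exact ⟨this.1.le, this.2.le⟩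
  · exact hP.add_smul_sub_mem_interior hx hz ⟨ht, min_le_right _ _⟩
  · refine Set.mem_iInter₂.2 fun v hv => ?_
    obtain ⟨hv, hv0⟩ := Finset.mem_filter.1 hv
    have hvne : dotZ v (z - x) ≠ 0 := by
      rw [dotZ_sub]; exact sub_ne_zero.2 (hne v hv hv0)
    have hle : t * |dotZ v (z - x)| ≤ t₀ * |dotZ v (z - x)| :=
      mul_le_mul_of_nonneg_right (min_le_left _ _) (abs_nonneg _)
    have hl := hlt v hv
    simp only [Set.mem_inter_iff, Set.mem_ofPred_eq, dotZ_add, dotZ_smul]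
    by_cases hv' : 0 ≤ dotZ v (z - x)
    · have h1 := hpos v hv'
      have h2 := mul_pos ht (lt_of_le_of_ne hv' hvne.symm)
      rw [if_pos hv'] at hl
      have h3 := hl (by linarith)
      rw [abs_of_nonneg hv'] at h3 hle
      constructor <;> linarith
    · have h1 := hneg v hv'
      have h2 := mul_pos ht (neg_pos.2 (not_le.1 hv'))
      rw [if_neg hv'] at hl
      have h3 := hl (by linarith)
      rw [abs_of_neg (not_le.1 hv')] at h3 hle
      constructor <;> linarith

theorem spans_lift_of_interior_nonempty {B : Finset (Fin d → ℝ)}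
    (hi : (interior (convexHull ℝ (B : Set (Fin d → ℝ)))).Nonempty) : Spans lift B := by
  by_contra hsp
  obtain ⟨h, h0, hB⟩ := exists_functional_of_not_spans hsp
  obtain ⟨y, hy⟩ := hi
  have hz : ∀ x ∈ convexHull ℝ (B : Set (Fin d → ℝ)), h (lift x) = 0 := fun x hx =>
    lift_eq_of_mem_convexHull (g := h) (h := 0) (by simpa using hB) hx
  have hy0 := hz y (interior_subset hy)
  have hu : ∀ u : Fin d → ℝ, h (u, 0) = 0 := by
    intro u
    obtain ⟨ε, hε, hmem⟩ := exists_pos_smul_mem_of_mem_interior hy u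
    have h1 := hz _ hmem
    have h2 : lift (y + ε • u) = lift y + ε • ((u, 0) : (Fin d → ℝ) × ℝ) := by simp [lift]
    rw [h2, map_add, hy0, map_smul, zero_add] at h1
    exact (smul_eq_zero.1 h1).resolve_left hε.ne'
  refine h0 (LinearMap.ext fun p => ?_)
  have h3 : p = p.2 • lift y + ((p.1 - p.2 • y, 0) : (Fin d → ℝ) × ℝ) := by
    ext <;> simp [lift]
  rw [h3, map_add, map_smul, hy0, hu]
  simp

end Cells

section Compressed
variable {d : ℕ}

/-- The finite set of lattice points of a bounded set. -/
theorem exists_finset_zd {R : Set (Fin d → ℝ)} (hR : Bornology.IsBounded R) :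
    ∃ X : Finset (Fin d → ℝ), ∀ x, x ∈ X ↔ x ∈ R ∧ Zd x :=
  ⟨(finite_setOf_zd hR).toFinset, fun x => by simp⟩

theorem convexHull_eq_NBox {N : Finset (Fin d → ℤ)} (hN : UnimodularMinors N)
    {lo hi : (Fin d → ℤ) → ℤ} (hb : Bornology.IsBounded (NBox N lo hi))
    {X : Finset (Fin d → ℝ)} (hX : ∀ x, x ∈ X ↔ x ∈ NBox N lo hi ∧ Zd x) :
    convexHull ℝ (X : Set (Fin d → ℝ)) = NBox N lo hi := by
  rw [← convexHull_zd_NBox hN hb]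
  congr 1
  ext x
  simp [hX]

/-- Full-dimensional polytopes between neighbouring hyperplanes of a unimodular
configuration have width one with respect to their facets. -/
theorem isCompressedW_NBox {N : Finset (Fin d → ℤ)} (hN : UnimodularMinors N)
    {a : (Fin d → ℤ) → ℤ} (hb : Bornology.IsBounded (NBox N a fun v => a v + 1))
    (hi : (interior (NBox N a fun v => a v + 1)).Nonempty) :
    IsCompressedW (NBox N a fun v => a v + 1) := by
  classical
  obtain ⟨X, hX⟩ := exists_finset_zd hb
  have hQ := convexHull_eq_NBox hN hb hX
  set Q := NBox N a fun v => a v + 1 with hQdef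
  have hXQ : ∀ x ∈ X, x ∈ Q := fun x hx => ((hX x).1 hx).1
  have hXne : X.Nonempty := by
    have := hi.mono interior_subset
    rw [← hQ, convexHull_nonempty_iff] at this
    exact_mod_cast this
  refine ⟨⟨X, hXne, fun x hx => ((hX x).1 hx).2, hQ.symm⟩, fun y c F hgcd hF hFeq hc => ?_⟩
  set h : (Fin d → ℝ) × ℝ →ₗ[ℝ] ℝ := affineFunctional (dotLin y) c with hh
  have hlift : ∀ x, h (lift x) = dotZ y x - c := fun x => by simp [hh]
  set Y := X.filter fun x => dotZ y x = c with hY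
  have hFY : ∀ {w : Fin d → ℤ} {k : ℤ}, (∀ b ∈ Y, dotZ w b = k) → ∀ x ∈ F, dotZ w x = k := by
    intro w k hw x hx
    rw [hFeq] at hx
    have h1 := convexHull_filter_eq_zero X (-h) fun b hb => by
      rw [LinearMap.neg_apply, hlift]; linarith [hc b (hXQ b hb)]
    rw [hQ] at h1
    have h2 := h1.superset ⟨hx.1, by rw [LinearMap.neg_apply, hlift, hx.2]; simp⟩
    have h3 := lift_eq_of_mem_convexHull (g := affineFunctional (dotLin w) k) (h := 0)
      (fun b hb => ?_) h2
    · rw [affineFunctional_lift, LinearMap.zero_apply, dotLin_apply] at h3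
      linarith
    · obtain ⟨hb1, hb2⟩ := Finset.mem_filter.1 hb
      rw [LinearMap.neg_apply, hlift] at hb2
      have := hw b (Finset.mem_filter.2 ⟨hb1, by linarith⟩)
      simp [this]
  have hYne : Y.Nonempty := by
    obtain ⟨z, hz⟩ := hF.2.1
    rw [hFeq, ← hQ] at hz
    obtain ⟨b, hb, hbc⟩ := exists_mem_eq_of_mem_convexHull (l := -dotLin y) (c := -c)
      (fun b hb => by simpa using hc b (hXQ b hb)) hz.1 (by simpa using hz.2)
    exact ⟨b, Finset.mem_filter.2 ⟨hb, by simpa using hbc⟩⟩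
  obtain ⟨m, hmX, hm⟩ : ∃ m ∈ X, dotZ y m ≠ c := by
    by_contra! hall
    refine hF.2.2.1 (hFeq.trans (Set.Subset.antisymm (fun x hx => hx.1) fun x hx => ⟨hx, ?_⟩))
    rw [← hQ] at hx
    have := lift_eq_of_mem_convexHull (g := h) (h := 0)
      (fun b hb => by simp [hlift, hall b hb]) hx
    rw [hlift, LinearMap.zero_apply] at this
    linarith
  obtain ⟨w, k, hw, hwY, hwm⟩ : ∃ (w : Fin d → ℤ) (k : ℤ),
      (∀ x ∈ Q, (k : ℝ) ≤ dotZ w x ∧ dotZ w x ≤ k + 1) ∧ (∀ b ∈ Y, dotZ w b = k) ∧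
        dotZ w m ≠ k := by
    obtain ⟨v, hv, ⟨h1, h2⟩ | ⟨h1, h2⟩⟩ := exists_tight (lo := a) (hi := fun v => a v + 1)
      (h := h) hYne (fun b hb => hXQ b (Finset.mem_of_mem_filter b hb))
      (fun b hb => by rw [hlift, (Finset.mem_filter.1 hb).2, sub_self])
      (by rw [hlift, sub_pos]; exact lt_of_le_of_ne (hc m (hXQ m hmX)) hm.symm)
      (fun x hx => by rw [hlift]; exact sub_nonneg.2 (hc x hx))
    · exact ⟨v, a v, fun x hx => by simpa using hx v hv, h1, h2⟩
    · refine ⟨-v, -(a v + 1), fun x hx => ?_, fun b hb => ?_, ?_⟩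
      · have := hx v hv
        push_cast at this ⊢
        rw [dotZ_neg_left]
        constructor <;> linarith
      · rw [dotZ_neg_left, h1 b hb]; push_cast; ring
      · rw [dotZ_neg_left]
        push_cast at h2 ⊢
        intro h3; apply h2; linarith
  have hGF : ∀ x ∈ Q, dotZ w x = k → x ∈ F := by
    have hG := faceOf_of_functional (Q := Q) (-affineFunctional (dotLin w) k) fun x hx => by
      simpa using (hw x hx).1
    have := hF.2.2.2 _ hG (fun heq => hwm ?_) fun x hx => ⟨(hFeq.subset hx).1, ?_⟩
    · intro x hx hxk
      rw [← this]
      exact ⟨hx, by simp [hxk]⟩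
    · have := (heq.superset (hXQ m hmX)).2
      simp only [LinearMap.neg_apply, affineFunctional_lift, dotLin_apply] at this
      linarith
    · simp [hFY hwY x hx]
  have hone : ∀ x ∈ X, dotZ y x ≠ c → dotZ w x = k + 1 := by
    intro x hx hxc
    obtain ⟨j, hj⟩ := ((hX x).1 hx).2.exists_dotZ w
    have h1 := hw x (hXQ x hx)
    have h2 : dotZ w x ≠ k := fun h2 => hxc (hFeq.subset (hGF x (hXQ x hx) h2)).2
    rw [hj] at h1 h2 ⊢
    have h3 : k ≤ j ∧ j ≤ k + 1 := by exact_mod_cast h1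
    have h4 : j ≠ k := by exact_mod_cast h2
    have : j = k + 1 := by omega
    exact_mod_cast this
  obtain ⟨m₀, hm₀, hmin⟩ := Finset.exists_min_image (X.filter fun x => dotZ y x ≠ c)
    (fun x => dotZ y x) ⟨m, Finset.mem_filter.2 ⟨hmX, hm⟩⟩
  obtain ⟨hm₀X, hm₀c⟩ := Finset.mem_filter.1 hm₀
  obtain ⟨t, ht⟩ : ∃ t : ℤ, dotZ y m₀ - c = t := by
    obtain ⟨b, hb⟩ := hYne
    obtain ⟨hbX, hbc⟩ := Finset.mem_filter.1 hb
    obtain ⟨k₁, hk₁⟩ := ((hX b).1 hbX).2.exists_dotZ y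
    obtain ⟨k₂, hk₂⟩ := ((hX m₀).1 hm₀X).2.exists_dotZ y
    exact ⟨k₂ - k₁, by rw [← hbc, hk₁, hk₂]; push_cast; ring⟩
  have htpos : 0 < t := by
    have : 0 < dotZ y m₀ - c := sub_pos.2 (lt_of_le_of_ne (hc _ (hXQ _ hm₀X)) hm₀c.symm)
    rw [ht] at this
    exact_mod_cast this
  set f := (t : ℝ) • affineFunctional (dotLin w) k - h with hf
  have hflift : ∀ x, f (lift x) = t * (dotZ w x - k) - (dotZ y x - c) := fun x => by
    simp [hf, hlift]
  have hfX : ∀ x ∈ X, f (lift x) ≤ 0 := by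
    intro x hx
    rw [hflift]
    by_cases hxc : dotZ y x = c
    · rw [hwY x (Finset.mem_filter.2 ⟨hx, hxc⟩), hxc]; simp
    · have := hmin x (Finset.mem_filter.2 ⟨hx, hxc⟩)
      rw [hone x hx hxc]
      linarith
  have hfQ : ∀ x ∈ Q, f (lift x) ≤ 0 := by
    intro x hx
    rw [← hQ] at hx
    simpa using lift_le_of_mem_convexHull (g := f) (h := 0) (by simpa using hfX) hx
  have hall : ∀ x ∈ Q, f (lift x) = 0 := by
    by_contra hne
    have := hF.2.2.2 _ (faceOf_of_functional f hfQ)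
      (fun heq => hne fun x hx => (heq.superset hx).2)
      (fun x hx => ⟨(hFeq.subset hx).1, by
        rw [hflift, hFY hwY x hx, (hFeq.subset hx).2]; simp⟩)
    refine hm₀c (hFeq.subset (this.subset ⟨hXQ m₀ hm₀X, ?_⟩)).2
    rw [hflift, hone m₀ hm₀X hm₀c, ht]; ring
  have hyw : ∀ u : Fin d → ℝ, dotZ y u = t * dotZ w u := by
    intro u
    obtain ⟨z, hz⟩ := hi
    obtain ⟨ε, hε, hmem⟩ := exists_pos_smul_mem_of_mem_interior hz u
    have h1 := hall _ hmem
    have h2 := hall _ (interior_subset hz)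
    rw [hflift] at h1 h2
    rw [dotZ_add, dotZ_add, dotZ_smul, dotZ_smul] at h1
    have h3 : ε * (dotZ y u - t * dotZ w u) = 0 := by linarith
    linarith [(mul_eq_zero.1 h3).resolve_left hε.ne']
  have hti : ∀ i, y i = t * w i := by
    intro i
    have := hyw (Pi.single i 1)
    simp only [dotZ, Pi.single_apply, mul_ite, mul_one, mul_zero, Finset.sum_ite_eq',
      Finset.mem_univ, if_true] at this
    exact_mod_cast this
  have ht1 : t = 1 := by
    have h1 : t.natAbs ∣ Finset.univ.gcd fun i => (y i).natAbs :=
      Finset.dvd_gcd fun i _ => Int.natAbs_dvd_natAbs.2 ⟨w i, hti i⟩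
    rw [hgcd, Nat.dvd_one] at h1
    omega
  intro x hx
  have h1 := hall x hx
  rw [hflift, ht1] at h1
  have h2 := (hw x hx).2
  push_cast at h1
  linarith

end Compressed

section Slicing
variable {d : ℕ}

/-- The strictly convex height whose domains of linearity are the slice cells. -/
noncomputable def sqHeight (N : Finset (Fin d → ℤ)) (x : Fin d → ℝ) : ℝ :=
  ∑ v ∈ N, dotZ v x ^ 2

/-- The functional supporting `sqHeight N` along a slice cell. -/
noncomputable def sliceFunctional (N : Finset (Fin d → ℤ)) (a : (Fin d → ℤ) → ℤ) :
    (Fin d → ℝ) × ℝ →ₗ[ℝ] ℝ :=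
  ∑ v ∈ N, affineFunctional ((2 * (a v : ℝ) + 1) • dotLin v) (a v * (a v + 1))

theorem sqHeight_sub_sliceFunctional (N : Finset (Fin d → ℤ)) (a : (Fin d → ℤ) → ℤ)
    (x : Fin d → ℝ) : sqHeight N x - sliceFunctional N a (lift x) =
      ∑ v ∈ N, (dotZ v x - a v) * (dotZ v x - (a v + 1)) := by
  rw [sqHeight, sliceFunctional, LinearMap.sum_apply, ← Finset.sum_sub_distrib]
  refine Finset.sum_congr rfl fun v _ => ?_
  simp only [affineFunctional_lift, LinearMap.smul_apply, dotLin_apply, smul_eq_mul]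
  ring

theorem Int.sub_mul_sub_succ_nonneg (k a : ℤ) : 0 ≤ (k - a) * (k - (a + 1)) := by
  rcases le_or_gt k a with h | h
  · exact mul_nonneg_of_nonpos_of_nonpos (by omega) (by omega)
  · exact mul_nonneg (by omega) (by omega)

theorem slice_term_nonneg {x : Fin d → ℝ} (hx : Zd x) (v : Fin d → ℤ) (a : ℤ) :
    0 ≤ (dotZ v x - a) * (dotZ v x - (a + 1)) := by
  obtain ⟨k, hk⟩ := hx.exists_dotZ v
  rw [hk]
  exact_mod_cast Int.sub_mul_sub_succ_nonneg k a

theorem sliceFunctional_le (N : Finset (Fin d → ℤ)) (a : (Fin d → ℤ) → ℤ) {x : Fin d → ℝ}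
    (hx : Zd x) : sliceFunctional N a (lift x) ≤ sqHeight N x := by
  rw [← sub_nonneg, sqHeight_sub_sliceFunctional]
  exact Finset.sum_nonneg fun v _ => slice_term_nonneg hx v (a v)

theorem sliceFunctional_eq_iff (N : Finset (Fin d → ℤ)) (a : (Fin d → ℤ) → ℤ) {x : Fin d → ℝ}
    (hx : Zd x) :
    sliceFunctional N a (lift x) = sqHeight N x ↔ x ∈ NBox N a fun v => a v + 1 := by
  rw [eq_comm, ← sub_eq_zero, sqHeight_sub_sliceFunctional,
    Finset.sum_eq_zero_iff_of_nonneg fun v _ => slice_term_nonneg hx v (a v)]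
  refine forall₂_congr fun v _ => ?_
  obtain ⟨k, hk⟩ := hx.exists_dotZ v
  rw [hk]
  norm_cast
  rw [mul_eq_zero]
  beta_reduce
  omega

/-- `A` is the set of lattice points of a full-dimensional lattice polytope whose
full-dimensional slice cells are cut out by the unimodular configuration `N`. -/
structure IsSliced (A : Finset (Fin d → ℝ)) (N : Finset (Fin d → ℤ)) : Prop where
  minors : UnimodularMinors N
  mem_iff : ∀ x, x ∈ A ↔ x ∈ convexHull ℝ (A : Set (Fin d → ℝ)) ∧ Zd x
  spans : Spans lift A
  cell : ∀ a, (interior (sliceCell (convexHull ℝ (A : Set (Fin d → ℝ))) N a)).Nonempty →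
    sliceCell (convexHull ℝ (A : Set (Fin d → ℝ))) N a = NBox N a fun v => a v + 1
  cover : ∀ x ∈ convexHull ℝ (A : Set (Fin d → ℝ)), ∃ a,
    x ∈ sliceCell (convexHull ℝ (A : Set (Fin d → ℝ))) N a ∧
      (interior (sliceCell (convexHull ℝ (A : Set (Fin d → ℝ))) N a)).Nonempty

namespace IsSliced
variable {A : Finset (Fin d → ℝ)} {N : Finset (Fin d → ℤ)} {a : (Fin d → ℤ) → ℤ}

theorem zd (H : IsSliced A N) {x : Fin d → ℝ} (hx : x ∈ A) : Zd x := ((H.mem_iff x).1 hx).2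

theorem below (H : IsSliced A N) (a : (Fin d → ℤ) → ℤ) :
    Below A lift (sqHeight N) (sliceFunctional N a) := fun _ hx =>
  sliceFunctional_le N a (H.zd hx)

theorem NBox_subset (H : IsSliced A N)
    (ha : (interior (sliceCell (convexHull ℝ (A : Set (Fin d → ℝ))) N a)).Nonempty) :
    (NBox N a fun v => a v + 1) ⊆ convexHull ℝ (A : Set (Fin d → ℝ)) := by
  rw [← H.cell a ha]
  exact fun x hx => hx.1

theorem isBounded (H : IsSliced A N)
    (ha : (interior (sliceCell (convexHull ℝ (A : Set (Fin d → ℝ))) N a)).Nonempty) :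
    Bornology.IsBounded (NBox N a fun v => a v + 1) :=
  (isBounded_convexHull.2 A.finite_toSet.isBounded).subset (H.NBox_subset ha)

theorem mem_contact_iff (H : IsSliced A N)
    (ha : (interior (sliceCell (convexHull ℝ (A : Set (Fin d → ℝ))) N a)).Nonempty)
    (x : Fin d → ℝ) : x ∈ contact A lift (sqHeight N) (sliceFunctional N a) ↔
      (x ∈ NBox N a fun v => a v + 1) ∧ Zd x := by
  rw [mem_contact]
  constructor
  · rintro ⟨hx, h⟩
    exact ⟨(sliceFunctional_eq_iff N a (H.zd hx)).1 h, H.zd hx⟩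
  · rintro ⟨hx, h⟩
    exact ⟨(H.mem_iff x).2 ⟨H.NBox_subset ha hx, h⟩, (sliceFunctional_eq_iff N a h).2 hx⟩

theorem convexHull_contact (H : IsSliced A N)
    (ha : (interior (sliceCell (convexHull ℝ (A : Set (Fin d → ℝ))) N a)).Nonempty) :
    convexHull ℝ (contact A lift (sqHeight N) (sliceFunctional N a) : Set (Fin d → ℝ)) =
      NBox N a fun v => a v + 1 :=
  convexHull_eq_NBox H.minors (H.isBounded ha) (H.mem_contact_iff ha)

theorem spans_contact (H : IsSliced A N)
    (ha : (interior (sliceCell (convexHull ℝ (A : Set (Fin d → ℝ))) N a)).Nonempty) :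
    Spans lift (contact A lift (sqHeight N) (sliceFunctional N a)) :=
  spans_lift_of_interior_nonempty (by rwa [H.convexHull_contact ha, ← H.cell a ha])

end IsSliced

/-- A set on whose centroid the average height is at most the value of a supporting functional
lies in the contact set of that functional. -/
theorem Below.subset_contact {E : Type*} [AddCommGroup E] [Module ℝ E] {A B : Finset E}
    {ω : E → ℝ} {g : E × ℝ →ₗ[ℝ] ℝ} (hg : Below A lift ω g) (hBA : B ⊆ A) {x : E}
    (hx : ∑ b ∈ B, (B.card : ℝ)⁻¹ • lift b = lift x)
    (hle : ∑ b ∈ B, (B.card : ℝ)⁻¹ * ω b ≤ g (lift x)) : B ⊆ contact A lift ω g := by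
  intro b hb
  have hpos : (0 : ℝ) < (B.card : ℝ)⁻¹ := inv_pos.2 (by exact_mod_cast Finset.card_pos.2 ⟨b, hb⟩)
  have hterm : ∀ b ∈ B, 0 ≤ (B.card : ℝ)⁻¹ * (ω b - g (lift b)) := fun b hb =>
    mul_nonneg hpos.le (sub_nonneg.2 (hg b (hBA hb)))
  have hzero : ∑ b ∈ B, (B.card : ℝ)⁻¹ * (ω b - g (lift b)) = 0 := by
    refine le_antisymm ?_ (Finset.sum_nonneg hterm)
    simp only [mul_sub, Finset.sum_sub_distrib]
    rw [← hx, map_sum] at hle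
    simp only [map_smul, smul_eq_mul] at hle
    linarith
  have := (mul_eq_zero.1 ((Finset.sum_eq_zero_iff_of_nonneg hterm).1 hzero b hb)).resolve_left
    hpos.ne'
  exact mem_contact.2 ⟨hBA hb, by linarith⟩

/-- The centroid of a nonempty finite set. -/
theorem exists_centroid {E : Type*} [AddCommGroup E] [Module ℝ E] {B : Finset E}
    (hB : B.Nonempty) : ∃ x ∈ convexHull ℝ (B : Set E),
      ∑ b ∈ B, (B.card : ℝ)⁻¹ • lift b = lift x := by
  have hpos : (0 : ℝ) < B.card := by exact_mod_cast hB.card_pos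
  have h : ∑ b ∈ B, (B.card : ℝ)⁻¹ • lift b = lift (∑ b ∈ B, (B.card : ℝ)⁻¹ • b) := by
    rw [sum_smul_lift B fun _ => (B.card : ℝ)⁻¹, lift, Finset.sum_const, nsmul_eq_mul,
      mul_inv_cancel₀ hpos.ne']
  exact ⟨_, mem_convexHull_iff_lift.2 ⟨_, fun _ _ => (inv_pos.2 hpos).le, h⟩, h⟩

namespace IsSliced
variable {A : Finset (Fin d → ℝ)} {N : Finset (Fin d → ℤ)}

theorem maxCellS_iff (H : IsSliced A N) {C : Set (Fin d → ℝ)} :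
    MaxCellS (regularCells A (sqHeight N)) C ↔
      (interior C).Nonempty ∧ ∃ a, C = sliceCell (convexHull ℝ (A : Set (Fin d → ℝ))) N a := by
  rw [maxCellS_regularCells_iff H.spans]
  constructor
  · rintro ⟨g, hg, hgs, rfl⟩
    obtain ⟨y, hy, hsum⟩ := exists_centroid hgs.nonempty
    obtain ⟨a, hya, hi⟩ := H.cover y (convexHull_mono (by exact_mod_cast contact_subset) hy)
    have hy' := hya
    rw [H.cell a hi, ← H.convexHull_contact hi] at hy'
    have h1 := lift_le_of_mem_convexHull hg.le_of_mem_contact hy'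
    have hsub : contact A lift (sqHeight N) g ⊆ contact A lift (sqHeight N)
        (sliceFunctional N a) := by
      refine (H.below a).subset_contact contact_subset hsum (le_trans (le_of_eq ?_) h1)
      rw [← hsum, map_sum]
      refine Finset.sum_congr rfl fun b hb => ?_
      rw [map_smul, smul_eq_mul, (mem_contact.1 hb).2]
    have hga : g = sliceFunctional N a := hgs.eq_of_eqOn fun b hb =>
      (mem_contact.1 hb).2.trans (mem_contact.1 (hsub hb)).2.symm
    rw [hga, H.convexHull_contact hi, ← H.cell a hi]
    exact ⟨hi, a, rfl⟩
  · rintro ⟨hi, a, rfl⟩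
    exact ⟨_, H.below a, H.spans_contact hi, by rw [H.convexHull_contact hi, H.cell a hi]⟩

theorem isCompressedW (H : IsSliced A N) {C : Set (Fin d → ℝ)}
    (hC : MaxCellS (regularCells A (sqHeight N)) C) : IsCompressedW C := by
  obtain ⟨hi, a, rfl⟩ := H.maxCellS_iff.1 hC
  rw [H.cell a hi]
  exact isCompressedW_NBox H.minors (H.isBounded hi) (by rwa [← H.cell a hi])

theorem isLatticePolytope (H : IsSliced A N) {ω : (Fin d → ℝ) → ℝ} {C : Set (Fin d → ℝ)}
    (hC : C ∈ regularCells A ω) : IsLatticePolytope Zd C := by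
  obtain ⟨g, -, hne, rfl⟩ := mem_regularCells.1 hC
  exact ⟨_, hne, fun v hv => H.zd (contact_subset hv), rfl⟩

end IsSliced

/-- Facet unimodular polytopes are sliced by their facet normals. -/
theorem exists_isSliced {P : Set (Fin d → ℝ)}
    (hP : IsLatticePolytope Zd P) (hfull : affineSpan ℝ P = ⊤)
    {N : Finset (Fin d → ℤ)} (hN : UnimodularMinors N)
    (hNfacets : ∀ F, FacetOf P F → ∃ v ∈ N, ∃ c : ℝ,
      (∀ x ∈ P, dotZ v x ≤ c) ∧ F = {x ∈ P | dotZ v x = c}) :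
    ∃ A : Finset (Fin d → ℝ), P = convexHull ℝ (A : Set (Fin d → ℝ)) ∧ IsSliced A N := by
  obtain ⟨V, -, hVz, hPV⟩ := hP
  obtain ⟨A, hA⟩ := exists_finset_zd (R := P)
    (hPV ▸ isBounded_convexHull.2 V.finite_toSet.isBounded)
  have hPA : P = convexHull ℝ (A : Set (Fin d → ℝ)) := by
    refine Set.Subset.antisymm ?_ (convexHull_min (fun x hx => ((hA x).1 hx).1)
      (hPV ▸ convex_convexHull ℝ _))
    rw [hPV]
    exact convexHull_mono fun x hx =>
      (hA x).2 ⟨hPV ▸ subset_convexHull ℝ _ hx, hVz x hx⟩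
  subst hPA
  have hi : (interior (convexHull ℝ (A : Set (Fin d → ℝ)))).Nonempty := by
    rw [interior_convexHull_nonempty_iff_affineSpan_eq_top, ← affineSpan_convexHull, hfull]
  exact ⟨A, rfl, hN, hA, spans_lift_of_interior_nonempty hi,
    fun a ha => sliceCell_eq_NBox (fun x hx => ((hA x).1 hx).2) hNfacets ha,
    fun x hx => exists_mem_sliceCell (convex_convexHull ℝ _) hi N hx⟩

end Slicing

section Pulling

/-- A generic small perturbation of the heights `ω`, which lowers points of small rank
much more than points of large rank. -/
theorem exists_perturbation {ι : Type*} (A : Finset ι) (ω : ι → ℝ) (r : ι → ℕ)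
    (D : Finset (ι → ℝ)) :
    ∃ ω' : ι → ℝ, ∀ c ∈ D, (0 < ∑ a ∈ A, c a * ω a → 0 < ∑ a ∈ A, c a * ω' a) ∧
      (∑ a ∈ A, c a * ω a = 0 → ∀ m ∈ A, (∀ a ∈ A, a ≠ m → c a ≠ 0 → r m < r a) → 0 < c m →
        ∑ a ∈ A, c a * ω' a < 0) := by
  classical
  let ω' : ℝ → ι → ℝ := fun t a => ω a - t ^ (r a + 1)
  suffices h : ∀ᶠ t in nhdsWithin (0 : ℝ) (Set.Ioi 0), ∀ c ∈ D,
      (0 < ∑ a ∈ A, c a * ω a → 0 < ∑ a ∈ A, c a * ω' t a) ∧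
      ∀ m ∈ A, ∑ a ∈ A, c a * ω a = 0 → (∀ a ∈ A, a ≠ m → c a ≠ 0 → r m < r a) → 0 < c m →
        ∑ a ∈ A, c a * ω' t a < 0 by
    obtain ⟨t, ht⟩ := h.exists
    exact ⟨ω' t, fun c hc => ⟨(ht c hc).1, fun h0 m hm => (ht c hc).2 m hm h0⟩⟩
  have hpos : ∀ {φ : ℝ → ℝ}, Continuous φ → 0 < φ 0 →
      ∀ᶠ t in nhdsWithin (0 : ℝ) (Set.Ioi 0), 0 < φ t := fun hφ h0 =>
    ((hφ.tendsto 0).mono_left nhdsWithin_le_nhds).eventually (lt_mem_nhds h0)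
  rw [Filter.eventually_all_finset]
  intro c _
  refine Filter.Eventually.and ?_ ((Filter.eventually_all_finset A).2 fun m hm => ?_)
  · by_cases h0 : 0 < ∑ a ∈ A, c a * ω a
    · have := hpos (φ := fun t => ∑ a ∈ A, c a * ω' t a) (by fun_prop) (by simpa [ω'] using h0)
      exact this.mono fun t ht _ => ht
    · exact Filter.Eventually.of_forall fun t h => absurd h h0
  · by_cases h0 : ∑ a ∈ A, c a * ω a = 0 ∧ (∀ a ∈ A, a ≠ m → c a ≠ 0 → r m < r a) ∧ 0 < c m
    swap
    · exact Filter.Eventually.of_forall fun t h1 h2 h3 => absurd ⟨h1, h2, h3⟩ h0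
    obtain ⟨h1, h2, h3⟩ := h0
    have hφ0 : ∑ a ∈ A, c a * (0 : ℝ) ^ (r a - r m) = c m := by
      rw [Finset.sum_eq_single_of_mem m hm, Nat.sub_self, pow_zero, mul_one]
      intro a ha ham
      rcases eq_or_ne (c a) 0 with hc | hc
      · rw [hc, zero_mul]
      · rw [zero_pow (Nat.sub_pos_of_lt (h2 a ha ham hc)).ne', mul_zero]
    filter_upwards [hpos (φ := fun t => ∑ a ∈ A, c a * t ^ (r a - r m)) (by fun_prop)
      (h3.trans_eq hφ0.symm), self_mem_nhdsWithin] with t ht ht0 _ _ _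
    have hsum : ∑ a ∈ A, c a * ω' t a = -(t ^ (r m + 1) * ∑ a ∈ A, c a * t ^ (r a - r m)) := by
      simp only [ω', mul_sub, Finset.sum_sub_distrib, h1, zero_sub, Finset.mul_sum]
      congr 1
      refine Finset.sum_congr rfl fun a ha => ?_
      rcases eq_or_ne (c a) 0 with hc | hc
      · simp [hc]
      · have hle : r m ≤ r a := by
          rcases eq_or_ne a m with rfl | ham
          exacts [le_rfl, (h2 a ha ham hc).le]
        rw [mul_left_comm, ← pow_add]
        congr 2
        omega
    rw [hsum, neg_lt_zero]
    exact mul_pos (pow_pos ht0 _) ht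

variable {d : ℕ}

/-- The heights `ω'` refine the slicing of `A` by pulling the points in the order `r`. -/
structure IsPulling (A : Finset (Fin d → ℝ)) (N : Finset (Fin d → ℤ)) (r : (Fin d → ℝ) → ℕ)
    (ω' : (Fin d → ℝ) → ℝ) : Prop where
  refines : ∀ g, Below A lift ω' g → (contact A lift ω' g).Nonempty → ∃ a,
    (interior (sliceCell (convexHull ℝ (A : Set (Fin d → ℝ))) N a)).Nonempty ∧
      contact A lift ω' g ⊆ contact A lift (sqHeight N) (sliceFunctional N a)
  pull : ∀ g, Below A lift ω' g → ∀ B ⊆ contact A lift ω' g, ∀ x ∈ A,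
    lift x ∈ Submodule.span ℝ (lift '' (B : Set (Fin d → ℝ))) →
    ∀ s : (Fin d → ℝ) × ℝ →ₗ[ℝ] ℝ, (∀ b ∈ B, s (lift b) = sqHeight N b) →
    s (lift x) = sqHeight N x →
    ∀ m ∈ A, (∀ b ∈ B, b ≠ m → r m < r b) → (x ≠ m → r m < r x) →
    (x = m → m ∈ B) ∧ (x ≠ m → m ∈ B → ∃ c : (Fin d → ℝ) → ℝ,
      ∑ b ∈ B, c b • lift b = lift x ∧ 0 ≤ c m)

theorem Finset.sum_ite_mem_mul_of_subset {ι : Type*} [DecidableEq ι] {A B : Finset ι}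
    (h : B ⊆ A) (c u : ι → ℝ) :
    ∑ a ∈ A, (if a ∈ B then c a else 0) * u a = ∑ b ∈ B, c b * u b := by
  simp only [ite_mul, zero_mul]
  rw [Finset.sum_ite_mem, Finset.inter_eq_right.2 h]

theorem map_sum_smul_lift {E : Type*} [AddCommGroup E] [Module ℝ E] {B : Finset E}
    {g : E × ℝ →ₗ[ℝ] ℝ} {u c : E → ℝ} {p : E × ℝ} (hg : ∀ b ∈ B, g (lift b) = u b)
    (hp : ∑ b ∈ B, c b • lift b = p) : ∑ b ∈ B, c b * u b = g p := by
  rw [← hp, map_sum]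
  exact Finset.sum_congr rfl fun b hb => by rw [map_smul, smul_eq_mul, hg b hb]

theorem IsSliced.exists_isPulling {A : Finset (Fin d → ℝ)} {N : Finset (Fin d → ℤ)}
    (H : IsSliced A N) (r : (Fin d → ℝ) → ℕ) : ∃ ω', IsPulling A N r ω' := by
  classical
  have hc : ∀ (B : Finset (Fin d → ℝ)) (x : Fin d → ℝ), ∃ c : (Fin d → ℝ) → ℝ,
      lift x ∈ Submodule.span ℝ (lift '' (B : Set (Fin d → ℝ))) →
        ∑ b ∈ B, c b • lift b = lift x := fun B x => by
    by_cases h : lift x ∈ Submodule.span ℝ (lift '' (B : Set (Fin d → ℝ)))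
    · exact (exists_sum_of_mem_span h).imp fun c hc _ => hc
    · exact ⟨0, fun h' => absurd h' h⟩
  choose c hc using hc
  let X : ((Fin d → ℤ) → ℤ) → Finset (Fin d → ℝ) := fun a =>
    contact A lift (sqHeight N) (sliceFunctional N a)
  have hμ : ∀ B : Finset (Fin d → ℝ), ∃ (y : Fin d → ℝ) (a : (Fin d → ℤ) → ℤ)
      (μ : (Fin d → ℝ) → ℝ), B ⊆ A → B.Nonempty →
        ∑ b ∈ B, (B.card : ℝ)⁻¹ • lift b = lift y ∧
        (interior (sliceCell (convexHull ℝ (A : Set (Fin d → ℝ))) N a)).Nonempty ∧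
        (∀ b ∈ X a, 0 ≤ μ b) ∧ ∑ b ∈ X a, μ b • lift b = lift y := by
    intro B
    by_cases h : B ⊆ A ∧ B.Nonempty
    · obtain ⟨y, hy, hsum⟩ := exists_centroid h.2
      obtain ⟨a, hya, hi⟩ := H.cover y (convexHull_mono (by exact_mod_cast h.1) hy)
      rw [H.cell a hi, ← H.convexHull_contact hi] at hya
      obtain ⟨μ, h1, h2⟩ := mem_convexHull_iff_lift.1 hya
      exact ⟨y, a, μ, fun _ _ => ⟨hsum, hi, h1, h2⟩⟩
    · exact ⟨0, 0, 0, fun h1 h2 => absurd ⟨h1, h2⟩ h⟩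
  choose y a μ hμ using hμ
  let e : Finset (Fin d → ℝ) × (Fin d → ℝ) → (Fin d → ℝ) → ℝ := fun q z =>
    (if z ∈ ({q.2} : Finset (Fin d → ℝ)) then 1 else 0) - (if z ∈ q.1 then c q.1 q.2 z else 0)
  let f : Finset (Fin d → ℝ) → (Fin d → ℝ) → ℝ := fun B z =>
    (if z ∈ B then (B.card : ℝ)⁻¹ else 0) - (if z ∈ X (a B) then μ B z else 0)
  have he : ∀ {B x} (u : (Fin d → ℝ) → ℝ), B ⊆ A → x ∈ A →
      ∑ z ∈ A, e (B, x) z * u z = u x - ∑ b ∈ B, c B x b * u b := by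
    intro B x u hB hx
    simp only [e, sub_mul, Finset.sum_sub_distrib]
    rw [Finset.sum_ite_mem_mul_of_subset (Finset.singleton_subset_iff.2 hx) (fun _ => 1),
      Finset.sum_ite_mem_mul_of_subset hB, Finset.sum_singleton, one_mul]
  have hf : ∀ {B} (u : (Fin d → ℝ) → ℝ), B ⊆ A → ∑ z ∈ A, f B z * u z =
      ∑ b ∈ B, (B.card : ℝ)⁻¹ * u b - ∑ b ∈ X (a B), μ B b * u b := by
    intro B u hB
    simp only [f, sub_mul, Finset.sum_sub_distrib]
    rw [Finset.sum_ite_mem_mul_of_subset hB (fun _ => (B.card : ℝ)⁻¹),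
      Finset.sum_ite_mem_mul_of_subset contact_subset]
  obtain ⟨ω', hω'⟩ := exists_perturbation A (sqHeight N) r
    ((A.powerset ×ˢ A).image e ∪ A.powerset.image f)
  refine ⟨ω', ⟨fun g hg hne => ?_, fun g hg B hB x hx hspan s hsB hsx m hm hmB hmx => ?_⟩⟩
  · have hBA : contact A lift ω' g ⊆ A := contact_subset
    obtain ⟨hsum, hi, hpos, hy⟩ := hμ _ hBA hne
    refine ⟨_, hi, (H.below _).subset_contact hBA hsum ?_⟩
    have h1 := (hω' _ (Finset.mem_union_right _ (Finset.mem_image_of_mem f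
      (Finset.mem_powerset.2 hBA)))).1
    rw [hf _ hBA, hf _ hBA, sub_pos, sub_pos] at h1
    rw [← map_sum_smul_lift (fun b hb => (mem_contact.1 hb).2) hy]
    by_contra! hlt
    have h2 := h1 hlt
    rw [map_sum_smul_lift (fun b hb => (mem_contact.1 hb).2) hsum, ← hy, map_sum] at h2
    refine h2.not_ge (Finset.sum_le_sum fun b hb => ?_)
    rw [map_smul, smul_eq_mul]
    exact mul_le_mul_of_nonneg_left (hg b (contact_subset hb)) (hpos b hb)
  · have hBA := hB.trans contact_subset
    have hcx := hc B x hspan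
    have h1 := (hω' _ (Finset.mem_union_left _ (Finset.mem_image_of_mem e
      (Finset.mk_mem_product (Finset.mem_powerset.2 hBA) hx)))).2
    rw [he _ hBA hx, he _ hBA hx, map_sum_smul_lift hsB hcx, hsx, sub_self,
      map_sum_smul_lift (fun b hb => (mem_contact.1 (hB hb)).2) hcx] at h1
    have h2 : ¬ 0 < e (B, x) m := fun hlt => by
      refine (sub_nonneg.2 (hg x hx)).not_gt (h1 rfl m hm (fun z _ hz hez => ?_) hlt)
      by_cases hzB : z ∈ B
      · exact hmB z hzB hz
      · by_cases hzx : z = x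
        · exact hzx ▸ hmx (hzx ▸ hz)
        · simp [e, hzB, hzx] at hez
    constructor
    · rintro rfl
      by_contra hxB
      simp [e, hxB] at h2
    · intro hxm hmB'
      refine ⟨c B x, hcx, ?_⟩
      simpa [e, hxm.symm, hmB'] using h2

end Pulling

section Unimodular
variable {d : ℕ}

theorem Zd.sub_smul {x y : Fin d → ℝ} (hx : Zd x) (hy : Zd y) (k : ℤ) : Zd (x - (k : ℝ) • y) :=
  fun i => by
    obtain ⟨p, hp⟩ := hx i
    obtain ⟨q, hq⟩ := hy i
    exact ⟨p - k * q, by simp [hp, hq]⟩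

/-- A set for which every combination with integral weight sum that is a lattice point has
integral weights. -/
def IsIntegralSet (B : Finset (Fin d → ℝ)) : Prop :=
  ∀ c : (Fin d → ℝ) → ℝ, (∃ k : ℤ, ∑ b ∈ B, c b = k) → Zd (∑ b ∈ B, c b • b) →
    ∀ b ∈ B, ∃ k : ℤ, c b = k

theorem IsIntegralSet.of_erase {B : Finset (Fin d → ℝ)} {m : Fin d → ℝ}
    (h : IsIntegralSet (B.erase m)) (hmB : m ∈ B) (hm : Zd m) {w : Fin d → ℤ} {k : ℤ}
    (hw : ∀ b ∈ B.erase m, dotZ w b = k) (hwm : dotZ w m = k + 1) : IsIntegralSet B := by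
  rintro c ⟨s, hs⟩ hz
  have hsum := Finset.add_sum_erase B c hmB
  have hsum' := Finset.add_sum_erase B (fun b => c b • b) hmB
  have hcm : ∃ j : ℤ, c m = j := by
    obtain ⟨j, hj⟩ := hz.exists_dotZ w
    refine ⟨j - k * s, ?_⟩
    rw [← hsum', dotZ_add, dotZ_smul, hwm, ← dotLin_apply, map_sum,
      Finset.sum_congr rfl (g := fun b => c b * (k : ℝ)) fun b hb => by
        rw [map_smul, dotLin_apply, hw b hb, smul_eq_mul], ← Finset.sum_mul] at hj
    push_cast
    rw [← hs, ← hsum, ← hj]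
    ring
  obtain ⟨j, hj⟩ := hcm
  intro b hb
  rcases eq_or_ne b m with rfl | hbm
  · exact ⟨j, hj⟩
  refine h c ⟨s - j, ?_⟩ ?_ b (Finset.mem_erase.2 ⟨hbm, hb⟩)
  · push_cast
    rw [← hs, ← hsum, hj]
    ring
  · have := hz.sub_smul hm j
    rwa [← hsum', hj, add_sub_cancel_left] at this

theorem IsIntegralSet.affineIndependent {B : Finset (Fin d → ℝ)} (h : IsIntegralSet B) :
    AffineIndependent ℝ (fun p : B => (p : Fin d → ℝ)) := by
  rw [affineIndependent_iff_of_fintype]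
  intro w hw0 hw i
  rw [Finset.weightedVSub_eq_linear_combination _ hw0] at hw
  by_contra hi
  let c : (Fin d → ℝ) → ℝ := fun b => (2 * w i)⁻¹ * Function.extend Subtype.val w 0 b
  have hc : ∀ b : B, c b = (2 * w i)⁻¹ * w b := fun b => by
    simp only [c, Subtype.val_injective.extend_apply]
  obtain ⟨k, hk⟩ := h c ⟨0, by
      rw [← Finset.sum_coe_sort]
      simp only [hc, ← Finset.mul_sum, hw0, mul_zero, Int.cast_zero]⟩ (by
      rw [← Finset.sum_coe_sort B fun b => c b • b]
      simp only [hc, mul_smul, ← Finset.smul_sum, hw, smul_zero]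
      exact fun _ => ⟨0, by simp⟩) i i.2
  rw [hc] at hk
  have h2 : (2 * k : ℝ) = 1 := by
    rw [← hk]
    field_simp
  have h3 : 2 * k = 1 := by exact_mod_cast h2
  omega

theorem IsIntegralSet.unimodularFinset {B : Finset (Fin d → ℝ)} (h : IsIntegralSet B)
    (hB : ∀ b ∈ B, Zd b) : UnimodularFinset Zd B := by
  classical
  refine ⟨hB, h.affineIndependent, fun x hx hxB => ?_⟩
  have hxB' : x ∈ affineSpan ℝ (Set.range fun p : B => (p : Fin d → ℝ)) := by
    simpa using hxB
  obtain ⟨w, hw1, hw⟩ := eq_affineCombination_of_mem_affineSpan_of_fintype hxB'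
  rw [Finset.affineCombination_eq_linear_combination _ _ _ hw1] at hw
  let c : (Fin d → ℝ) → ℝ := Function.extend Subtype.val w 0
  have hc : ∀ b : B, c b = w b := fun b => Subtype.val_injective.extend_apply w 0 b
  have hc1 : ∑ b ∈ B, c b = 1 := by
    rw [← Finset.sum_coe_sort]
    simpa only [hc] using hw1
  have hcx : ∑ b ∈ B, c b • b = x := by
    rw [← Finset.sum_coe_sort B fun b => c b • b, hw]
    simp only [hc]
  have hint := h c ⟨1, by simpa using hc1⟩ (hcx ▸ hx)
  choose! k hk using hint
  have hk' : ∀ b ∈ B, ((if b ∈ B then k b else 0 : ℤ) : ℝ) = c b := fun b hb => by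
    rw [if_pos hb, hk b hb]
  refine ⟨fun b => if b ∈ B then k b else 0, fun a ha => if_neg ha, ?_, ?_⟩
  · have : ((∑ b ∈ B, if b ∈ B then k b else 0 : ℤ) : ℝ) = 1 := by
      rw [Int.cast_sum, Finset.sum_congr rfl hk', hc1]
    exact_mod_cast this
  · rw [← hcx]
    exact Finset.sum_congr rfl fun b hb => by rw [hk' b hb]

theorem IsPulling.isIntegralSet {A : Finset (Fin d → ℝ)} {N : Finset (Fin d → ℤ)}
    {r : (Fin d → ℝ) → ℕ} {ω' : (Fin d → ℝ) → ℝ} (hp : IsPulling A N r ω') (H : IsSliced A N)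
    (hr : Set.InjOn r A) {g : (Fin d → ℝ) × ℝ →ₗ[ℝ] ℝ} (hg : Below A lift ω' g)
    {a : (Fin d → ℤ) → ℤ}
    (ha : (interior (sliceCell (convexHull ℝ (A : Set (Fin d → ℝ))) N a)).Nonempty)
    (B : Finset (Fin d → ℝ)) (hBg : B ⊆ contact A lift ω' g) (X : Finset (Fin d → ℝ))
    (lo hi : (Fin d → ℤ) → ℤ) (hX : ∀ x, x ∈ X ↔ x ∈ NBox N lo hi ∧ Zd x)
    (hbox : NBox N lo hi ⊆ NBox N a fun v => a v + 1) (hBX : B ⊆ X)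
    (hspan : ∀ x ∈ X, lift x ∈ Submodule.span ℝ (lift '' (B : Set (Fin d → ℝ)))) :
    IsIntegralSet B := by
  classical
  induction hn : B.card generalizing B X lo hi with
  | zero =>
    rw [Finset.card_eq_zero] at hn
    subst hn
    simp [IsIntegralSet]
  | succ n ih =>
    have hXne : X.Nonempty := by
      refine Finset.Nonempty.mono hBX ?_
      rw [← Finset.card_pos]
      omega
    have hXs : X ⊆ contact A lift (sqHeight N) (sliceFunctional N a) := fun x hx =>
      (H.mem_contact_iff ha x).2 ⟨hbox ((hX x).1 hx).1, ((hX x).1 hx).2⟩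
    have hXA : X ⊆ A := hXs.trans contact_subset
    have hs : ∀ x ∈ X, sliceFunctional N a (lift x) = sqHeight N x := fun x hx =>
      (mem_contact.1 (hXs hx)).2
    obtain ⟨m, hmX, hmin⟩ := Finset.exists_min_image X r hXne
    have hlt : ∀ x ∈ X, x ≠ m → r m < r x := fun x hx hxm =>
      lt_of_le_of_ne (hmin x hx) fun h => hxm (hr (hXA hx) (hXA hmX) h.symm)
    have hpull : ∀ B' ⊆ B, ∀ x ∈ X,
        lift x ∈ Submodule.span ℝ (lift '' (B' : Set (Fin d → ℝ))) →
        (x = m → m ∈ B') ∧ (x ≠ m → m ∈ B' → ∃ c : (Fin d → ℝ) → ℝ,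
          ∑ b ∈ B', c b • lift b = lift x ∧ 0 ≤ c m) := fun B' hB' x hx hxB' =>
      hp.pull g hg B' (hB'.trans hBg) x (hXA hx) hxB' _ (fun b hb => hs b (hBX (hB' hb)))
        (hs x hx) m (hXA hmX) (fun b hb => hlt b (hBX (hB' hb))) (hlt x hx)
    have hmB : m ∈ B := (hpull B subset_rfl m hmX (hspan m hmX)).1 rfl
    have hmspan : lift m ∉ Submodule.span ℝ (lift '' (B.erase m : Set (Fin d → ℝ))) := fun h =>
      Finset.notMem_erase m B
        ((hpull (B.erase m) (Finset.erase_subset m B) m hmX (by exact_mod_cast h)).1 rfl)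
    obtain ⟨f, hfm, hf⟩ := Submodule.exists_le_ker_of_notMem hmspan
    have hcoeff : ∀ (l : (Fin d → ℝ) × ℝ →ₗ[ℝ] ℝ), (∀ b ∈ B.erase m, l (lift b) = 0) →
        ∀ (c : (Fin d → ℝ) → ℝ) (p : (Fin d → ℝ) × ℝ), ∑ b ∈ B, c b • lift b = p →
          l p = c m * l (lift m) := by
      rintro l hl c p rfl
      rw [← Finset.add_sum_erase B _ hmB, map_add, map_sum, map_smul, smul_eq_mul,
        Finset.sum_eq_zero fun b hb => by rw [map_smul, hl b hb, smul_zero], add_zero]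
    let h : (Fin d → ℝ) × ℝ →ₗ[ℝ] ℝ := (f (lift m))⁻¹ • f
    have hhm : h (lift m) = 1 := by simp [h, hfm]
    have hh0 : ∀ b ∈ B.erase m, h (lift b) = 0 := fun b hb => by
      have : f (lift b) = 0 := hf (Submodule.subset_span ⟨b, by exact_mod_cast hb, rfl⟩)
      simp [h, this]
    have hhX : ∀ x ∈ X, 0 ≤ h (lift x) := fun x hx => by
      rcases eq_or_ne x m with rfl | hxm
      · simp [hhm]
      · obtain ⟨c, hc, hcm⟩ := (hpull B subset_rfl x hx (hspan x hx)).2 hxm hmB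
        rwa [hcoeff h hh0 c _ hc, hhm, mul_one]
    have hb : Bornology.IsBounded (NBox N lo hi) := (H.isBounded ha).subset hbox
    have hbound : ∀ x ∈ NBox N lo hi, 0 ≤ h (lift x) := fun x hx => by
      rw [← convexHull_eq_NBox H.minors hb hX] at hx
      obtain ⟨μ, hμ, hμx⟩ := mem_convexHull_iff_lift.1 hx
      rw [← hμx, map_sum]
      exact Finset.sum_nonneg fun b hb => by
        rw [map_smul]
        exact mul_nonneg (hμ b hb) (hhX b hb)
    have hmZ : Zd m := ((hX m).1 hmX).2
    rcases (B.erase m).eq_empty_or_nonempty with hem | hne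
    · refine IsIntegralSet.of_erase (w := 0) (k := -1) (by simp [hem, IsIntegralSet]) hmB hmZ
        (by simp [hem]) (by simp [dotZ_zero_left])
    have htight : ∃ v ∈ N, ∃ k : ℤ, lo v ≤ k ∧ k ≤ hi v ∧
        (∀ b ∈ B.erase m, dotZ v b = k) ∧ dotZ v m ≠ k := by
      have hmem : ∀ b ∈ B.erase m, b ∈ NBox N lo hi := fun b hb =>
        ((hX b).1 (hBX (Finset.mem_of_mem_erase hb))).1
      have hle : ∀ v ∈ N, lo v ≤ hi v := fun v hv => by
        have := ((hX m).1 hmX).1 v hv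
        exact_mod_cast this.1.trans this.2
      obtain ⟨v, hv, h1 | h1⟩ := exists_tight hne hmem hh0
        (hhm ▸ one_pos) hbound
      exacts [⟨v, hv, _, le_rfl, hle v hv, h1⟩, ⟨v, hv, _, hle v hv, le_rfl, h1⟩]
    obtain ⟨v, hv, k, hlo, hhi, hvk, hvm⟩ := htight
    have hface : IsIntegralSet (B.erase m) := by
      have hsub : NBox N (Function.update lo v k) (Function.update hi v k) ⊆ NBox N lo hi := by
        intro x hx u hu
        have := hx u hu
        rcases eq_or_ne u v with rfl | huv
        · rw [Function.update_self, Function.update_self] at this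
          have h1 : (lo u : ℝ) ≤ k := by exact_mod_cast hlo
          have h2 : (k : ℝ) ≤ hi u := by exact_mod_cast hhi
          exact ⟨h1.trans this.1, this.2.trans h2⟩
        · rwa [Function.update_of_ne huv, Function.update_of_ne huv] at this
      obtain ⟨X', hX'⟩ := exists_finset_zd (hb.subset hsub)
      refine ih (B.erase m) ((Finset.erase_subset m B).trans hBg) X' _ _ hX'
        (hsub.trans hbox) (fun b hb => ?_) (fun x hx => ?_) ?_
      · have hbX := (hX b).1 (hBX (Finset.mem_of_mem_erase hb))
        refine (hX' b).2 ⟨fun u hu => ?_, hbX.2⟩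
        rcases eq_or_ne u v with rfl | huv
        · rw [Function.update_self, Function.update_self]
          exact ⟨(hvk b hb).ge, (hvk b hb).le⟩
        · rw [Function.update_of_ne huv, Function.update_of_ne huv]
          exact hbX.1 u hu
      · have hx' := (hX' x).1 hx
        have hxX := (hX x).2 ⟨hsub hx'.1, hx'.2⟩
        obtain ⟨c, hc⟩ := exists_sum_of_mem_span (hspan x hxX)
        have hxv : dotZ v x = k := by
          have := hx'.1 v hv
          rw [Function.update_self, Function.update_self] at this
          exact le_antisymm this.2 this.1
        have h1 := hcoeff (affineFunctional (dotLin v) k)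
          (fun b hb => by simp [hvk b hb]) c _ hc
        have hcm : c m = 0 := by
          simpa [hxv, sub_eq_zero, hvm] using h1
        rw [← hc, ← Finset.add_sum_erase B _ hmB, hcm, zero_smul, zero_add]
        exact Submodule.sum_mem _ fun b hb => Submodule.smul_mem _ _
          (Submodule.subset_span ⟨b, by exact_mod_cast hb, rfl⟩)
      · rw [Finset.card_erase_of_mem hmB, hn, Nat.add_sub_cancel]
    obtain ⟨b, hbe⟩ := hne
    have hwidth : dotZ v m = k + 1 ∨ dotZ v m = k - 1 := by
      have hb1 := hbox ((hX b).1 (hBX (Finset.mem_of_mem_erase hbe))).1 v hv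
      have hm1 := hbox ((hX m).1 hmX).1 v hv
      obtain ⟨j, hj⟩ := hmZ.exists_dotZ v
      rw [hvk b hbe] at hb1
      rw [hj] at hm1 hvm ⊢
      norm_cast at hb1 hm1 hvm ⊢
      beta_reduce at hb1 hm1
      omega
    rcases hwidth with h1 | h1
    · exact hface.of_erase hmB hmZ hvk h1
    · refine hface.of_erase (w := -v) (k := -k) hmB hmZ (fun b hb => ?_) ?_
      · rw [dotZ_neg_left, hvk b hb, Int.cast_neg]
      · rw [dotZ_neg_left, h1, Int.cast_neg]
        ring

theorem IsPulling.unimodularFinset {A : Finset (Fin d → ℝ)} {N : Finset (Fin d → ℤ)}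
    {r : (Fin d → ℝ) → ℕ} {ω' : (Fin d → ℝ) → ℝ} (hp : IsPulling A N r ω') (H : IsSliced A N)
    (hr : Set.InjOn r A) {g : (Fin d → ℝ) × ℝ →ₗ[ℝ] ℝ} (hg : Below A lift ω' g)
    (hgs : Spans lift (contact A lift ω' g)) :
    UnimodularFinset Zd (contact A lift ω' g) := by
  obtain ⟨a, ha, hsub⟩ := hp.refines g hg hgs.nonempty
  refine (hp.isIntegralSet H hr hg ha _ subset_rfl _ a _ (H.mem_contact_iff ha) subset_rfl hsub
    fun x _ => ?_).unimodularFinset fun b hb => H.zd (contact_subset hb)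
  rw [show Submodule.span ℝ (lift '' (contact A lift ω' g : Set (Fin d → ℝ))) = ⊤ from hgs]
  exact Submodule.mem_top

theorem IsPulling.isSimplexSet {A : Finset (Fin d → ℝ)} {N : Finset (Fin d → ℤ)}
    {r : (Fin d → ℝ) → ℕ} {ω' : (Fin d → ℝ) → ℝ} (hp : IsPulling A N r ω') (H : IsSliced A N)
    (hr : Set.InjOn r A) {C : Set (Fin d → ℝ)} (hC : C ∈ regularCells A ω') :
    IsSimplexSet C := by
  obtain ⟨g, hg, -, rfl⟩ := mem_regularCells.1 hC
  obtain ⟨g', hg', hsub, hs, -⟩ := hg.exists_spans H.spans (x := 0) ⟨0, by simp⟩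
  exact ⟨_, (hp.unimodularFinset H hr hg' hs).2.1.mono hsub, rfl⟩

theorem IsPulling.unimodularSimplexSet {A : Finset (Fin d → ℝ)} {N : Finset (Fin d → ℤ)}
    {r : (Fin d → ℝ) → ℕ} {ω' : (Fin d → ℝ) → ℝ} (hp : IsPulling A N r ω') (H : IsSliced A N)
    (hr : Set.InjOn r A) {C : Set (Fin d → ℝ)} (hC : MaxCellS (regularCells A ω') C) :
    UnimodularSimplexSet Zd C := by
  obtain ⟨g, hg, hs, rfl⟩ := (maxCellS_regularCells_iff H.spans).1 hC
  exact ⟨_, hp.unimodularFinset H hr hg hs, rfl⟩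

theorem IsSliced.exists_unimodular {A : Finset (Fin d → ℝ)} {N : Finset (Fin d → ℤ)}
    (H : IsSliced A N) : ∃ ω' : (Fin d → ℝ) → ℝ,
      (∀ C ∈ regularCells A ω', IsSimplexSet C) ∧
        ∀ C, MaxCellS (regularCells A ω') C → UnimodularSimplexSet Zd C := by
  obtain ⟨r, hr⟩ := Set.countable_iff_exists_injOn.1 A.finite_toSet.countable
  obtain ⟨ω', hp⟩ := H.exists_isPulling r
  exact ⟨ω', fun C => hp.isSimplexSet H hr, fun C => hp.unimodularSimplexSet H hr⟩

end Unimodular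

/-- **Facet unimodular polytopes.** Let `P ⊆ ℝ^d` be a full-dimensional lattice polytope
whose primitive facet normals all belong to a spanning unimodular vector configuration
`N ⊆ ℤ^d` (all `d × d` minors lie in `{0, ±1}`).  Then (1) the canonical subdivision of
`P`, obtained by slicing `P` along all the lattice hyperplanes with normals in `N`, is a
regular lattice subdivision all of whose cells are compressed, and (2) `P` admits a
regular unimodular triangulation. -/
theorem facet_unimodular_polytope {d : ℕ} (P : Set (Fin d → ℝ))
    (hP : IsLatticePolytope Zd P) (hfull : affineSpan ℝ P = ⊤)
    (N : Finset (Fin d → ℤ))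
    (hNfacets : ∀ F, FacetOf P F → ∃ v ∈ N, ∃ c : ℝ,
        (∀ x ∈ P, dotZ v x ≤ c) ∧ F = {x ∈ P | dotZ v x = c})
    (hNspan : Submodule.span ℝ
        {w : Fin d → ℝ | ∃ v ∈ N, w = fun i => (v i : ℝ)} = ⊤)
    (hNunimodular : ∀ v : Fin d → (Fin d → ℤ), (∀ i, v i ∈ N) →
        (Matrix.of fun i j => v i j).det ∈ ({-1, 0, 1} : Set ℤ)) :
    -- (1) the canonical subdivision is a regular lattice subdivision with compressed cells
    (∃ S : Finset (Set (Fin d → ℝ)),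
      IsSubdivision P S ∧ (∀ C ∈ S, IsLatticePolytope Zd C) ∧
      IsRegularSubdivision P S ∧
      (∀ C, MaxCellS S C ↔
        ((interior C).Nonempty ∧ ∃ a : (Fin d → ℤ) → ℤ,
          C = {x ∈ P | ∀ v ∈ N, (a v : ℝ) ≤ dotZ v x ∧ dotZ v x ≤ (a v : ℝ) + 1})) ∧
      (∀ C, MaxCellS S C → IsCompressedW C)) ∧
    -- (2) P has a regular unimodular triangulation
    (∃ T : Finset (Set (Fin d → ℝ)),
      IsSubdivision P T ∧ IsRegularSubdivision P T ∧
      (∀ C ∈ T, IsSimplexSet C) ∧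
      (∀ C, MaxCellS T C → UnimodularSimplexSet Zd C)) := by
  obtain ⟨A, rfl, H⟩ := exists_isSliced hP hfull hNunimodular hNfacets
  obtain ⟨ω', hsimplex, hunimodular⟩ := H.exists_unimodular
  exact ⟨⟨regularCells A (sqHeight N), isSubdivision_regularCells H.spans _,
      fun C => H.isLatticePolytope, isRegularSubdivision_regularCells H.spans _,
      fun C => H.maxCellS_iff, fun C => H.isCompressedW⟩,
    ⟨regularCells A ω', isSubdivision_regularCells H.spans _,
      isRegularSubdivision_regularCells H.spans _, hsimplex, hunimodular⟩⟩
end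

section
/- Let A be a configuration of d+2 points in ℝ^d whose affine span is d-dimensional, and let λ ∈ ℝ^A be its affine dependence, unique up to a nonzero scalar. Set A⁺ = {a ∈ A : λ_a > 0} and A⁻ = {a ∈ A : λ_a < 0}. Then A has exactly two triangulations, namely T⁺ = {F ⊆ A : A⁺ ⊄ F} and T⁻ = {F ⊆ A : A⁻ ⊄ F}, and both triangulations are regular. -/
/-- A triangulation of the point configuration `A`: a triangulation of `conv(A)` all of
whose vertices belong to `A`. -/
def IsTriangulationOfConfig {E : Type*} [AddCommGroup E] [Module ℝ E]
    (A : Finset E) (T : Finset (Finset E)) : Prop :=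
  (∀ F ∈ T, F ⊆ A) ∧ IsTriangulation (convexHull ℝ (A : Set E)) T

/-- A regular triangulation of the point configuration `A`: one induced by a weight vector
`ω`, its faces being the subsets of `A` on which the lower envelope of the lifted points is
attained by a single affine function. -/
def IsRegularConfigTriangulation {E : Type*} [AddCommGroup E] [Module ℝ E]
    (A : Finset E) (T : Finset (Finset E)) : Prop :=
  IsTriangulationOfConfig A T ∧
  ∃ ω : E → ℝ, ∀ F : Finset E, F ∈ T ↔
    (F ⊆ A ∧ ∃ g : E →ᵃ[ℝ] ℝ, (∀ a ∈ A, g a ≤ ω a) ∧ ∀ a ∈ F, g a = ω a)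

theorem range_coe_finset {α : Type*} (F : Finset α) :
    Set.range (fun p : F => (p : α)) = F :=
  Subtype.range_coe

section Circuit

variable {E : Type*} [AddCommGroup E] [Module ℝ E]

/-- Membership in the convex hull of a subset `F ⊆ A`, by weights on `E` supported in `F`
and summed over `A`. -/
theorem mem_convexHull_iff_of_subset {A F : Finset E} (hF : F ⊆ A) {x : E} :
    x ∈ convexHull ℝ (F : Set E) ↔ ∃ w : E → ℝ, (∀ a, 0 ≤ w a) ∧ (∀ a, a ∉ F → w a = 0) ∧
      ∑ a ∈ A, w a = 1 ∧ ∑ a ∈ A, w a • a = x := by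
  classical
  rw [Finset.mem_convexHull']
  constructor
  · rintro ⟨w, h0, h1, hx⟩
    refine ⟨fun a => if a ∈ F then w a else 0, fun a => ?_, fun a ha => if_neg ha, ?_, ?_⟩
    · dsimp only
      split_ifs with h
      exacts [h0 a h, le_rfl]
    · rw [← h1, ← Finset.sum_subset hF fun a _ ha => if_neg ha]
      exact Finset.sum_congr rfl fun a ha => if_pos ha
    · rw [← hx, ← Finset.sum_subset hF fun a _ ha => by simp [ha]]
      exact Finset.sum_congr rfl fun a ha => by simp [ha]
  · rintro ⟨w, h0, hF0, h1, hx⟩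
    refine ⟨w, fun a _ => h0 a, ?_, ?_⟩
    · rw [← h1, Finset.sum_subset hF fun a _ ha => hF0 a ha]
    · rw [← hx, Finset.sum_subset hF fun a _ ha => by rw [hF0 a ha, zero_smul]]

theorem affineIndependent_finset_iff {F : Finset E} :
    AffineIndependent ℝ (fun p : F => (p : E)) ↔
      ∀ w : E → ℝ, ∑ a ∈ F, w a = 0 → ∑ a ∈ F, w a • a = 0 → ∀ a ∈ F, w a = 0 := by
  classical
  rw [affineIndependent_iff]
  constructor
  · intro h w h0 h1 a ha
    refine h Finset.univ (fun p => w p) ?_ ?_ ⟨a, ha⟩ (Finset.mem_univ _)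
    · rw [← h0]; exact Finset.sum_coe_sort F w
    · rw [← h1]; exact Finset.sum_coe_sort F fun a => w a • a
  · intro h s w h0 h1 e he
    let v : E → ℝ := fun a => if ha : a ∈ F then (if ⟨a, ha⟩ ∈ s then w ⟨a, ha⟩ else 0) else 0
    have hv : ∀ p : F, v p = if p ∈ s then w p else 0 := fun p => dif_pos p.2
    have := h v ?_ ?_ e e.2
    · rwa [hv, if_pos he] at this
    · rw [← Finset.sum_coe_sort F v]
      simpa only [hv, Finset.sum_ite_mem, Finset.univ_inter] using h0
    · rw [← Finset.sum_coe_sort F fun a => v a • a]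
      simpa only [hv, ite_smul, zero_smul, Finset.sum_ite_mem, Finset.univ_inter] using h1

/-- `lam` spans the space of affine dependences of the configuration `A`. -/
structure IsCircuitDependence (A : Finset E) (lam : E → ℝ) : Prop where
  supp : ∀ a, a ∉ A → lam a = 0
  sum_eq_zero : ∑ a ∈ A, lam a = 0
  sum_smul_eq_zero : ∑ a ∈ A, lam a • a = 0
  exists_ne_zero : ∃ a ∈ A, lam a ≠ 0
  unique : ∀ v : E → ℝ, (∀ a, a ∉ A → v a = 0) → ∑ a ∈ A, v a = 0 →
    ∑ a ∈ A, v a • a = 0 → ∃ t : ℝ, ∀ a, v a = t * lam a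

namespace IsCircuitDependence

variable {A : Finset E} {lam : E → ℝ}

theorem neg (h : IsCircuitDependence A lam) : IsCircuitDependence A (-lam) where
  supp a ha := by simp [h.supp a ha]
  sum_eq_zero := by simp [h.sum_eq_zero]
  sum_smul_eq_zero := by simp [h.sum_smul_eq_zero]
  exists_ne_zero := by simpa using h.exists_ne_zero
  unique v h0 h1 h2 := by
    obtain ⟨t, ht⟩ := h.unique v h0 h1 h2
    exact ⟨-t, fun a => by simp [ht]⟩

theorem exists_pos (h : IsCircuitDependence A lam) : ∃ a ∈ A, 0 < lam a :=
  Finset.exists_pos_of_sum_zero_of_exists_nonzero lam h.sum_eq_zero h.exists_ne_zero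

theorem exists_neg (h : IsCircuitDependence A lam) : ∃ a ∈ A, lam a < 0 := by
  simpa using h.neg.exists_pos

theorem weights_eq_add_mul (h : IsCircuitDependence A lam) {v w : E → ℝ}
    (hv : ∀ a, a ∉ A → v a = 0) (hw : ∀ a, a ∉ A → w a = 0)
    (h1 : ∑ a ∈ A, v a = ∑ a ∈ A, w a) (h2 : ∑ a ∈ A, v a • a = ∑ a ∈ A, w a • a) :
    ∃ t : ℝ, ∀ a, v a = w a + t * lam a := by
  obtain ⟨t, ht⟩ := h.unique (fun a => v a - w a) (fun a ha => by simp [hv a ha, hw a ha])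
    (by simp [h1]) (by simp [sub_smul, h2])
  exact ⟨t, fun a => by linarith [ht a]⟩

theorem affineIndependent_iff_exists (h : IsCircuitDependence A lam) {F : Finset E}
    (hF : F ⊆ A) :
    AffineIndependent ℝ (fun p : F => (p : E)) ↔ ∃ a ∈ A, lam a ≠ 0 ∧ a ∉ F := by
  classical
  rw [affineIndependent_finset_iff]
  constructor
  · intro hi
    by_contra! hc
    have hz : ∀ a ∈ A, a ∉ F → lam a = 0 := fun a ha haF => by
      by_contra hne
      exact haF (hc a ha hne)
    obtain ⟨a, ha, hne⟩ := h.exists_ne_zero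
    refine hne (hi lam ?_ ?_ a (hc a ha hne))
    · rw [Finset.sum_subset hF hz, h.sum_eq_zero]
    · rw [Finset.sum_subset hF fun a ha haF => by rw [hz a ha haF, zero_smul],
        h.sum_smul_eq_zero]
  · rintro ⟨b, -, hb, hbF⟩ w h0 h1 a ha
    have hz : ∀ a, a ∉ F → (if a ∈ F then w a else 0) = 0 := fun a ha => if_neg ha
    obtain ⟨t, ht⟩ := h.unique (fun a => if a ∈ F then w a else 0)
      (fun a ha => hz a fun haF => ha (hF haF))
      (by
        rw [← Finset.sum_subset hF fun a _ ha => hz a ha, ← h0]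
        exact Finset.sum_congr rfl fun a ha => if_pos ha)
      (by
        rw [← Finset.sum_subset hF fun a _ ha => by rw [hz a ha, zero_smul], ← h1]
        exact Finset.sum_congr rfl fun a ha => by rw [if_pos ha])
    have hbt := ht b
    rw [if_neg hbF, eq_comm, mul_eq_zero, or_iff_left hb] at hbt
    simpa [ha, hbt] using ht a

variable {T Tplus Tminus : Finset (Finset E)}

theorem convexHull_inter_of_mem_plus (h : IsCircuitDependence A lam)
    (hT : ∀ F, F ∈ Tplus ↔ (F ⊆ A ∧ ¬ ∀ a ∈ A, 0 < lam a → a ∈ F)) {F G : Finset E}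
    (hF : F ∈ Tplus) (hG : G ∈ Tplus) :
    convexHull ℝ (F : Set E) ∩ convexHull ℝ (G : Set E) =
      convexHull ℝ ((F : Set E) ∩ (G : Set E)) := by
  classical
  obtain ⟨hFA, hFn⟩ := (hT F).1 hF
  obtain ⟨hGA, hGn⟩ := (hT G).1 hG
  push Not at hFn hGn
  obtain ⟨p, -, hp, hpF⟩ := hFn
  obtain ⟨q, -, hq, hqG⟩ := hGn
  refine Set.Subset.antisymm ?_ (Set.subset_inter (convexHull_mono Set.inter_subset_left)
    (convexHull_mono Set.inter_subset_right))
  rintro x ⟨hxF, hxG⟩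
  rw [mem_convexHull_iff_of_subset hFA] at hxF
  rw [mem_convexHull_iff_of_subset hGA] at hxG
  obtain ⟨v, v0, vF, v1, vx⟩ := hxF
  obtain ⟨w, w0, wG, w1, wx⟩ := hxG
  obtain ⟨t, ht⟩ := h.weights_eq_add_mul (fun a ha => vF a fun haF => ha (hFA haF))
    (fun a ha => wG a fun haG => ha (hGA haG)) (v1.trans w1.symm) (vx.trans wx.symm)
  have ht0 : t = 0 := by
    have h1 := ht p
    have h2 := ht q
    rw [vF p hpF] at h1
    rw [wG q hqG] at h2
    have h3 := w0 p
    have h4 := v0 q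
    apply le_antisymm
    · by_contra! hc
      linarith [mul_pos hc hp]
    · by_contra! hc
      linarith [mul_neg_of_neg_of_pos hc hq]
  rw [← Finset.coe_inter, mem_convexHull_iff_of_subset (Finset.inter_subset_left.trans hFA)]
  refine ⟨v, v0, fun a ha => ?_, v1, vx⟩
  by_cases haF : a ∈ F
  · have haG : a ∉ G := fun haG => ha (Finset.mem_inter.2 ⟨haF, haG⟩)
    simp [ht, ht0, wG a haG]
  · exact vF a haF

theorem exists_mem_plus_mem_convexHull (h : IsCircuitDependence A lam)
    (hT : ∀ F, F ∈ Tplus ↔ (F ⊆ A ∧ ¬ ∀ a ∈ A, 0 < lam a → a ∈ F)) {x : E}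
    (hx : x ∈ convexHull ℝ (A : Set E)) :
    ∃ F ∈ Tplus, x ∈ convexHull ℝ (F : Set E) := by
  classical
  rw [mem_convexHull_iff_of_subset subset_rfl] at hx
  obtain ⟨w, w0, wA, w1, wx⟩ := hx
  obtain ⟨b, hb, hmin⟩ := (A.filter fun a => 0 < lam a).exists_min_image
    (fun a => w a / lam a) (by simpa [Finset.filter_nonempty_iff] using h.exists_pos)
  rw [Finset.mem_filter] at hb
  refine ⟨A.erase b, (hT _).2 ⟨Finset.erase_subset _ _, fun hall =>
    Finset.notMem_erase b A (hall b hb.1 hb.2)⟩, ?_⟩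
  rw [mem_convexHull_iff_of_subset (Finset.erase_subset _ _)]
  have ht : 0 ≤ w b / lam b := div_nonneg (w0 b) hb.2.le
  refine ⟨fun a => w a - w b / lam b * lam a, fun a => ?_, fun a ha => ?_, ?_, ?_⟩
  · rw [sub_nonneg]
    rcases le_or_gt (lam a) 0 with hl | hl
    · exact (mul_nonpos_of_nonneg_of_nonpos ht hl).trans (w0 a)
    · have haA : a ∈ A := by
        by_contra haA
        exact hl.ne' (h.supp a haA)
      exact (le_div_iff₀ hl).1 (hmin a (Finset.mem_filter.2 ⟨haA, hl⟩))
  · rcases eq_or_ne a b with rfl | hab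
    · simp [hb.2.ne']
    · have haA : a ∉ A := fun haA => ha (Finset.mem_erase.2 ⟨hab, haA⟩)
      simp [wA a haA, h.supp a haA]
  · simp [← Finset.mul_sum, h.sum_eq_zero, w1]
  · simp [sub_smul, mul_smul, ← Finset.smul_sum, h.sum_smul_eq_zero, wx]

theorem isTriangulationOfConfig_plus (h : IsCircuitDependence A lam)
    (hT : ∀ F, F ∈ Tplus ↔ (F ⊆ A ∧ ¬ ∀ a ∈ A, 0 < lam a → a ∈ F)) :
    IsTriangulationOfConfig A Tplus := by
  refine ⟨fun F hF => ((hT F).1 hF).1, fun F hF => ?_, fun F hF G hG => ?_,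
    fun F hF G hG => h.convexHull_inter_of_mem_plus hT hF hG, ?_⟩
  · obtain ⟨hFA, hFn⟩ := (hT F).1 hF
    push Not at hFn
    obtain ⟨p, hpA, hp, hpF⟩ := hFn
    exact (h.affineIndependent_iff_exists hFA).2 ⟨p, hpA, hp.ne', hpF⟩
  · obtain ⟨hFA, hFn⟩ := (hT F).1 hF
    exact (hT G).2 ⟨hG.trans hFA, fun hall => hFn fun a ha hpos => hG (hall a ha hpos)⟩
  · refine Set.Subset.antisymm (Set.iUnion₂_subset fun F hF =>
      convexHull_mono (Finset.coe_subset.2 ((hT F).1 hF).1)) fun x hx => ?_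
    simpa using h.exists_mem_plus_mem_convexHull hT hx

/-- A triangulation all of whose faces are faces of `T⁺` is `T⁺`. -/
theorem eq_plus_of_subset (h : IsCircuitDependence A lam)
    (hTp : ∀ F, F ∈ Tplus ↔ (F ⊆ A ∧ ¬ ∀ a ∈ A, 0 < lam a → a ∈ F))
    (hT : IsTriangulationOfConfig A T) (hsub : T ⊆ Tplus) : T = Tplus := by
  classical
  refine Finset.Subset.antisymm hsub fun F hF => ?_
  obtain ⟨-, -, hdown, -, hcover⟩ := hT
  have hFA : F ⊆ A := ((hTp F).1 hF).1
  have hcov : ∀ x ∈ convexHull ℝ (A : Set E), ∃ G ∈ T, x ∈ convexHull ℝ (G : Set E) := by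
    intro x hx
    rw [← hcover] at hx
    simpa using hx
  rcases F.eq_empty_or_nonempty with rfl | hne
  · obtain ⟨a, ha, -⟩ := h.exists_ne_zero
    obtain ⟨G, hG, -⟩ := hcov a (subset_convexHull ℝ _ ha)
    exact hdown G hG _ (Finset.empty_subset _)
  have hcard : (F.card : ℝ) ≠ 0 := by exact_mod_cast hne.card_pos.ne'
  let x : E := ∑ a ∈ F, (F.card : ℝ)⁻¹ • a
  have hxF : x ∈ convexHull ℝ (F : Set E) :=
    Finset.mem_convexHull'.2 ⟨fun _ => (F.card : ℝ)⁻¹, fun _ _ => by positivity,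
      by simp [hcard], rfl⟩
  obtain ⟨G, hG, hxG⟩ := hcov x (convexHull_mono (Finset.coe_subset.2 hFA) hxF)
  refine hdown G hG F fun a ha => ?_
  have hx : x ∈ convexHull ℝ ((F : Set E) ∩ (G : Set E)) := by
    rw [← h.convexHull_inter_of_mem_plus hTp hF (hsub hG)]
    exact ⟨hxF, hxG⟩
  rw [← Finset.coe_inter, mem_convexHull_iff_of_subset Finset.inter_subset_left] at hx
  obtain ⟨w, -, wz, w1, wx⟩ := hx
  have hind := affineIndependent_finset_iff.1
    ((h.isTriangulationOfConfig_plus hTp).2.1 F hF) (fun a => w a - (F.card : ℝ)⁻¹)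
    (by simp [w1, hcard]) (by simp only [sub_smul, Finset.sum_sub_distrib, wx, x, sub_self]) a ha
  by_contra haG
  rw [wz a fun hm => haG (Finset.mem_inter.1 hm).2, zero_sub, neg_eq_zero] at hind
  exact inv_ne_zero hcard hind

/-- Radon's partition of a circuit: `conv A⁺` and `conv A⁻` meet. -/
theorem convexHull_pos_inter_neg_nonempty (h : IsCircuitDependence A lam) :
    (convexHull ℝ ((A.filter fun a => 0 < lam a : Finset E) : Set E) ∩
      convexHull ℝ ((A.filter fun a => lam a < 0 : Finset E) : Set E)).Nonempty := by
  classical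
  have hsplit : ∀ a, (lam a)⁻ = (lam a)⁺ - lam a := fun a => by
    linarith [posPart_sub_negPart (lam a)]
  obtain ⟨b, hb, hbpos⟩ := h.exists_pos
  have hs : 0 < ∑ a ∈ A, (lam a)⁺ :=
    Finset.sum_pos' (fun a _ => posPart_nonneg _) ⟨b, hb, posPart_pos hbpos⟩
  refine ⟨∑ a ∈ A, ((∑ a ∈ A, (lam a)⁺)⁻¹ * (lam a)⁺) • a, ?_, ?_⟩
  · rw [mem_convexHull_iff_of_subset (Finset.filter_subset _ _)]
    refine ⟨fun a => (∑ a ∈ A, (lam a)⁺)⁻¹ * (lam a)⁺, fun a => by positivity,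
      fun a ha => ?_, ?_, rfl⟩
    · have : lam a ≤ 0 := by
        by_cases haA : a ∈ A
        · simpa [haA] using ha
        · exact (h.supp a haA).le
      simp [posPart_eq_zero.2 this]
    · rw [← Finset.mul_sum, inv_mul_cancel₀ hs.ne']
  · rw [mem_convexHull_iff_of_subset (Finset.filter_subset _ _)]
    refine ⟨fun a => (∑ a ∈ A, (lam a)⁺)⁻¹ * (lam a)⁻, fun a => by positivity,
      fun a ha => ?_, ?_, ?_⟩
    · have : 0 ≤ lam a := by
        by_cases haA : a ∈ A
        · simpa [haA] using ha
        · exact (h.supp a haA).ge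
      simp [negPart_eq_zero.2 this]
    · simp only [hsplit, ← Finset.mul_sum, Finset.sum_sub_distrib, h.sum_eq_zero, sub_zero]
      exact inv_mul_cancel₀ hs.ne'
    · simp only [hsplit, mul_smul, ← Finset.smul_sum, sub_smul, Finset.sum_sub_distrib,
        h.sum_smul_eq_zero, sub_zero]

theorem eq_plus_or_eq_minus (h : IsCircuitDependence A lam)
    (hTp : ∀ F, F ∈ Tplus ↔ (F ⊆ A ∧ ¬ ∀ a ∈ A, 0 < lam a → a ∈ F))
    (hTm : ∀ F, F ∈ Tminus ↔ (F ⊆ A ∧ ¬ ∀ a ∈ A, lam a < 0 → a ∈ F))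
    (hT : IsTriangulationOfConfig A T) : T = Tplus ∨ T = Tminus := by
  classical
  have hTA := hT.1
  obtain ⟨-, hdown, hinter, -⟩ := hT.2
  by_cases hpos : (A.filter fun a => 0 < lam a) ∈ T
  · right
    refine h.neg.eq_plus_of_subset (by simpa using hTm) hT fun F hF => (hTm F).2
      ⟨hTA F hF, fun hall => ?_⟩
    have hneg : (A.filter fun a => lam a < 0) ∈ T :=
      hdown F hF _ fun a ha => hall a (Finset.mem_filter.1 ha).1 (Finset.mem_filter.1 ha).2
    have hne := h.convexHull_pos_inter_neg_nonempty
    rw [hinter _ hpos _ hneg, convexHull_nonempty_iff] at hne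
    obtain ⟨a, ha, ha'⟩ := hne
    exact lt_asymm (Finset.mem_filter.1 ha).2 (Finset.mem_filter.1 ha').2
  · left
    exact h.eq_plus_of_subset hTp hT fun F hF => (hTp F).2 ⟨hTA F hF, fun hall => hpos
      (hdown F hF _ fun a ha => hall a (Finset.mem_filter.1 ha).1 (Finset.mem_filter.1 ha).2)⟩

theorem plus_ne_minus (h : IsCircuitDependence A lam)
    (hTp : ∀ F, F ∈ Tplus ↔ (F ⊆ A ∧ ¬ ∀ a ∈ A, 0 < lam a → a ∈ F))
    (hTm : ∀ F, F ∈ Tminus ↔ (F ⊆ A ∧ ¬ ∀ a ∈ A, lam a < 0 → a ∈ F)) : Tplus ≠ Tminus := by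
  classical
  rintro rfl
  obtain ⟨b, hb, hbneg⟩ := h.exists_neg
  have hmem : (A.filter fun a => 0 < lam a) ∈ Tplus := (hTm _).2
    ⟨Finset.filter_subset _ _, fun hall =>
      lt_asymm hbneg (Finset.mem_filter.1 (hall b hb hbneg)).2⟩
  exact ((hTp _).1 hmem).2 fun a ha hpos => Finset.mem_filter.2 ⟨ha, hpos⟩

theorem sum_mul_affineMap_eq_zero (h : IsCircuitDependence A lam) (g : E →ᵃ[ℝ] ℝ) :
    ∑ a ∈ A, lam a * g a = 0 := by
  obtain ⟨c, hg⟩ : ∃ c, ∀ a, g a = g.linear a + c := ⟨g 0, congrFun g.decomp⟩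
  have hlin : ∑ a ∈ A, lam a * g.linear a = g.linear (∑ a ∈ A, lam a • a) := by
    simp only [map_sum, map_smul, smul_eq_mul]
  simp only [hg, mul_add, Finset.sum_add_distrib, ← Finset.sum_mul, h.sum_eq_zero, zero_mul,
    add_zero]
  rw [hlin, h.sum_smul_eq_zero, map_zero]

end IsCircuitDependence

theorem affineSpan_erase_of_dependence [DecidableEq E] {A : Finset E} {lam : E → ℝ}
    (h0 : ∑ a ∈ A, lam a = 0) (h1 : ∑ a ∈ A, lam a • a = 0) {b : E} (hb : b ∈ A)
    (hne : lam b ≠ 0) :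
    affineSpan ℝ (A.erase b : Set E) = affineSpan ℝ (A : Set E) := by
  refine le_antisymm (affineSpan_mono ℝ (Finset.coe_subset.2 (Finset.erase_subset _ _))) ?_
  rw [affineSpan_le]
  intro a ha
  rcases eq_or_ne a b with rfl | hab
  · have hw : ∑ i ∈ (Finset.univ : Finset (A.erase a)), -(lam a)⁻¹ * lam i = 1 := by
      rw [Finset.sum_coe_sort (A.erase a) fun i => -(lam a)⁻¹ * lam i, ← Finset.mul_sum,
        Finset.sum_erase_eq_sub hb, h0]
      field_simp
      simp
    have hmem := affineCombination_mem_affineSpan hw (fun i : A.erase a => (i : E))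
    rw [Finset.affineCombination_eq_linear_combination _ _ _ hw,
      Finset.sum_coe_sort (A.erase a) fun i => (-(lam a)⁻¹ * lam i) • i] at hmem
    simp only [mul_smul] at hmem
    rw [← Finset.smul_sum, Finset.sum_erase_eq_sub hb, h1, zero_sub, smul_neg, neg_smul,
      neg_neg, inv_smul_smul₀ hne] at hmem
    rwa [range_coe_finset] at hmem
  · exact subset_affineSpan ℝ _ (Finset.mem_coe.2 (Finset.mem_erase.2 ⟨hab, ha⟩))

namespace IsCircuitDependence

variable {A : Finset E} {lam : E → ℝ} {Tplus : Finset (Finset E)}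

/-- In a spanning configuration of `dim E + 2` points any nonzero dependence spans the
space of dependences. -/
theorem of_card_eq_finrank_add_two [FiniteDimensional ℝ E]
    (hcard : A.card = Module.finrank ℝ E + 2) (hspan : affineSpan ℝ (A : Set E) = ⊤)
    (hsupp : ∀ a, a ∉ A → lam a = 0) (h0 : ∑ a ∈ A, lam a = 0)
    (h1 : ∑ a ∈ A, lam a • a = 0) (hne : ∃ a ∈ A, lam a ≠ 0) :
    IsCircuitDependence A lam where
  supp := hsupp
  sum_eq_zero := h0
  sum_smul_eq_zero := h1
  exists_ne_zero := hne
  unique v hv v0 v1 := by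
    classical
    obtain ⟨b, hb, hbne⟩ := hne
    have hsp : affineSpan ℝ (A.erase b : Set E) = ⊤ :=
      (affineSpan_erase_of_dependence h0 h1 hb hbne).trans hspan
    have hind : AffineIndependent ℝ (fun p : A.erase b => (p : E)) := by
      rw [affineIndependent_iff_finrank_vectorSpan_eq ℝ _ (n := Module.finrank ℝ E)
        (by simp [Finset.card_erase_of_mem hb, hcard]), range_coe_finset]
      exact (congrArg (fun S : Submodule ℝ E => Module.finrank ℝ S)
        (AffineSubspace.vectorSpan_eq_top_of_affineSpan_eq_top ℝ E E hsp)).trans (finrank_top ℝ E)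
    rw [affineIndependent_finset_iff] at hind
    have hvb : v b - v b / lam b * lam b = 0 := by simp [hbne]
    have hzero := hind (fun a => v a - v b / lam b * lam a)
      (by
        rw [Finset.sum_erase A hvb]
        simp [← Finset.mul_sum, h0, v0])
      (by
        rw [Finset.sum_erase A (by rw [hvb, zero_smul])]
        simp [sub_smul, mul_smul, ← Finset.smul_sum, h1, v1])
    refine ⟨v b / lam b, fun a => ?_⟩
    rcases eq_or_ne a b with rfl | hab
    · exact sub_eq_zero.1 hvb
    · by_cases haA : a ∈ A
      · exact sub_eq_zero.1 (hzero a (Finset.mem_erase.2 ⟨hab, haA⟩))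
      · simp [hv a haA, hsupp a haA]

theorem exists_affineMap_eq_on_erase [DecidableEq E] (h : IsCircuitDependence A lam)
    (hspan : affineSpan ℝ (A : Set E) = ⊤) {b : E} (hb : b ∈ A) (hne : lam b ≠ 0)
    (ω : E → ℝ) : ∃ g : E →ᵃ[ℝ] ℝ, ∀ a ∈ A.erase b, g a = ω a := by
  let B : AffineBasis (A.erase b) ℝ E :=
    { toFun := fun p => p
      ind' := (h.affineIndependent_iff_exists (Finset.erase_subset _ _)).2
        ⟨b, hb, hne, Finset.notMem_erase b A⟩
      tot' := by
        rw [range_coe_finset]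
        exact (affineSpan_erase_of_dependence h.sum_eq_zero h.sum_smul_eq_zero hb hne).trans
          hspan }
  refine ⟨∑ i : A.erase b, ω i • B.coord i, fun a ha => ?_⟩
  have hsum : ∀ s : Finset (A.erase b),
      (∑ i ∈ s, ω i • B.coord i) a = ∑ i ∈ s, ω i * B.coord i a := fun s => by
    induction s using Finset.induction_on with
    | empty => simp
    | insert i s hi ih => simp [Finset.sum_insert hi, ih]
  have hB : ∀ i, B.coord i a = if i = ⟨a, ha⟩ then 1 else 0 := fun i =>
    B.coord_apply i ⟨a, ha⟩
  simp [hsum, hB]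

/-- The dependence itself is a weight vector inducing `T⁺`. -/
theorem isRegularConfigTriangulation_plus (h : IsCircuitDependence A lam)
    (hspan : affineSpan ℝ (A : Set E) = ⊤)
    (hT : ∀ F, F ∈ Tplus ↔ (F ⊆ A ∧ ¬ ∀ a ∈ A, 0 < lam a → a ∈ F)) :
    IsRegularConfigTriangulation A Tplus := by
  classical
  have hslack : ∀ g : E →ᵃ[ℝ] ℝ, 0 < ∑ a ∈ A, lam a * (lam a - g a) := fun g => by
    simp only [mul_sub, Finset.sum_sub_distrib, h.sum_mul_affineMap_eq_zero, sub_zero]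
    obtain ⟨b, hb, hne⟩ := h.exists_ne_zero
    exact Finset.sum_pos' (fun a _ => mul_self_nonneg _) ⟨b, hb, mul_self_pos.2 hne⟩
  refine ⟨h.isTriangulationOfConfig_plus hT, lam, fun F => (hT F).trans
    (and_congr_right fun hFA => ⟨fun hn => ?_, ?_⟩)⟩
  · push Not at hn
    obtain ⟨b, hb, hpos, hbF⟩ := hn
    obtain ⟨g, hg⟩ := h.exists_affineMap_eq_on_erase hspan hb hpos.ne' lam
    have hs := hslack g
    rw [← Finset.add_sum_erase A _ hb,
      Finset.sum_eq_zero fun a ha => by rw [hg a ha, sub_self, mul_zero], add_zero] at hs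
    refine ⟨g, fun a ha => ?_, fun a ha => hg a (Finset.mem_erase.2
      ⟨fun hab => hbF (hab ▸ ha), hFA ha⟩)⟩
    rcases eq_or_ne a b with rfl | hab
    · exact (sub_pos.1 (pos_of_mul_pos_right hs hpos.le)).le
    · exact (hg a (Finset.mem_erase.2 ⟨hab, ha⟩)).le
  · rintro ⟨g, hle, heq⟩ hall
    refine (hslack g).not_ge (Finset.sum_nonpos fun a ha => ?_)
    rcases le_or_gt (lam a) 0 with hl | hl
    · exact mul_nonpos_of_nonpos_of_nonneg hl (sub_nonneg.2 (hle a ha))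
    · rw [heq a (hall a ha hl), sub_self, mul_zero]

end IsCircuitDependence

end Circuit

/-- **The two triangulations of a circuit.** Let `A` be a configuration of `d + 2` points
affinely spanning `ℝ^d`, with (essentially unique) affine dependence `λ`.  Then `A` has
exactly two triangulations, `T⁺ = {F ⊆ A : A⁺ ⊄ F}` and `T⁻ = {F ⊆ A : A⁻ ⊄ F}`, and both
are regular. -/
theorem circuit_has_two_regular_triangulations {d : ℕ}
    (A : Finset (Fin d → ℝ)) (lam : (Fin d → ℝ) → ℝ)
    (hcard : A.card = d + 2)
    (hspan : affineSpan ℝ (A : Set (Fin d → ℝ)) = ⊤)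
    (hsupp : ∀ a, a ∉ A → lam a = 0)
    (hdep0 : ∑ a ∈ A, lam a = 0)
    (hdep : ∑ a ∈ A, lam a • a = 0)
    (hne : ∃ a ∈ A, lam a ≠ 0)
    (Tplus Tminus : Finset (Finset (Fin d → ℝ)))
    (hTplus : ∀ F, F ∈ Tplus ↔ (F ⊆ A ∧ ¬ ∀ a ∈ A, 0 < lam a → a ∈ F))
    (hTminus : ∀ F, F ∈ Tminus ↔ (F ⊆ A ∧ ¬ ∀ a ∈ A, lam a < 0 → a ∈ F)) :
    (∀ T, IsTriangulationOfConfig A T ↔ (T = Tplus ∨ T = Tminus)) ∧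
    Tplus ≠ Tminus ∧
    IsRegularConfigTriangulation A Tplus ∧
    IsRegularConfigTriangulation A Tminus := by
  have h : IsCircuitDependence A lam :=
    .of_card_eq_finrank_add_two (by simpa using hcard) hspan hsupp hdep0 hdep hne
  have hTminus' : ∀ F, F ∈ Tminus ↔ (F ⊆ A ∧ ¬ ∀ a ∈ A, 0 < (-lam) a → a ∈ F) := by
    simpa using hTminus
  refine ⟨fun T => ⟨h.eq_plus_or_eq_minus hTplus hTminus, ?_⟩, h.plus_ne_minus hTplus hTminus,
    h.isRegularConfigTriangulation_plus hspan hTplus,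
    h.neg.isRegularConfigTriangulation_plus hspan hTminus'⟩
  rintro (rfl | rfl)
  exacts [h.isTriangulationOfConfig_plus hTplus, h.neg.isTriangulationOfConfig_plus hTminus']
end

section
/- Let A be a configuration of d+2 points spanning a d-dimensional affine space, with affine dependence λ unique up to scalar, A⁺ = {a : λ_a > 0}, A⁻ = {a : λ_a < 0}, and the two triangulations T⁺ = {F ⊆ A : A⁺ ⊄ F} and T⁻ = {F ⊆ A : A⁻ ⊄ F}. Then: (1) T⁺ (resp. T⁻) is flag if and only if |A⁺| ≤ 2 (resp. |A⁻| ≤ 2); (2) if A is a set of lattice points and λ is normalized to have coprime integer entries, and Λ_A denotes the affine lattice generated by A, then T⁺ (resp. T⁻) is unimodular with respect to Λ_A if and only if all positive (resp. negative) coefficients of λ are equal to 1 (resp. −1). -/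
section Helpers

variable {E : Type*}

/-- If `T` consists of the subsets of `A` not containing the nonempty set `{a ∈ A | P a}`, then
that set is the only possible minimal non-face, so `T` is flag iff it has at most two elements. -/
theorem isFlag_iff_of_mem_iff {A : Finset E} {P : E → Prop} {T : Finset (Finset E)}
    (hT : ∀ F, F ∈ T ↔ (F ⊆ A ∧ ¬ ∀ a ∈ A, P a → a ∈ F)) (hP : ∃ a ∈ A, P a) :
    IsFlag T ↔ ∃ x y, ∀ a ∈ A, P a → (a = x ∨ a = y) := by
  classical
  have mem_filter_iff : ∀ a, a ∈ A.filter P ↔ a ∈ A ∧ P a := fun a => Finset.mem_filter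
  constructor
  · intro h
    by_cases hN : MinNonFace T (A.filter P)
    · obtain ⟨x, y, -, hxy⟩ := Finset.card_eq_two.1 (h _ hN)
      exact ⟨x, y, fun a ha hPa => by
        simpa [hxy] using (mem_filter_iff a).2 ⟨ha, hPa⟩⟩
    · have hex : ∃ x ∈ A.filter P, ({x} : Finset E) ∉ T := by
        by_contra! hx
        refine hN ⟨hx, fun hmem => ((hT _).1 hmem).2 fun a ha hPa => (mem_filter_iff a).2 ⟨ha, hPa⟩,
          fun M hM => (hT M).2 ⟨hM.1.trans (Finset.filter_subset _ _), fun hall => hM.2 ?_⟩⟩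
        exact fun a ha => hall a ((mem_filter_iff a).1 ha).1 ((mem_filter_iff a).1 ha).2
      obtain ⟨x, hx, hxT⟩ := hex
      have hall : ∀ a ∈ A, P a → a ∈ ({x} : Finset E) := by
        by_contra hn
        exact hxT ((hT _).2 ⟨by simpa using ((mem_filter_iff x).1 hx).1, hn⟩)
      exact ⟨x, x, fun a ha hPa => Or.inl (by simpa using hall a ha hPa)⟩
  · rintro ⟨x, y, hxy⟩ N ⟨hsing, hN, hmin⟩
    have hNA : N ⊆ A := fun a ha => ((hT _).1 (hsing a ha)).1 (by simp)
    have hPN : ∀ a ∈ A, P a → a ∈ N := by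
      by_contra hn
      exact hN ((hT _).2 ⟨hNA, hn⟩)
    have hNeq : A.filter P = N := by
      by_contra hn
      have hss : A.filter P ⊂ N := Finset.ssubset_iff_subset_ne.2
        ⟨fun a ha => hPN a ((mem_filter_iff a).1 ha).1 ((mem_filter_iff a).1 ha).2, hn⟩
      exact ((hT _).1 (hmin _ hss)).2 fun a ha hPa => (mem_filter_iff a).2 ⟨ha, hPa⟩
    have hle : N.card ≤ 2 := by
      refine (Finset.card_le_card (t := {x, y}) fun a ha => ?_).trans Finset.card_le_two
      rw [← hNeq, mem_filter_iff] at ha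
      simpa using hxy a ha.1 ha.2
    have h0 : N.card ≠ 0 := by
      obtain ⟨a, ha, hPa⟩ := hP
      exact Finset.card_ne_zero_of_mem (hPN a ha hPa)
    have h1 : N.card ≠ 1 := by
      intro h1
      obtain ⟨z, rfl⟩ := Finset.card_eq_one.1 h1
      exact hN (hsing z (by simp))
    omega

/-- The maximal cells of the complex of subsets of `A` not containing `{a ∈ A | P a}` are the
complements of single points of that set. -/
theorem maxCell_iff_of_mem_iff [DecidableEq E] {A : Finset E} {P : E → Prop}
    {T : Finset (Finset E)} (hT : ∀ F, F ∈ T ↔ (F ⊆ A ∧ ¬ ∀ a ∈ A, P a → a ∈ F))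
    (F : Finset E) : MaxCell T F ↔ ∃ a ∈ A, P a ∧ F = A.erase a := by
  have herase : ∀ a ∈ A, P a → A.erase a ∈ T := fun a ha hPa =>
    (hT _).2 ⟨Finset.erase_subset _ _, fun h => Finset.notMem_erase a A (h a ha hPa)⟩
  constructor
  · rintro ⟨hF, hmax⟩
    obtain ⟨hFA, hn⟩ := (hT F).1 hF
    push Not at hn
    obtain ⟨a, ha, hPa, haF⟩ := hn
    exact ⟨a, ha, hPa, (hmax _ (herase a ha hPa) (Finset.subset_erase.2 ⟨hFA, haF⟩)).symm⟩
  · rintro ⟨a, ha, hPa, rfl⟩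
    refine ⟨herase a ha hPa, fun G hG hsub => ?_⟩
    obtain ⟨hGA, hn⟩ := (hT G).1 hG
    refine Finset.Subset.antisymm (Finset.subset_erase.2 ⟨hGA, fun haG => hn fun b hb _ => ?_⟩) hsub
    by_cases hba : b = a
    · exact hba ▸ haG
    · exact hsub (Finset.mem_erase.2 ⟨hba, hb⟩)

variable [AddCommGroup E] [Module ℝ E]

/-- A point with nonzero coefficient in an affine dependence lies in the affine span of the other
points. -/
theorem mem_affineSpan_erase_of_dependence [DecidableEq E] {A : Finset E} {l : E → ℝ}
    (h0 : ∑ a ∈ A, l a = 0) (h1 : ∑ a ∈ A, l a • a = 0) {a : E} (ha : a ∈ A) (hla : l a ≠ 0) :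
    a ∈ affineSpan ℝ ((A.erase a : Finset E) : Set E) := by
  have e0 := Finset.add_sum_erase A l ha
  have e1 := Finset.add_sum_erase A (fun b => l b • b) ha
  rw [h0] at e0
  rw [h1] at e1
  have hw : ∑ b ∈ A.erase a, -(l a)⁻¹ * l b = 1 := by
    rw [← Finset.mul_sum, eq_neg_of_add_eq_zero_right e0]
    field_simp
  have hmem := affineCombination_mem_affineSpan_image hw
    (s' := ((A.erase a : Finset E) : Set E)) (fun i hi hi' => absurd hi hi') (id : E → E)
  rw [Set.image_id, Finset.affineCombination_eq_linear_combination _ _ _ hw] at hmem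
  have hsum : ∑ b ∈ A.erase a, (-(l a)⁻¹ * l b) • id b = a := by
    simp only [mul_smul, id, ← Finset.smul_sum]
    rw [eq_neg_of_add_eq_zero_right e1, smul_neg, neg_smul, neg_neg, inv_smul_smul₀ hla]
  rwa [hsum] at hmem

/-- Deleting a point with nonzero coefficient in an affine dependence from a spanning
configuration of `dim + 2` points leaves an affinely independent set. -/
theorem affineIndependent_erase_of_dependence [DecidableEq E] [FiniteDimensional ℝ E]
    {A : Finset E} {l : E → ℝ} (hcard : A.card = Module.finrank ℝ E + 2)
    (hspan : affineSpan ℝ (A : Set E) = ⊤)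
    (h0 : ∑ a ∈ A, l a = 0) (h1 : ∑ a ∈ A, l a • a = 0) {a : E} (ha : a ∈ A) (hla : l a ≠ 0) :
    AffineIndependent ℝ (fun p : (A.erase a : Finset E) => (p : E)) := by
  have htop : affineSpan ℝ ((A.erase a : Finset E) : Set E) = ⊤ := by
    rw [← affineSpan_insert_eq_affineSpan ℝ (mem_affineSpan_erase_of_dependence h0 h1 ha hla),
      ← Finset.coe_insert, Finset.insert_erase ha, hspan]
  have hc : Fintype.card (A.erase a : Finset E) = Module.finrank ℝ E + 1 := by
    rw [Fintype.card_coe, Finset.card_erase_of_mem ha, hcard]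
    omega
  rw [affineIndependent_iff_finrank_vectorSpan_eq ℝ _ hc]
  have hr : Set.range (fun p : (A.erase a : Finset E) => (p : E))
      = ((A.erase a : Finset E) : Set E) := Subtype.range_coe
  rw [hr, ← direction_affineSpan, htop, AffineSubspace.direction_top, finrank_top]

theorem AffineIndependent.finset_eq_zero {F : Finset E}
    (hF : AffineIndependent ℝ (fun p : F => (p : E))) {w : E → ℝ} (h0 : ∑ b ∈ F, w b = 0)
    (h1 : ∑ b ∈ F, w b • b = 0) : ∀ b ∈ F, w b = 0 := fun b hb =>
  affineIndependent_iff.1 hF Finset.univ (fun p => w p)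
    ((Finset.sum_coe_sort F w).trans h0)
    ((Finset.sum_coe_sort F fun b => w b • b).trans h1) ⟨b, hb⟩ (Finset.mem_univ _)

/-- The simplex obtained by deleting `a` from a circuit is unimodular with respect to the lattice
generated by the circuit iff `a` has coefficient `±1` in the primitive integer dependence. -/
theorem unimodularFinset_erase_iff [DecidableEq E] [FiniteDimensional ℝ E]
    {A : Finset E} {l : E → ℤ} (hcard : A.card = Module.finrank ℝ E + 2)
    (hspan : affineSpan ℝ (A : Set E) = ⊤) (hsupp : ∀ a, a ∉ A → l a = 0)
    (h0 : ∑ a ∈ A, l a = 0) (h1 : ∑ a ∈ A, (l a : ℝ) • a = 0)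
    (hgcd : A.gcd (fun a => (l a).natAbs) = 1) {a : E} (ha : a ∈ A) (hla : l a ≠ 0) :
    UnimodularFinset (InAffLat A) (A.erase a) ↔ (l a).natAbs = 1 := by
  have h0' : ∑ a ∈ A, (l a : ℝ) = 0 := by exact_mod_cast h0
  have hla' : (l a : ℝ) ≠ 0 := by exact_mod_cast hla
  have hind := affineIndependent_erase_of_dependence hcard hspan h0' h1 ha hla'
  have e0 := Finset.add_sum_erase A (fun b => (l b : ℝ)) ha
  have e1 := Finset.add_sum_erase A (fun b => (l b : ℝ) • b) ha
  rw [h0'] at e0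
  rw [h1] at e1
  have hmemA : ∀ b ∈ A, InAffLat A b := fun b hb =>
    ⟨Pi.single b 1, fun x hx => Pi.single_eq_of_ne (by rintro rfl; exact hx hb) _,
      by simp [Finset.sum_pi_single', hb], by
        rw [Finset.sum_eq_single_of_mem b hb fun c _ hc => by simp [hc]]
        simp⟩
  constructor
  · rintro ⟨-, -, hU⟩
    obtain ⟨c, -, hc0, hc1⟩ := hU a (hmemA a ha) (mem_affineSpan_erase_of_dependence h0' h1 ha hla')
    have hc0' : ∑ b ∈ A.erase a, (c b : ℝ) = 1 := by exact_mod_cast hc0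
    have hz := hind.finset_eq_zero (w := fun b => (l a : ℝ) * c b + l b)
      (by rw [Finset.sum_add_distrib, ← Finset.mul_sum, hc0', mul_one, e0])
      (by simp only [add_smul, mul_smul, Finset.sum_add_distrib, ← Finset.smul_sum]
          rw [hc1, e1])
    rw [← Nat.dvd_one, ← hgcd]
    refine Finset.dvd_gcd fun b hb => Int.natAbs_dvd_natAbs.2 ?_
    by_cases hba : b = a
    · rw [hba]
    · have hb0 : l a * c b + l b = 0 := by
        exact_mod_cast hz b (Finset.mem_erase.2 ⟨hba, hb⟩)
      exact ⟨-c b, by linarith⟩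
  · intro habs
    have hsq : l a * l a = 1 := by rw [← Int.natAbs_mul_self' (l a), habs]; norm_num
    refine ⟨fun b hb => hmemA b (Finset.mem_of_mem_erase hb), hind, ?_⟩
    rintro x ⟨c, hcs, hc0, hc1⟩ -
    have hva : c a - c a * l a * l a = 0 := by rw [mul_assoc, hsq]; ring
    refine ⟨fun b => c b - c a * l a * l b, fun b hb => ?_, ?_, ?_⟩
    · by_cases hba : b = a
      · rw [hba]
        exact hva
      · have hbA : b ∉ A := fun h => hb (Finset.mem_erase.2 ⟨hba, h⟩)
        simp [hcs b hbA, hsupp b hbA]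
    · rw [Finset.sum_erase A hva, Finset.sum_sub_distrib, ← Finset.mul_sum, h0, hc0]
      ring
    · rw [Finset.sum_erase A (by simp only [hva, Int.cast_zero, zero_smul])]
      push_cast
      simp only [sub_smul, mul_smul, Finset.sum_sub_distrib, ← Finset.smul_sum]
      rw [h1, hc1]
      simp

theorem isUnimodular_iff_of_mem_iff [FiniteDimensional ℝ E]
    {A : Finset E} {l : E → ℤ} (hcard : A.card = Module.finrank ℝ E + 2)
    (hspan : affineSpan ℝ (A : Set E) = ⊤) (hsupp : ∀ a, a ∉ A → l a = 0)
    (h0 : ∑ a ∈ A, l a = 0) (h1 : ∑ a ∈ A, (l a : ℝ) • a = 0)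
    (hgcd : A.gcd (fun a => (l a).natAbs) = 1) {P : E → Prop} (hP : ∀ a, P a → l a ≠ 0)
    {T : Finset (Finset E)} (hT : ∀ F, F ∈ T ↔ (F ⊆ A ∧ ¬ ∀ a ∈ A, P a → a ∈ F)) :
    IsUnimodular (InAffLat A) T ↔ ∀ a ∈ A, P a → (l a).natAbs = 1 := by
  classical
  have hU := fun a (ha : a ∈ A) (hPa : P a) =>
    unimodularFinset_erase_iff hcard hspan hsupp h0 h1 hgcd ha (hP a hPa)
  constructor
  · exact fun h a ha hPa =>
      (hU a ha hPa).1 (h _ ((maxCell_iff_of_mem_iff hT _).2 ⟨a, ha, hPa, rfl⟩))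
  · intro h F hF
    obtain ⟨a, ha, hPa, rfl⟩ := (maxCell_iff_of_mem_iff hT F).1 hF
    exact (hU a ha hPa).2 (h a ha hPa)

end Helpers

/-- **Flagness and unimodularity for the two triangulations of a circuit.**
Let `A` be a configuration of `d + 2` points affinely spanning `ℝ^d` with affine
dependence `λ`, and let `T⁺ = {F ⊆ A : A⁺ ⊄ F}`, `T⁻ = {F ⊆ A : A⁻ ⊄ F}` be its two
triangulations.  Then (1) `T⁺` (resp. `T⁻`) is flag iff `|A⁺| ≤ 2` (resp. `|A⁻| ≤ 2`);
(2) if `A` consists of lattice points and `λ` is normalized to have coprime integer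
entries, then `T⁺` (resp. `T⁻`) is unimodular with respect to the affine lattice `Λ_A`
generated by `A` iff all positive (resp. negative) entries of `λ` equal `1` (resp. `-1`). -/
theorem circuit_flag_and_unimodular {d : ℕ}
    (A : Finset (Fin d → ℝ)) (lam : (Fin d → ℝ) → ℝ)
    (hcard : A.card = d + 2)
    (hspan : affineSpan ℝ (A : Set (Fin d → ℝ)) = ⊤)
    (hsupp : ∀ a, a ∉ A → lam a = 0)
    (hdep0 : ∑ a ∈ A, lam a = 0)
    (hdep : ∑ a ∈ A, lam a • a = 0)
    (hne : ∃ a ∈ A, lam a ≠ 0)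
    (Tplus Tminus : Finset (Finset (Fin d → ℝ)))
    (hTplus : ∀ F, F ∈ Tplus ↔ (F ⊆ A ∧ ¬ ∀ a ∈ A, 0 < lam a → a ∈ F))
    (hTminus : ∀ F, F ∈ Tminus ↔ (F ⊆ A ∧ ¬ ∀ a ∈ A, lam a < 0 → a ∈ F)) :
    -- (1) flagness
    ((IsFlag Tplus ↔ ∃ x y, ∀ a ∈ A, 0 < lam a → (a = x ∨ a = y)) ∧
     (IsFlag Tminus ↔ ∃ x y, ∀ a ∈ A, lam a < 0 → (a = x ∨ a = y))) ∧
    -- (2) unimodularity with respect to the affine lattice generated by `A`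
    (∀ lamInt : (Fin d → ℝ) → ℤ,
      (∀ a ∈ A, Zd a) →
      (∀ a, a ∉ A → lamInt a = 0) →
      (∑ a ∈ A, lamInt a) = 0 →
      (∑ a ∈ A, (lamInt a : ℝ) • a) = 0 →
      (∀ a, (0 < lam a ↔ 0 < lamInt a) ∧ (lam a < 0 ↔ lamInt a < 0)) →
      A.gcd (fun a => (lamInt a).natAbs) = 1 →
      ((IsUnimodular (InAffLat A) Tplus ↔ ∀ a ∈ A, 0 < lamInt a → lamInt a = 1) ∧
       (IsUnimodular (InAffLat A) Tminus ↔ ∀ a ∈ A, lamInt a < 0 → lamInt a = -1))) := by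
  have hpos : ∃ a ∈ A, 0 < lam a :=
    Finset.exists_pos_of_sum_zero_of_exists_nonzero lam hdep0 hne
  have hneg : ∃ a ∈ A, lam a < 0 := by
    obtain ⟨a, ha, hla⟩ := Finset.exists_pos_of_sum_zero_of_exists_nonzero (fun a => -lam a)
      (by rw [Finset.sum_neg_distrib, hdep0, neg_zero])
      (hne.imp fun a h => ⟨h.1, neg_ne_zero.2 h.2⟩)
    exact ⟨a, ha, neg_pos.1 hla⟩
  refine ⟨⟨isFlag_iff_of_mem_iff hTplus hpos, isFlag_iff_of_mem_iff hTminus hneg⟩, ?_⟩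
  intro l _ hs h0 h1 hsign hgcd
  have hcard' : A.card = Module.finrank ℝ (Fin d → ℝ) + 2 := by simpa using hcard
  constructor
  · rw [isUnimodular_iff_of_mem_iff hcard' hspan hs h0 h1 hgcd
      (fun a ha => ((hsign a).1.1 ha).ne') hTplus]
    refine forall₂_congr fun a _ => ?_
    rw [(hsign a).1]
    exact forall_congr' fun h => by omega
  · rw [isUnimodular_iff_of_mem_iff hcard' hspan hs h0 h1 hgcd
      (fun a ha => ((hsign a).2.1 ha).ne) hTminus]
    refine forall₂_congr fun a _ => ?_
    rw [(hsign a).2]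
    exact forall_congr' fun h => by omega
end
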